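/- There are exactly 158 equivalence classes of bordered double circulant self-dual binary codes of length 92 with minimum weight at least 16 (each such code has minimum weight exactly 16), where two codes are equivalent if one is obtained from the other by a permutation of coordinates. -/

import Mathlib

/-- The standard inner product on `ι → ZMod 2`. -/
def dot {ι : Type*} [Fintype ι] (x y : ι → ZMod 2) : ZMod 2 := ∑ i, x i * y i

/-- A binary linear code is self-dual if it coincides with its dual. -/
def IsSelfDual {ι : Type*} [Fintype ι] (C : Submodule (ZMod 2) (ι → ZMod 2)) : Prop :=
  ∀ x, x ∈ C ↔ ∀ y ∈ C, dot x y = 0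

/-- `C` has minimum (nonzero) weight exactly `d`. -/
def MinWeightIs {ι : Type*} [Fintype ι] (C : Submodule (ZMod 2) (ι → ZMod 2)) (d : ℕ) : Prop :=
  (∃ x ∈ C, x ≠ 0 ∧ hammingNorm x = d) ∧ ∀ x ∈ C, x ≠ 0 → d ≤ hammingNorm x

/-- `A_i(C)`: the number of codewords of `C` of Hamming weight `i`. -/
noncomputable def weightEnum {ι : Type*} [Fintype ι] (C : Submodule (ZMod 2) (ι → ZMod 2)) (i : ℕ) : ℕ :=
  Set.ncard {x : ι → ZMod 2 | x ∈ C ∧ hammingNorm x = i}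

/-- Two codes are equivalent if a coordinate permutation maps one onto the other. -/
def CodeEquiv {ι : Type*} [Fintype ι] (C C' : Submodule (ZMod 2) (ι → ZMod 2)) : Prop :=
  ∃ σ : Equiv.Perm ι, Submodule.map (LinearMap.funLeft (ZMod 2) (ZMod 2) ⇑σ) C = C'

/-- The order of the automorphism group of a code: the number of coordinate
permutations mapping the code onto itself. -/
noncomputable def autGroupOrder {ι : Type*} [Fintype ι] (C : Submodule (ZMod 2) (ι → ZMod 2)) : ℕ :=
  Nat.card {σ : Equiv.Perm ι // Submodule.map (LinearMap.funLeft (ZMod 2) (ZMod 2) ⇑σ) C = C}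

/-- A circulant matrix: each row is the cyclic shift of the previous one. -/
def IsCirculant {n : ℕ} (R : Matrix (Fin n) (Fin n) (ZMod 2)) : Prop :=
  ∃ v : Fin n → ZMod 2, R = Matrix.circulant v

/-- The pure double circulant code with generator matrix `(I_n | R)`. -/
def pureDCC {n : ℕ} (R : Matrix (Fin n) (Fin n) (ZMod 2)) :
    Submodule (ZMod 2) (Fin n ⊕ Fin n → ZMod 2) :=
  Submodule.span (ZMod 2)
    (Set.range fun i : Fin n =>
      Sum.elim (fun j => if j = i then (1 : ZMod 2) else 0) (R i))

/-- A bordered matrix: first row `(0,1,…,1)`, first column `(0,1,…,1)ᵀ`, and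
lower-right block an `n × n` circulant matrix. -/
def IsBorderMatrix {n : ℕ} (B : Matrix (Fin (n + 1)) (Fin (n + 1)) (ZMod 2)) : Prop :=
  B 0 0 = 0 ∧ (∀ j, j ≠ 0 → B 0 j = 1) ∧ (∀ i, i ≠ 0 → B i 0 = 1) ∧
  ∃ R' : Matrix (Fin n) (Fin n) (ZMod 2), IsCirculant R' ∧
    ∀ i j : Fin n, B i.succ j.succ = R' i j

/-- The bordered double circulant code with generator matrix `(I_{n+1} | B)`. -/
def borderedDCC {n : ℕ} (B : Matrix (Fin (n + 1)) (Fin (n + 1)) (ZMod 2)) :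
    Submodule (ZMod 2) (Fin (n + 1) ⊕ Fin (n + 1) → ZMod 2) :=
  Submodule.span (ZMod 2)
    (Set.range fun i : Fin (n + 1) =>
      Sum.elim (fun j => if j = i then (1 : ZMod 2) else 0) (B i))


namespace BD

abbrev A := AddMonoidAlgebra (ZMod 2) (ZMod 45)

noncomputable def ofFn (f : ZMod 45 → ZMod 2) : A := ⟨Finsupp.equivFunOnFinite.symm f⟩

@[simp] theorem coeff_ofFn (f : ZMod 45 → ZMod 2) (i : ZMod 45) : (ofFn f).coeff i = f i := rfl

theorem A_ext {s t : A} (h : ∀ i, s.coeff i = t.coeff i) : s = t := by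
  apply AddMonoidAlgebra.ext
  exact Finsupp.ext h

theorem coeff_mul' (s t : A) (k : ZMod 45) :
    (s * t).coeff k = ∑ i, s.coeff i * t.coeff (k - i) := by
  rw [AddMonoidAlgebra.coeff_mul_apply_left, Finsupp.sum_fintype]
  · refine Finset.sum_congr rfl fun i _ => ?_
    rw [neg_add_eq_sub]
  · simp

theorem coeff_one' (k : ZMod 45) : (1 : A).coeff k = if k = 0 then 1 else 0 := by
  rw [AddMonoidAlgebra.one_def, AddMonoidAlgebra.coeff_single, Finsupp.single_apply]
  simp [eq_comm]

noncomputable def st (s : A) : A := ofFn fun i => s.coeff (-i)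

@[simp] theorem coeff_st (s : A) (i : ZMod 45) : (st s).coeff i = s.coeff (-i) := rfl

theorem st_mul (s t : A) : st (s * t) = st s * st t := by
  apply A_ext; intro k
  rw [coeff_st, coeff_mul', coeff_mul', ← Equiv.sum_comp (Equiv.neg (ZMod 45))]
  refine Finset.sum_congr rfl fun i _ => ?_
  simp only [Equiv.neg_apply, coeff_st]
  congr 2
  ring

@[simp] theorem st_st (s : A) : st (st s) = s := by
  apply A_ext; intro k; simp

theorem st_one : st 1 = 1 := by
  apply A_ext; intro k; rw [coeff_st, coeff_one', coeff_one']; simp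

theorem st_add (s t : A) : st (s + t) = st s + st t := by
  apply A_ext; intro k; simp

theorem st_pow (s : A) (n : ℕ) : st (s ^ n) = st s ^ n := by
  induction n with
  | zero => simp [st_one]
  | succ n ih => rw [pow_succ, pow_succ, st_mul, ih]

noncomputable def X (c : ZMod 45) : A := AddMonoidAlgebra.single c 1

theorem coeff_X_mul (c : ZMod 45) (s : A) (k : ZMod 45) : (X c * s).coeff k = s.coeff (k - c) := by
  rw [X, AddMonoidAlgebra.coeff_single_mul_apply, one_mul, neg_add_eq_sub]

theorem X_add (c d : ZMod 45) : X (c + d) = X c * X d := by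
  simp [X, AddMonoidAlgebra.single_mul_single]

theorem X_zero : X 0 = 1 := by rw [X, AddMonoidAlgebra.one_def]

theorem coeff_X (c k : ZMod 45) : (X c).coeff k = if k = c then 1 else 0 := by
  rw [X, AddMonoidAlgebra.coeff_single, Finsupp.single_apply]; simp [eq_comm]

theorem st_X (c : ZMod 45) : st (X c) = X (-c) := by
  apply A_ext; intro k; rw [coeff_st, coeff_X, coeff_X]; simp [neg_eq_iff_eq_neg]

theorem X_pow (c : ZMod 45) (n : ℕ) : X c ^ n = X (n * c) := by
  induction n with
  | zero => simp [X_zero]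
  | succ n ih => rw [pow_succ, ih, ← X_add]; congr 1; push_cast; ring

theorem add_self (s : A) : s + s = 0 := by
  apply A_ext; intro k
  simpa using CharTwo.add_self_eq_zero (s.coeff k)

theorem add_sq' (s t : A) : (s + t) ^ 2 = s ^ 2 + t ^ 2 := by
  have := add_self (s * t)
  calc (s + t) ^ 2 = s ^ 2 + t ^ 2 + (s * t + s * t) := by ring
  _ = _ := by rw [this, add_zero]

theorem coeff_sq (s : A) : ∀ i, (s ^ 2).coeff (2 * i) = s.coeff i := by
  induction s using AddMonoidAlgebra.induction_linear with
  | zero => intro i; simp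
  | add a b ha hb => intro i; rw [add_sq']; simp [ha, hb]
  | single m r =>
    intro i
    rw [sq, AddMonoidAlgebra.single_mul_single, AddMonoidAlgebra.coeff_single,
      AddMonoidAlgebra.coeff_single, Finsupp.single_apply, Finsupp.single_apply]
    have h1 : (m + m = 2 * i) ↔ m = i := by
      rw [← two_mul]
      constructor
      · intro h
        have := congrArg (fun z => (23 : ZMod 45) * z) h
        simp only [← mul_assoc] at this
        rw [show (23 : ZMod 45) * 2 = 1 from by decide] at this
        simpa using this
      · rintro rfl; rfl
    have h2 : r * r = r := by revert r; decide
    simp [h1, h2]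

/-! ### spread encoding -/

def bs : ℕ := 4096

def dig (f : ℕ → ℕ) (n : ℕ) : ℕ := ∑ i ∈ Finset.range n, f i * 4096 ^ i

theorem dig_succ (f : ℕ → ℕ) (n : ℕ) : dig f (n + 1) = f 0 + 2 ^ 12 * dig (fun i => f (i + 1)) n := by
  unfold dig
  rw [Finset.sum_range_succ', Finset.mul_sum, add_comm]
  congr 1
  · simp
  · refine Finset.sum_congr rfl fun i _ => ?_
    rw [pow_succ]; ring

theorem land_split (a b c d : ℕ) (ha : a < 2 ^ 12) (hc : c < 2 ^ 12) :
    (a + 2 ^ 12 * b) &&& (c + 2 ^ 12 * d) = (a &&& c) + 2 ^ 12 * (b &&& d) := by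
  have hac : (a &&& c) < 2 ^ 12 := Nat.lt_of_le_of_lt Nat.and_le_left ha
  apply Nat.eq_of_testBit_eq
  intro i
  rw [Nat.testBit_and, add_comm a, add_comm c, add_comm (a &&& c), Nat.testBit_two_pow_mul_add _ ha,
    Nat.testBit_two_pow_mul_add _ hc, Nat.testBit_two_pow_mul_add _ hac]
  split <;> simp

theorem xor_split (a b c d : ℕ) (ha : a < 2 ^ 12) (hc : c < 2 ^ 12) :
    (a + 2 ^ 12 * b) ^^^ (c + 2 ^ 12 * d) = (a ^^^ c) + 2 ^ 12 * (b ^^^ d) := by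
  have hac : (a ^^^ c) < 2 ^ 12 := Nat.xor_lt_two_pow ha hc
  apply Nat.eq_of_testBit_eq
  intro i
  rw [Nat.testBit_xor, add_comm a, add_comm c, add_comm (a ^^^ c), Nat.testBit_two_pow_mul_add _ ha,
    Nat.testBit_two_pow_mul_add _ hc, Nat.testBit_two_pow_mul_add _ hac]
  split <;> simp

theorem dig_land (f g : ℕ → ℕ) (n : ℕ) (hf : ∀ i, f i < 2 ^ 12) (hg : ∀ i, g i < 2 ^ 12) :
    dig f n &&& dig g n = dig (fun i => f i &&& g i) n := by
  induction n generalizing f g with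
  | zero => simp [dig]
  | succ n ih =>
    rw [dig_succ, dig_succ, dig_succ, land_split _ _ _ _ (hf 0) (hg 0), ih _ _ (fun i => hf _) fun i => hg _]

theorem dig_xor (f g : ℕ → ℕ) (n : ℕ) (hf : ∀ i, f i < 2 ^ 12) (hg : ∀ i, g i < 2 ^ 12) :
    dig f n ^^^ dig g n = dig (fun i => f i ^^^ g i) n := by
  induction n generalizing f g with
  | zero => simp [dig]
  | succ n ih =>
    rw [dig_succ, dig_succ, dig_succ, xor_split _ _ _ _ (hf 0) (hg 0), ih _ _ (fun i => hf _) fun i => hg _]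

theorem dig_lt (f : ℕ → ℕ) (n : ℕ) (hf : ∀ i, f i < 2 ^ 12) : dig f n < 4096 ^ n := by
  induction n generalizing f with
  | zero => simp [dig]
  | succ n ih =>
    rw [dig_succ, pow_succ]
    have := ih (fun i => f (i + 1)) (fun i => hf _)
    have := hf 0
    omega

theorem dig_lt' (f : ℕ → ℕ) (n : ℕ) (hf : ∀ i, f i + 1 < 2 ^ 12) : dig f (n + 1) < 4096 ^ (n + 1) - 1 := by
  rw [dig_succ, pow_succ]
  have := dig_lt (fun i => f (i + 1)) n (fun i => by have := hf (i + 1); omega)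
  have := hf 0
  omega

theorem dig_digit (f : ℕ → ℕ) (n : ℕ) (hf : ∀ i, f i < 2 ^ 12) (i : ℕ) (hi : i < n) :
    dig f n / 4096 ^ i % 4096 = f i := by
  induction n generalizing f i with
  | zero => omega
  | succ n ih =>
    rw [dig_succ]
    have h0 := hf 0
    cases i with
    | zero => simp; omega
    | succ i =>
      rw [pow_succ' 4096 i, ← Nat.div_div_eq_div_mul]
      rw [show (f 0 + 2 ^ 12 * dig (fun i => f (i + 1)) n) / 4096 = dig (fun i => f (i + 1)) n by omega]
      exact ih (fun i => f (i + 1)) (fun i => hf _) i (by omega)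

theorem dig_mod (f : ℕ → ℕ) (n : ℕ) : dig f n % 4095 = (∑ i ∈ Finset.range n, f i) % 4095 := by
  unfold dig
  rw [Finset.sum_nat_mod, Finset.sum_nat_mod (Finset.range n) 4095 f]
  congr 1
  refine Finset.sum_congr rfl fun i _ => ?_
  have : 4096 ^ i % 4095 = 1 := by
    rw [Nat.pow_mod]; simp
  rw [Nat.mul_mod, this]; simp

theorem dig_congr {f g : ℕ → ℕ} {n : ℕ} (h : ∀ i < n, f i = g i) : dig f n = dig g n :=
  Finset.sum_congr rfl fun i hi => by rw [h i (Finset.mem_range.1 hi)]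

/-- encoding of natural-valued functions -/
def encF (f : ZMod 45 → ℕ) : ℕ := ∑ k : ZMod 45, f k * 4096 ^ k.val

theorem encF_dig (f : ZMod 45 → ℕ) : encF f = dig (fun i => f (i : ZMod 45)) 45 := by
  unfold encF dig
  rw [Finset.sum_range]
  refine Finset.sum_congr rfl fun (i : Fin 45) _ => ?_
  have h : ((i.val : ℕ) : ZMod 45) = (i : ZMod 45) := ZMod.natCast_zmod_val (n := 45) i
  show f i * 4096 ^ i.val = f ((i.val : ℕ) : ZMod 45) * 4096 ^ i.val
  rw [h]

def conv (f g : ZMod 45 → ℕ) (k : ZMod 45) : ℕ := ∑ i, f i * g (k - i)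

theorem encF_mul_modEq (f g : ZMod 45 → ℕ) :
    encF f * encF g ≡ encF (conv f g) [MOD 4096 ^ 45 - 1] := by
  have h1 : ∀ i j : ZMod 45, 4096 ^ i.val * 4096 ^ j.val ≡ 4096 ^ (i + j).val [MOD 4096 ^ 45 - 1] := by
    intro i j
    rw [ZMod.val_add, ← pow_add]
    conv_lhs => rw [← Nat.div_add_mod (i.val + j.val) 45, pow_add, pow_mul]
    have : (4096 ^ 45) ^ ((i.val + j.val) / 45) ≡ 1 ^ ((i.val + j.val) / 45) [MOD 4096 ^ 45 - 1] := by
      apply Nat.ModEq.pow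
      exact ((Nat.modEq_iff_dvd' (by norm_num)).2 (by norm_num)).symm
    simpa using this.mul_right _
  have h2 : encF (conv f g) = ∑ i, ∑ j, f i * g j * 4096 ^ (i + j).val := by
    unfold encF conv
    simp_rw [Finset.sum_mul]
    rw [Finset.sum_comm]
    refine Finset.sum_congr rfl fun i _ => ?_
    rw [← Equiv.sum_comp (Equiv.addLeft i)]
    refine Finset.sum_congr rfl fun j _ => ?_
    simp
  rw [h2]
  unfold encF
  rw [Finset.sum_mul_sum]
  refine Nat.ModEq.sum fun i _ => Nat.ModEq.sum fun j _ => ?_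
  have := (h1 i j).mul_left (f i * g j)
  calc _ = f i * g j * (4096 ^ i.val * 4096 ^ j.val) := by ring
    _ ≡ _ [MOD _] := this

theorem encF_lt (f : ZMod 45 → ℕ) (hf : ∀ i, f i + 1 < 2 ^ 12) : encF f < 4096 ^ 45 - 1 := by
  rw [encF_dig]; exact dig_lt' _ 44 fun i => hf _

theorem encF_mul (f g : ZMod 45 → ℕ) (h : ∀ k, conv f g k + 1 < 2 ^ 12) :
    encF f * encF g % (4096 ^ 45 - 1) = encF (conv f g) := by
  rw [encF_mul_modEq f g, Nat.mod_eq_of_lt (encF_lt _ h)]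

def mask : ℕ := 0x1001001001001001001001001001001001001001001001001001001001001001001001001001001001001001001001001001001001001001001001001001001001001

def md : ℕ := 0xfffffffffffffffffffffffffffffffffffffffffffffffffffffffffffffffffffffffffffffffffffffffffffffffffffffffffffffffffffffffffffffffffffffff

theorem md_eq : md = 4096 ^ 45 - 1 := by decide +kernel

theorem mask_eq : mask = dig (fun _ => 1) 45 := by decide +kernel

def bit (s : A) (i : ZMod 45) : ℕ := (s.coeff i).val

theorem bit_le (s : A) (i : ZMod 45) : bit s i ≤ 1 := by
  have := ZMod.val_lt (s.coeff i); unfold bit; omega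

noncomputable def enc (s : A) : ℕ := encF (bit s)

theorem bit_eq_iff {a b : ZMod 2} : a = b ↔ a.val = b.val := by
  constructor
  · rintro rfl; rfl
  · intro h; exact ZMod.val_injective 2 h

theorem enc_digit (s : A) (i : ZMod 45) : enc s / 4096 ^ i.val % 4096 = bit s i := by
  unfold enc
  rw [encF_dig, dig_digit _ _ (fun i => by have := bit_le s i; omega) _ (ZMod.val_lt i)]
  rw [ZMod.natCast_zmod_val]

theorem enc_inj {s t : A} (h : enc s = enc t) : s = t := by
  apply A_ext; intro i
  rw [bit_eq_iff]
  show bit s i = bit t i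
  rw [← enc_digit, h, enc_digit]

theorem conv_le (f g : ZMod 45 → ℕ) (hf : ∀ i, f i ≤ 1) (hg : ∀ i, g i ≤ 1) (k : ZMod 45) : conv f g k ≤ 45 := by
  unfold conv
  calc _ ≤ ∑ i : ZMod 45, 1 := Finset.sum_le_sum fun i _ => by
        have := hf i; have := hg (k - i); nlinarith
    _ = 45 := by simp

theorem encF_land_mask (f : ZMod 45 → ℕ) (hf : ∀ i, f i < 2 ^ 12) : encF f &&& mask = encF fun i => f i % 2 := by
  rw [encF_dig, mask_eq, dig_land _ _ _ (fun i => hf _) (fun _ => by norm_num), encF_dig]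
  simp [Nat.and_one_is_mod]

def mulI (a b : ℕ) : ℕ := Nat.mod (Nat.mul a b) md

def mulN (a b : ℕ) : ℕ := Nat.land (mulI a b) mask

theorem mulI_eq (a b : ℕ) : mulI a b = a * b % (4096 ^ 45 - 1) := by
  rw [← md_eq]; rfl

theorem mulN_eq (a b : ℕ) : mulN a b = (a * b % (4096 ^ 45 - 1)) &&& mask := by
  rw [← mulI_eq]; rfl

theorem enc_conv (s t : A) : mulI (enc s) (enc t) = encF (conv (bit s) (bit t)) := by
  rw [mulI_eq]
  exact encF_mul _ _ fun k => by
    have := conv_le _ _ (bit_le s) (bit_le t) k; omega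

theorem enc_mul (s t : A) : enc (s * t) = mulN (enc s) (enc t) := by
  have h2 : mulN (enc s) (enc t) = encF (fun i => conv (bit s) (bit t) i % 2) := by
    rw [← encF_land_mask _ fun k => by
      have := conv_le _ _ (bit_le s) (bit_le t) k; omega]
    exact congrArg (fun z => Nat.land z mask) (enc_conv s t)
  rw [h2, enc]
  refine congrArg encF (funext fun k => ?_)
  unfold bit conv
  have h3 : (s * t).coeff k = ((∑ i, (s.coeff i).val * (t.coeff (k - i)).val : ℕ) : ZMod 2) := by
    rw [coeff_mul']
    push_cast
    refine Finset.sum_congr rfl fun i _ => ?_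
    simp
  rw [h3, ZMod.val_natCast]

theorem enc_add (s t : A) : enc (s + t) = Nat.xor (enc s) (enc t) := by
  show _ = enc s ^^^ enc t
  unfold enc
  rw [encF_dig, encF_dig, encF_dig, dig_xor _ _ _ (fun i => by have := bit_le s i; omega) (fun i => by have := bit_le t i; omega)]
  apply dig_congr
  intro i _
  unfold bit
  show ((s + t).coeff _).val = _
  rw [show (s + t).coeff (i : ZMod 45) = s.coeff (i : ZMod 45) + t.coeff (i : ZMod 45) from by simp]
  generalize s.coeff (i : ZMod 45) = a
  generalize t.coeff (i : ZMod 45) = b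
  revert a b; decide

noncomputable def ofN (n : ℕ) : A := ofFn fun i => ((n / 4096 ^ i.val % 4096 : ℕ) : ZMod 2)

theorem dig_div (n k : ℕ) : dig (fun i => n / 4096 ^ i % 4096) k = n % 4096 ^ k := by
  induction k with
  | zero => simp [dig, Nat.mod_one]
  | succ k ih =>
    unfold dig at *
    rw [Finset.sum_range_succ, ih, pow_succ, Nat.mod_mul]; ring

theorem enc_ofN {n : ℕ} (h : Nat.land n mask = n) : enc (ofN n) = n := by
  have h' : n &&& mask = n := h
  have hlt : n < 4096 ^ 45 := by
    rw [← h']; refine lt_of_le_of_lt Nat.and_le_right ?_; decide +kernel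
  have h1 : dig (fun i => n / 4096 ^ i % 4096) 45 = n := by
    rw [dig_div, Nat.mod_eq_of_lt hlt]
  have h2 : dig (fun i => (n / 4096 ^ i % 4096) % 2) 45 = n := by
    have h3 := dig_land (fun i => n / 4096 ^ i % 4096) (fun _ => 1) 45
      (fun i => Nat.mod_lt _ (by norm_num)) (fun _ => by norm_num)
    rw [h1, ← mask_eq, h'] at h3
    simp only [Nat.and_one_is_mod] at h3
    exact h3.symm
  conv_rhs => rw [← h2]
  unfold enc
  rw [encF_dig]
  apply dig_congr
  intro i hi
  show (((n / 4096 ^ (i : ZMod 45).val % 4096 : ℕ) : ZMod 2)).val = _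
  rw [ZMod.val_natCast, ZMod.val_natCast, Nat.mod_eq_of_lt hi]

theorem enc_lt (s : A) : enc s < 4096 ^ 45 - 1 := encF_lt _ fun i => by have := bit_le s i; omega

theorem land_mask_enc (s : A) : Nat.land (enc s) mask = enc s := by
  show enc s &&& mask = _
  unfold enc
  rw [encF_land_mask _ fun i => by have := bit_le s i; omega]
  congr 1; funext i; have := bit_le s i; omega

/-- weight -/
def wt (s : A) : ℕ := ∑ i, bit s i

theorem wt_le (s : A) : wt s ≤ 45 := by
  unfold wt
  calc _ ≤ ∑ i : ZMod 45, 1 := Finset.sum_le_sum fun i _ => bit_le s i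
    _ = 45 := by simp

theorem enc_mod (s : A) : Nat.mod (enc s) 4095 = wt s := by
  show enc s % 4095 = _
  have h : ∑ i ∈ Finset.range 45, bit s (i : ZMod 45) = wt s := by
    unfold wt
    rw [Finset.sum_range]
    refine Finset.sum_congr rfl fun (i : Fin 45) _ => ?_
    have h : ((i.val : ℕ) : ZMod 45) = (i : ZMod 45) := ZMod.natCast_zmod_val (n := 45) i
    rw [h]
  unfold enc
  rw [encF_dig, dig_mod, h, Nat.mod_eq_of_lt]
  have := wt_le s; omega

theorem enc_one : enc 1 = 1 := by
  have : (1 : A) = ofN 1 := by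
    apply A_ext; intro k
    rw [coeff_one']
    show _ = ((1 / 4096 ^ k.val % 4096 : ℕ) : ZMod 2)
    revert k; decide +kernel
  rw [this, enc_ofN (by decide +kernel)]

theorem enc_zero : enc 0 = 0 := by
  unfold enc encF bit; simp

def powN : ℕ → ℕ → ℕ → ℕ
  | 0, _, _ => 1
  | f + 1, a, n => bif Nat.beq n 0 then 1 else
      bif Nat.beq (Nat.mod n 2) 1 then mulN a (powN f (mulN a a) (Nat.div n 2))
      else powN f (mulN a a) (Nat.div n 2)

theorem enc_pow (f : ℕ) (s : A) (n : ℕ) (h : n < 2 ^ f) : enc (s ^ n) = powN f (enc s) n := by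
  induction f generalizing s n with
  | zero =>
    have : n = 0 := by simpa using h
    subst this; simp [powN, enc_one]
  | succ f ih =>
    unfold powN
    have ih' := ih (s * s) (n / 2) (by rw [pow_succ] at h; omega)
    rw [enc_mul] at ih'
    rcases Nat.eq_zero_or_pos n with h0 | h0
    · subst h0; simp [enc_one]
    have hb : Nat.beq n 0 = false := by
      cases n with
      | zero => omega
      | succ n => rfl
    rw [hb]
    simp only [cond_false]
    have hd : Nat.div n 2 = n / 2 := rfl
    have hmm : Nat.mod n 2 = n % 2 := rfl
    rw [hd, hmm, ← ih', ← sq, ← pow_mul, ← enc_mul]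
    rcases Nat.mod_two_eq_zero_or_one n with h1 | h1
    · rw [h1, show Nat.beq 0 1 = false from rfl, cond_false]
      exact congrArg (fun m => enc (s ^ m)) (by omega)
    · rw [h1, show Nat.beq 1 1 = true from rfl, cond_true]
      rw [← pow_succ']
      exact congrArg (fun m => enc (s ^ m)) (by omega)

end BD

namespace BD
open Finset

def zf (i : Fin 45) : ZMod 45 := i

noncomputable def Bm (σ : A) : Matrix (Fin 46) (Fin 46) (ZMod 2) :=
  Matrix.of (Fin.cons (Fin.cons 0 fun _ => 1)
    fun i : Fin 45 => (Fin.cons 1 fun j : Fin 45 => 1 + σ.coeff (zf i - zf j) : Fin 46 → ZMod 2))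

@[simp] theorem Bm_00 (σ : A) : Bm σ 0 0 = 0 := rfl
@[simp] theorem Bm_0s (σ : A) (j : Fin 45) : Bm σ 0 j.succ = 1 := rfl
@[simp] theorem Bm_s0 (σ : A) (i : Fin 45) : Bm σ i.succ 0 = 1 := rfl
@[simp] theorem Bm_ss (σ : A) (i j : Fin 45) : Bm σ i.succ j.succ = 1 + σ.coeff (zf i - zf j) := rfl

theorem isBorder_Bm (σ : A) : IsBorderMatrix (n := 45) (Bm σ) := by
  refine ⟨rfl, ?_, ?_, Matrix.circulant (fun i => 1 + σ.coeff (zf i)), ⟨_, rfl⟩, ?_⟩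
  · intro j hj
    obtain ⟨j, rfl⟩ := Fin.exists_succ_eq.2 hj
    rfl
  · intro j hj
    obtain ⟨j, rfl⟩ := Fin.exists_succ_eq.2 hj
    rfl
  · intro i j; rfl

theorem exists_Bm {B : Matrix (Fin 46) (Fin 46) (ZMod 2)} (h : IsBorderMatrix (n := 45) B) :
    ∃ σ : A, B = Bm σ := by
  obtain ⟨h0, h1, h2, R, ⟨v, rfl⟩, hR⟩ := h
  refine ⟨ofFn fun i => 1 + v i, ?_⟩
  ext i j
  refine Fin.cases ?_ (fun i => ?_) i <;> refine Fin.cases ?_ (fun j => ?_) j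
  · exact h0
  · exact h1 _ (Fin.succ_ne_zero _)
  · exact h2 _ (Fin.succ_ne_zero _)
  · rw [hR, Bm_ss, coeff_ofFn, ← add_assoc, CharTwo.add_self_eq_zero, zero_add]
    rfl

theorem mem_bordered {n : ℕ} (B : Matrix (Fin (n + 1)) (Fin (n + 1)) (ZMod 2)) (x : Fin (n + 1) ⊕ Fin (n + 1) → ZMod 2) :
    x ∈ borderedDCC B ↔ ∀ j, x (Sum.inr j) = ∑ i, x (Sum.inl i) * B i j := by
  unfold borderedDCC
  constructor
  · intro h
    induction h using Submodule.span_induction with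
    | mem y hy =>
      obtain ⟨i, rfl⟩ := hy
      intro j
      simp
    | zero => intro j; simp
    | add a b _ _ ha hb => intro j; simp [ha, hb, add_mul, Finset.sum_add_distrib]
    | smul c a _ ha => intro j; simp [ha, Finset.mul_sum, mul_assoc]
  · intro h
    have : x = ∑ i, x (Sum.inl i) • (Sum.elim (fun j => if j = i then (1 : ZMod 2) else 0) (B i) : Fin (n + 1) ⊕ Fin (n + 1) → ZMod 2) := by
      funext k
      rcases k with k | k
      · simp [Finset.sum_apply]
      · rw [h k]; simp [Finset.sum_apply]
    rw [this]
    exact Submodule.sum_mem _ fun i _ => Submodule.smul_mem _ _ (Submodule.subset_span ⟨i, rfl⟩)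

abbrev V := Fin 46 ⊕ Fin 46 → ZMod 2

noncomputable def code (σ : A) : Submodule (ZMod 2) V := borderedDCC (n := 45) (Bm σ)

noncomputable def aug (s : A) : ZMod 2 := ∑ i, s.coeff i

theorem sum_zf {M : Type*} [AddCommMonoid M] (f : ZMod 45 → M) : ∑ i : Fin 45, f (zf i) = ∑ i, f i := rfl

theorem sum_zf_neg {M : Type*} [AddCommMonoid M] (f : ZMod 45 → M) : ∑ i : Fin 45, f (-zf i) = ∑ i, f i := by
  rw [sum_zf fun i => f (-i)]
  exact Equiv.sum_comp (Equiv.neg (ZMod 45)) f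

noncomputable def word (σ : A) (a : ZMod 2) (S : A) : V :=
  Sum.elim (Fin.cons a fun i : Fin 45 => S.coeff (-zf i))
    (Fin.cons (aug S) fun j : Fin 45 => a + aug S + (S * σ).coeff (-zf j))

theorem key_sum (σ S : A) (j : Fin 45) :
    ∑ i : Fin 45, S.coeff (-zf i) * (1 + σ.coeff (zf i - zf j)) = aug S + (S * σ).coeff (-zf j) := by
  rw [coeff_mul', aug, ← Finset.sum_add_distrib, ← sum_zf_neg]
  refine Finset.sum_congr rfl fun i _ => ?_
  rw [show -zf j - -zf i = zf i - zf j by ring]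
  ring

theorem mem_code (σ : A) (x : V) : x ∈ code σ ↔ ∃ a S, x = word σ a S := by
  unfold code
  rw [mem_bordered]
  constructor
  · intro h
    refine ⟨x (Sum.inl 0), ofFn fun i => x (Sum.inl (Fin.succ (-i : ZMod 45))), ?_⟩
    set S := ofFn fun i => x (Sum.inl (Fin.succ (-i : ZMod 45))) with hS
    have hl : ∀ i : Fin 45, x (Sum.inl i.succ) = S.coeff (-zf i) := by
      intro i
      show _ = x (Sum.inl (Fin.succ (- -(i : ZMod 45))))
      rw [neg_neg (i : ZMod 45)]
    funext k
    rcases k with k | k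
    · refine Fin.cases rfl (fun i => ?_) k
      exact hl i
    · rw [h k, Fin.sum_univ_succ]
      refine Fin.cases ?_ (fun j => ?_) k
      · simp only [Bm_00, Bm_s0, mul_zero, zero_add, mul_one, hl]
        exact sum_zf_neg S.coeff
      · simp only [Bm_0s, Bm_ss, hl, mul_one, key_sum]
        show _ = x (Sum.inl 0) + aug S + (S * σ).coeff (-zf j)
        ring
  · rintro ⟨a, S, rfl⟩ j
    rw [Fin.sum_univ_succ]
    refine Fin.cases ?_ (fun j => ?_) j
    · simp only [Bm_00, Bm_s0, mul_zero, zero_add, mul_one]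
      exact (sum_zf_neg S.coeff).symm
    · simp only [Bm_0s, Bm_ss, mul_one]
      have := key_sum σ S j
      show a + aug S + (S * σ).coeff (-zf j) = a + ∑ i : Fin 45, S.coeff (-zf i) * (1 + σ.coeff (zf i - zf j))
      rw [this]; ring

theorem val_ite (a : ZMod 2) : (if a ≠ 0 then 1 else 0) = a.val := by revert a; decide

theorem hamming_val {ι : Type*} [Fintype ι] (x : ι → ZMod 2) : hammingNorm x = ∑ i, (x i).val := by
  unfold hammingNorm
  rw [Finset.card_filter]
  exact Finset.sum_congr rfl fun i _ => val_ite _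

theorem hamming_word (σ : A) (a : ZMod 2) (S : A) :
    hammingNorm (word σ a S) = a.val + wt S + ((aug S).val + ∑ j, (a + aug S + (S * σ).coeff j).val) := by
  rw [hamming_val, Fintype.sum_sum_type, Fin.sum_univ_succ, Fin.sum_univ_succ]
  have h1 := sum_zf_neg fun i => (S.coeff i).val
  have h2 := sum_zf_neg fun j => (a + aug S + (S * σ).coeff j).val
  unfold wt bit
  rw [← h1, ← h2]
  rfl

theorem sum_one_add (P : A) : ∑ j, ((1 : ZMod 2) + P.coeff j).val + wt P = 45 := by
  unfold wt bit
  rw [← Finset.sum_add_distrib]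
  have : ∀ a : ZMod 2, (1 + a).val + a.val = 1 := by decide
  simp [this]

theorem aug_val (S : A) : (aug S).val = wt S % 2 := by
  unfold wt bit aug
  rw [← ZMod.val_natCast]
  refine congrArg ZMod.val ?_
  push_cast
  exact Finset.sum_congr rfl fun i _ => by simp

theorem aug_cases (S : A) : (aug S = 0 ∧ wt S % 2 = 0) ∨ (aug S = 1 ∧ wt S % 2 = 1) := by
  have h := aug_val S
  generalize aug S = a at *
  have ha : a = 0 ∨ a = 1 := by clear h; revert a; decide
  rcases ha with rfl | rfl
  · left; exact ⟨rfl, h.symm⟩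
  · right; exact ⟨rfl, h.symm⟩

theorem aug_mul (S T : A) : aug (S * T) = aug S * aug T := by
  unfold aug
  simp_rw [coeff_mul']
  rw [Finset.sum_comm, Finset.sum_mul]
  refine Finset.sum_congr rfl fun i _ => ?_
  rw [← Finset.mul_sum]
  exact congrArg (fun z => S.coeff i * z) (Equiv.sum_comp (Equiv.subRight i) T.coeff)

theorem wt_eq_zero {S : A} (h : wt S = 0) : S = 0 := by
  apply A_ext; intro i
  unfold wt at h
  rw [Finset.sum_eq_zero_iff] at h
  have := h i (Finset.mem_univ i)
  rw [bit_eq_iff]; exact this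

def Good (σ : A) : Prop := ∀ S : A, S ≠ 0 → (wt S % 2 = 0 → 16 ≤ wt S + wt (S * σ)) ∧
  (wt S % 2 = 1 → 14 ≤ wt S + wt (S * σ)) ∧ wt (S * σ) ≤ 30 + wt S

theorem hw00 (σ S : A) (h : wt S % 2 = 0) : hammingNorm (word σ 0 S) = wt S + wt (S * σ) := by
  rw [hamming_word]
  rcases aug_cases S with ⟨h1, h2⟩ | ⟨h1, h2⟩
  · rw [h1]; simp [wt, bit]
  · omega

theorem hw01 (σ S : A) (h : wt S % 2 = 1) : hammingNorm (word σ 1 S) = wt S + wt (S * σ) + 2 := by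
  rw [hamming_word]
  rcases aug_cases S with ⟨h1, h2⟩ | ⟨h1, h2⟩
  · omega
  · rw [h1]
    have : (1 : ZMod 2) + 1 = 0 := by decide
    have h3 : ZMod.val (1 : ZMod 2) = 1 := rfl
    rw [this, h3]; simp [wt, bit]; ring

theorem hw10 (σ S : A) (h : wt S % 2 = 0) : hammingNorm (word σ 1 S) + wt (S * σ) = wt S + 46 := by
  rw [hamming_word]
  have := sum_one_add (S * σ)
  rcases aug_cases S with ⟨h1, h2⟩ | ⟨h1, h2⟩
  · have h3 : ZMod.val (1 : ZMod 2) = 1 := rfl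
    have h4 : ZMod.val (0 : ZMod 2) = 0 := rfl
    rw [h1, h3, add_zero, h4]; omega
  · omega

theorem hw11 (σ S : A) (h : wt S % 2 = 1) : hammingNorm (word σ 0 S) + wt (S * σ) = wt S + 46 := by
  rw [hamming_word]
  have := sum_one_add (S * σ)
  rcases aug_cases S with ⟨h1, h2⟩ | ⟨h1, h2⟩
  · omega
  · have h3 : ZMod.val (1 : ZMod 2) = 1 := rfl
    have h4 : ZMod.val (0 : ZMod 2) = 0 := rfl
    rw [h1, zero_add, h3, h4]; omega

theorem word_ne_zero (σ : A) (a : ZMod 2) {S : A} (hS : S ≠ 0) : word σ a S ≠ 0 := by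
  intro h
  apply hS
  apply A_ext; intro i
  have := congrFun h (Sum.inl (Fin.succ (-i : ZMod 45)))
  have h2 : word σ a S (Sum.inl (Fin.succ (-i : ZMod 45))) = S.coeff (- (-i)) := rfl
  rw [h2, neg_neg] at this
  simpa using this

theorem zm2 (a : ZMod 2) : a = 0 ∨ a = 1 := by revert a; decide

theorem good_iff (σ : A) : (∀ x ∈ code σ, x ≠ 0 → 16 ≤ hammingNorm x) ↔ Good σ := by
  constructor
  · intro h S hS
    have hm : ∀ a, 16 ≤ hammingNorm (word σ a S) := fun a =>
      h _ ((mem_code _ _).2 ⟨a, S, rfl⟩) (word_ne_zero σ a hS)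
    have h0 := hm 0
    have h1 := hm 1
    rcases Nat.mod_two_eq_zero_or_one (wt S) with h2 | h2
    · have e1 := hw00 σ S h2
      have e2 := hw10 σ S h2
      omega
    · have e1 := hw01 σ S h2
      have e2 := hw11 σ S h2
      omega
  · intro h x hx hx0
    obtain ⟨a, S, rfl⟩ := (mem_code _ _).1 hx
    by_cases hS : S = 0
    · subst hS
      rcases zm2 a with rfl | rfl
      · exfalso; apply hx0
        funext k
        rcases k with k | k
        · refine Fin.cases rfl (fun i => rfl) k
        · refine Fin.cases ?_ (fun i => ?_) k
          · show aug 0 = 0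
            simp [aug]
          · show 0 + aug 0 + (0 * σ).coeff _ = 0
            simp [aug]
      · have := hw10 σ 0 (by simp [wt, bit])
        have h2 : wt (0 * σ) = 0 := by simp [wt, bit]
        omega
    obtain ⟨g1, g2, g3⟩ := h S hS
    rcases Nat.mod_two_eq_zero_or_one (wt S) with h2 | h2
    · have e1 := hw00 σ S h2
      have e2 := hw10 σ S h2
      rcases zm2 a with rfl | rfl <;> omega
    · have e1 := hw01 σ S h2
      have e2 := hw11 σ S h2
      rcases zm2 a with rfl | rfl <;> omega

/-! ### self-duality -/

theorem dot_sum {n : ℕ} (x y : Fin n ⊕ Fin n → ZMod 2) :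
    dot x y = ∑ i, x (Sum.inl i) * y (Sum.inl i) + ∑ i, x (Sum.inr i) * y (Sum.inr i) := by
  unfold dot; rw [Fintype.sum_sum_type]

theorem selfdual_iff {n : ℕ} (B : Matrix (Fin (n + 1)) (Fin (n + 1)) (ZMod 2)) :
    IsSelfDual (borderedDCC B) ↔ B * B.transpose = 1 := by
  have hrow : ∀ i, (Sum.elim (fun j => if j = i then (1 : ZMod 2) else 0) (B i) : Fin (n + 1) ⊕ Fin (n + 1) → ZMod 2) ∈ borderedDCC B := by
    intro i; exact Submodule.subset_span ⟨i, rfl⟩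
  constructor
  · intro h
    ext i k
    have h1 := (h _).1 (hrow i) _ (hrow k)
    rw [dot_sum] at h1
    simp only [Sum.elim_inl, Sum.elim_inr, mul_ite, mul_one, mul_zero, Finset.sum_ite_eq', Finset.mem_univ, if_true] at h1
    rw [Matrix.mul_apply, Matrix.one_apply]
    simp only [Matrix.transpose_apply]
    have h2 := CharTwo.add_eq_zero.1 h1
    rw [← h2]
    by_cases hik : i = k
    · simp [hik]
    · simp [hik, Ne.symm hik]
  · intro h
    have h' : B.transpose * B = 1 := mul_eq_one_comm.1 h
    have key : ∀ x : Fin (n + 1) ⊕ Fin (n + 1) → ZMod 2, x ∈ borderedDCC B ↔ (fun j => x (Sum.inr j)) = Matrix.vecMul (fun i => x (Sum.inl i)) B := by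
      intro x; rw [mem_bordered, funext_iff]; rfl
    intro x
    constructor
    · intro hx y hy
      rw [key] at hx hy
      rw [dot_sum]
      show (fun i => x (Sum.inl i)) ⬝ᵥ (fun i => y (Sum.inl i)) + (fun i => x (Sum.inr i)) ⬝ᵥ (fun i => y (Sum.inr i)) = 0
      rw [hx, hy, ← Matrix.dotProduct_mulVec, ← Matrix.mulVec_transpose, Matrix.mulVec_mulVec, h, Matrix.one_mulVec]
      exact CharTwo.add_self_eq_zero _
    · intro hx
      rw [key]
      have h2 : (fun i => x (Sum.inl i)) = Matrix.mulVec B (fun j => x (Sum.inr j)) := by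
        funext i
        have := hx _ (hrow i)
        rw [dot_sum] at this
        simp only [Sum.elim_inl, Sum.elim_inr, mul_ite, mul_one, mul_zero, Finset.sum_ite_eq', Finset.mem_univ, if_true] at this
        have h2 := CharTwo.add_eq_zero.1 this
        rw [h2]
        exact Finset.sum_congr rfl fun j _ => mul_comm _ _
      rw [h2, ← Matrix.mulVec_transpose, Matrix.mulVec_mulVec, h', Matrix.one_mulVec]

theorem coeff_mul_st (σ : A) (i k : ZMod 45) :
    (σ * st σ).coeff (i - k) = ∑ j, σ.coeff (i - j) * σ.coeff (k - j) := by
  rw [coeff_mul', ← Equiv.sum_comp (Equiv.subLeft i)]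
  refine Finset.sum_congr rfl fun j _ => ?_
  simp only [Equiv.subLeft_apply, coeff_st]
  congr 2
  ring

theorem BBt_ss (σ : A) (i k : Fin 45) : (Bm σ * (Bm σ).transpose) i.succ k.succ = (σ * st σ).coeff (zf i - zf k) := by
  rw [Matrix.mul_apply, Fin.sum_univ_succ]
  simp only [Matrix.transpose_apply, Bm_s0, Bm_ss]
  rw [coeff_mul_st, sum_zf fun j => (1 + σ.coeff (zf i - j)) * (1 + σ.coeff (zf k - j))]
  have e : ∀ i : ZMod 45, ∑ j, σ.coeff (i - j) = ∑ j, σ.coeff j := fun i => Equiv.sum_comp (Equiv.subLeft i) _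
  have : ∑ j, (1 + σ.coeff (zf i - j)) * (1 + σ.coeff (zf k - j)) = ∑ j : ZMod 45, (1 : ZMod 2) + ∑ j, σ.coeff (zf i - j) + ∑ j, σ.coeff (zf k - j) + ∑ j, σ.coeff (zf i - j) * σ.coeff (zf k - j) := by
    rw [← Finset.sum_add_distrib, ← Finset.sum_add_distrib, ← Finset.sum_add_distrib]
    exact Finset.sum_congr rfl fun j _ => by ring
  rw [this, e, e, add_assoc (∑ j : ZMod 45, (1 : ZMod 2)), CharTwo.add_self_eq_zero]
  have h1 : ∑ j : ZMod 45, (1 : ZMod 2) = 1 := by simp; decide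
  rw [h1, add_zero, ← add_assoc, one_mul, CharTwo.add_self_eq_zero, zero_add]

theorem aug_st (σ : A) : aug (st σ) = aug σ := Equiv.sum_comp (Equiv.neg (ZMod 45)) σ.coeff

theorem aug_one : aug 1 = 1 := by unfold aug; simp [coeff_one']

theorem aug_unitary {σ : A} (h : σ * st σ = 1) : aug σ = 1 := by
  have := congrArg aug h
  rw [aug_mul, aug_st, aug_one] at this
  revert this; generalize aug σ = a; revert a; decide

theorem selfdual_code (σ : A) : IsSelfDual (code σ) ↔ σ * st σ = 1 := by
  unfold code
  rw [selfdual_iff]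
  constructor
  · intro h
    apply A_ext; intro k
    have := BBt_ss σ (k : ZMod 45) (0 : ZMod 45)
    rw [h] at this
    have e : zf k - zf (0 : ZMod 45) = k := sub_zero k
    rw [e] at this
    rw [← this, Matrix.one_apply, coeff_one']
    by_cases hk : k = 0
    · subst hk; simp
    · rw [if_neg hk, if_neg]
      intro hh; exact hk (Fin.succ_injective _ hh)
  · intro h
    have h45 : (45 : ZMod 2) = 1 := by decide
    have haug := aug_unitary h
    have hs : ∀ i : Fin 45, ∑ j : Fin 45, (1 + σ.coeff (zf i - zf j)) = 0 := by
      intro i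
      rw [sum_zf fun j => 1 + σ.coeff (zf i - j), Finset.sum_add_distrib,
        show ∑ j, σ.coeff (zf i - j) = aug σ from Equiv.sum_comp (Equiv.subLeft (zf i)) σ.coeff]
      rw [haug]; simp; decide
    ext i k
    refine Fin.cases ?_ (fun i => ?_) i <;> refine Fin.cases ?_ (fun k => ?_) k
    · rw [Matrix.mul_apply, Fin.sum_univ_succ]
      simp [h45]
    · rw [Matrix.mul_apply, Fin.sum_univ_succ]
      simp only [Matrix.transpose_apply, Bm_00, Bm_0s, Bm_ss, zero_mul, one_mul, zero_add, hs]
      rw [Matrix.one_apply_ne (Fin.succ_ne_zero _).symm]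
    · rw [Matrix.mul_apply, Fin.sum_univ_succ]
      simp only [Matrix.transpose_apply, Bm_00, Bm_0s, Bm_ss, mul_zero, mul_one, zero_add, hs]
      rw [Matrix.one_apply_ne (Fin.succ_ne_zero _)]
    · rw [BBt_ss, h, coeff_one', Matrix.one_apply]
      by_cases hk : i = k
      · subst hk; simp
      · rw [if_neg, if_neg]
        · intro hh; exact hk (Fin.succ_injective _ hh)
        · intro hh; exact hk (sub_eq_zero.1 hh)

/-! ### equivalence -/

theorem ce_refl {ι : Type*} [Fintype ι] (C : Submodule (ZMod 2) (ι → ZMod 2)) : CodeEquiv C C := by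
  refine ⟨1, ?_⟩
  ext x
  simp only [Submodule.mem_map]
  constructor
  · rintro ⟨y, hy, rfl⟩; exact hy
  · intro hx; exact ⟨x, hx, rfl⟩

theorem ce_symm {ι : Type*} [Fintype ι] {C D : Submodule (ZMod 2) (ι → ZMod 2)} (h : CodeEquiv C D) : CodeEquiv D C := by
  obtain ⟨p, rfl⟩ := h
  refine ⟨p⁻¹, ?_⟩
  ext x
  simp only [Submodule.mem_map]
  constructor
  · rintro ⟨y, ⟨z, hz, rfl⟩, rfl⟩
    convert hz using 1
    funext i; simp [LinearMap.funLeft]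
  · intro hx; refine ⟨_, ⟨x, hx, rfl⟩, ?_⟩
    funext i; simp [LinearMap.funLeft]

theorem ce_trans {ι : Type*} [Fintype ι] {C D E : Submodule (ZMod 2) (ι → ZMod 2)} (h : CodeEquiv C D) (h' : CodeEquiv D E) : CodeEquiv C E := by
  obtain ⟨p, rfl⟩ := h
  obtain ⟨q, rfl⟩ := h'
  refine ⟨p * q, ?_⟩
  rw [← Submodule.map_comp]
  rfl

theorem ce_mem {ι : Type*} [Fintype ι] {C D : Submodule (ZMod 2) (ι → ZMod 2)} (p : Equiv.Perm ι)
    (h : Submodule.map (LinearMap.funLeft (ZMod 2) (ZMod 2) ⇑p) C = D) (x : ι → ZMod 2) : (x ∘ p ∈ D) ↔ x ∈ C := by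
  subst h
  simp only [Submodule.mem_map]
  constructor
  · rintro ⟨y, hy, h⟩
    have : y = x := by
      funext i
      have := congrFun h (p⁻¹ i)
      simpa [LinearMap.funLeft] using this
    exact this ▸ hy
  · intro hx; exact ⟨x, hx, rfl⟩

theorem hamming_comp {ι : Type*} [Fintype ι] (p : Equiv.Perm ι) (x : ι → ZMod 2) : hammingNorm (x ∘ p) = hammingNorm x := by
  rw [hamming_val, hamming_val]
  exact Equiv.sum_comp p fun i => (x i).val

theorem dot_comp {ι : Type*} [Fintype ι] (p : Equiv.Perm ι) (x y : ι → ZMod 2) : dot (x ∘ p) (y ∘ p) = dot x y :=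
  Equiv.sum_comp p fun i => x i * y i

theorem ce_of_matrix {n : ℕ} (B B' : Matrix (Fin (n + 1)) (Fin (n + 1)) (ZMod 2)) (α β : Equiv.Perm (Fin (n + 1)))
    (h : ∀ i j, B (α i) (β j) = B' i j) : CodeEquiv (borderedDCC B) (borderedDCC B') := by
  refine ⟨Equiv.sumCongr α β, ?_⟩
  ext x
  simp only [Submodule.mem_map]
  have key : ∀ y, y ∈ borderedDCC B ↔ (LinearMap.funLeft (ZMod 2) (ZMod 2) (Equiv.sumCongr α β)) y ∈ borderedDCC B' := by
    intro y
    rw [mem_bordered, mem_bordered, ← β.forall_congr_right]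
    refine forall_congr' fun j => ?_
    rw [← Equiv.sum_comp α]
    simp only [h]
    rfl
  constructor
  · rintro ⟨y, hy, rfl⟩
    exact (key y).1 hy
  · intro hx
    refine ⟨x ∘ (Equiv.sumCongr α β).symm, ?_, ?_⟩
    · rw [key]
      convert hx using 1
      funext i
      simp [LinearMap.funLeft]
    · funext i
      simp [LinearMap.funLeft]

theorem ce_code (σ τ : A) (m m' c : ZMod 45) (hm : m * m' = 1) (h : ∀ i, σ.coeff (m * i + c) = τ.coeff i) :
    CodeEquiv (code σ) (code τ) := by
  have hm' : m' * m = 1 := by rw [mul_comm]; exact hm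
  let e1 : Equiv.Perm (ZMod 45) := ⟨fun i => m * i, fun i => m' * i,
    fun i => by simp only [← mul_assoc, hm', one_mul], fun i => by simp only [← mul_assoc, hm, one_mul]⟩
  let e2 : Equiv.Perm (ZMod 45) := e1.trans (Equiv.subRight c)
  let lift : Equiv.Perm (ZMod 45) → Equiv.Perm (Fin 46) := fun e =>
    ⟨Fin.cons 0 fun i => Fin.succ (e i : ZMod 45), Fin.cons 0 fun i => Fin.succ (e.symm i : ZMod 45),
      fun i => Fin.cases rfl (fun i => congrArg Fin.succ (e.symm_apply_apply i)) i,
      fun i => Fin.cases rfl (fun i => congrArg Fin.succ (e.apply_symm_apply i)) i⟩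
  refine ce_of_matrix _ _ (lift e1) (lift e2) ?_
  intro i j
  refine Fin.cases ?_ (fun i => ?_) i <;> refine Fin.cases ?_ (fun j => ?_) j
  · rfl
  · rfl
  · rfl
  · show 1 + σ.coeff (m * zf i - (m * zf j - c)) = 1 + τ.coeff (zf i - zf j)
    rw [← h]
    congr 2
    ring

theorem ce_X (c : ZMod 45) (σ : A) : CodeEquiv (code (X c * σ)) (code σ) := by
  refine ce_code _ _ 1 1 c (by ring) fun i => ?_
  rw [coeff_X_mul]; congr 1; ring

theorem ce_sq (σ : A) : CodeEquiv (code (σ ^ 2)) (code σ) := by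
  refine ce_code _ _ 2 23 0 (by decide) fun i => ?_
  rw [add_zero, coeff_sq]

theorem ce_st (σ : A) : CodeEquiv (code (st σ)) (code σ) := by
  refine ce_code _ _ (-1) (-1) 0 (by decide) fun i => ?_
  rw [coeff_st]; congr 1; ring

theorem ce_good {σ τ : A} (h : CodeEquiv (code σ) (code τ)) (hg : Good σ) : Good τ := by
  rw [← good_iff] at *
  obtain ⟨p, h⟩ := ce_symm h
  intro x hx hx0
  have := (ce_mem p h x).2 hx
  have := hg _ this (by
    intro h0; apply hx0; funext i
    have := congrFun h0 (p⁻¹ i)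
    simpa using this)
  rwa [hamming_comp] at this

end BD

namespace BD
open Finset

set_option linter.constructorNameAsVariable false
set_option maxRecDepth 100000

theorem ofFn_coeff (s : A) : ofFn s.coeff = s := A_ext fun _ => rfl

instance finA : Finite A :=
  Finite.of_surjective (fun f : ZMod 45 → ZMod 2 => ofFn f) fun s => ⟨s.coeff, ofFn_coeff s⟩

noncomputable instance fintypeA : Fintype A := Fintype.ofFinite A

noncomputable instance : DecidableEq A := Classical.decEq _

def shadow {ι : Type*} [Fintype ι] (C : Submodule (ZMod 2) (ι → ZMod 2)) (x : ι → ZMod 2) : Prop :=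
  ∀ c ∈ C, (dot x c).val = hammingNorm c / 2 % 2

open Classical in
noncomputable def sh14 (C : Submodule (ZMod 2) V) : Finset V :=
  univ.filter fun x => shadow C x ∧ hammingNorm x = 14

noncomputable def lam (C : Submodule (ZMod 2) V) (p q : Fin 46 ⊕ Fin 46) : ℕ :=
  ∑ x ∈ sh14 C, (x p).val * (x q).val

noncomputable def inv (C : Submodule (ZMod 2) V) : ℕ := ∑ p, ∑ q, lam C p q ^ 3

theorem inv_ce {C D : Submodule (ZMod 2) V} (h : CodeEquiv C D) : inv C = inv D := by
  obtain ⟨p, h⟩ := h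
  have hsh : ∀ x, shadow C x ↔ shadow D (x ∘ p) := by
    intro x
    constructor
    · intro hx c hc
      have hc' : c = (c ∘ p.symm) ∘ p := by funext i; simp
      rw [hc'] at hc ⊢
      rw [ce_mem p h] at hc
      rw [dot_comp, hamming_comp]
      exact hx _ hc
    · intro hx c hc
      have := hx _ ((ce_mem p h c).2 hc)
      rwa [dot_comp, hamming_comp] at this
  have hl : ∀ i j, lam C (p i) (p j) = lam D i j := by
    intro i j
    unfold lam
    refine Finset.sum_nbij' (fun x => x ∘ p) (fun x => x ∘ p.symm) ?_ ?_ ?_ ?_ ?_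
    · intro x hx
      simp only [sh14, mem_filter, mem_univ, true_and] at hx ⊢
      rw [← hsh, hamming_comp]; exact hx
    · intro x hx
      simp only [sh14, mem_filter, mem_univ, true_and] at hx ⊢
      rw [hsh, hamming_comp]
      have hc' : (x ∘ p.symm) ∘ p = x := by funext i; simp
      rw [hc']; exact hx
    · intro x _; funext i; simp
    · intro x _; funext i; simp
    · intro x _; rfl
  unfold inv
  rw [← Equiv.sum_comp p]
  refine Finset.sum_congr rfl fun i _ => ?_
  rw [← Equiv.sum_comp p]
  exact Finset.sum_congr rfl fun j _ => by rw [hl]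

/-! shadow of our codes -/

noncomputable def uu : V := Sum.elim (fun _ => 1) fun _ => 0

theorem hamming_add {ι : Type*} [Fintype ι] (x y : ι → ZMod 2) :
    hammingNorm (x + y) + 2 * ∑ i, (x i * y i).val = hammingNorm x + hammingNorm y := by
  rw [hamming_val, hamming_val, hamming_val, Finset.mul_sum, ← Finset.sum_add_distrib, ← Finset.sum_add_distrib]
  refine Finset.sum_congr rfl fun i _ => ?_
  rw [Pi.add_apply]
  generalize x i = a; generalize y i = b
  revert a b; decide

theorem dot_val {ι : Type*} [Fintype ι] (x y : ι → ZMod 2) : (∑ i, (x i * y i).val) % 2 = (dot x y).val := by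
  rw [← ZMod.val_natCast]
  refine congrArg ZMod.val ?_
  push_cast
  exact Finset.sum_congr rfl fun i _ => by simp

theorem dot_add {ι : Type*} [Fintype ι] (u x y : ι → ZMod 2) : dot u (x + y) = dot u x + dot u y := by
  unfold dot; rw [← Finset.sum_add_distrib]; exact Finset.sum_congr rfl fun i _ => by simp [mul_add]

theorem add_dot {ι : Type*} [Fintype ι] (u x y : ι → ZMod 2) : dot (x + y) u = dot x u + dot y u := by
  unfold dot; rw [← Finset.sum_add_distrib]; exact Finset.sum_congr rfl fun i _ => by simp [add_mul]

theorem uu_row (σ : A) (i : Fin 46) : dot uu (Sum.elim (fun j => if j = i then (1 : ZMod 2) else 0) (Bm σ i)) = 1 := by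
  rw [dot_sum]; simp [uu]

theorem row_norm (σ : A) (h4 : wt σ % 4 = 1) (i : Fin 46) :
    hammingNorm (Sum.elim (fun j => if j = i then (1 : ZMod 2) else 0) (Bm σ i)) % 4 = 2 := by
  rw [hamming_val, Fintype.sum_sum_type]
  have h1 : ∑ j, ((Sum.elim (fun j => if j = i then (1 : ZMod 2) else 0) (Bm σ i) (Sum.inl j) : ZMod 2)).val = 1 := by
    simp only [Sum.elim_inl]
    rw [Finset.sum_eq_single i]
    · simp; rfl
    · intro b _ hb; simp [hb]
    · simp
  rw [h1, Fin.sum_univ_succ]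
  simp only [Sum.elim_inr]
  refine Fin.cases ?_ (fun i => ?_) i
  · have h3 : ZMod.val (1 : ZMod 2) = 1 := rfl
    simp [h3]
  · have h3 : ZMod.val (1 : ZMod 2) = 1 := rfl
    simp only [Bm_s0, Bm_ss, h3]
    have h5 := sum_one_add σ
    have h6 : ∑ j : Fin 45, (1 + σ.coeff (zf i - zf j)).val = ∑ j, ((1 : ZMod 2) + σ.coeff j).val :=
      Equiv.sum_comp (Equiv.subLeft (zf i)) fun j => ((1 : ZMod 2) + σ.coeff j).val
    rw [h6]; omega

theorem code_norm {σ : A} (hu : σ * st σ = 1) (h4 : wt σ % 4 = 1) (c : V) (hc : c ∈ code σ) :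
    hammingNorm c % 4 = 2 * (dot uu c).val := by
  have hsd := (selfdual_code σ).2 hu
  unfold code borderedDCC at hc
  induction hc using Submodule.span_induction with
  | mem y hy =>
    obtain ⟨i, rfl⟩ := hy
    rw [uu_row, row_norm σ h4]; rfl
  | zero => simp [dot]
  | add a b ha hb iha ihb =>
    have h1 := hamming_add a b
    have h2 := dot_val a b
    rw [(hsd a).1 ha b hb] at h2
    have h3 : (∑ i, (a i * b i).val) % 2 = 0 := h2
    rw [dot_add]
    have h5 : ∀ p q : ZMod 2, 2 * (p + q).val % 4 = (2 * p.val + 2 * q.val) % 4 := by decide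
    have h6 := h5 (dot uu a) (dot uu b)
    have h7 : (dot uu a + dot uu b).val < 2 := ZMod.val_lt _
    omega
  | smul r a ha iha =>
    rcases zm2 r with rfl | rfl
    · simp [dot]
    · rw [one_smul]; exact iha

theorem shadow_iff {σ : A} (hu : σ * st σ = 1) (h4 : wt σ % 4 = 1) (x : V) :
    shadow (code σ) x ↔ uu + x ∈ code σ := by
  have hsd := (selfdual_code σ).2 hu
  rw [hsd]
  unfold shadow
  refine forall_congr' fun c => forall_congr' fun hc => ?_
  have h1 := code_norm hu h4 c hc
  have h7 : (dot uu c).val < 2 := ZMod.val_lt _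
  have h2 : hammingNorm c / 2 % 2 = (dot uu c).val := by omega
  rw [h2, ← bit_eq_iff, add_dot]
  generalize dot uu c = a; generalize dot x c = b
  revert a b; decide

noncomputable def J : A := ofFn fun _ => 1

theorem J_mul {σ : A} (h : aug σ = 1) : J * σ = J := by
  apply A_ext; intro k
  rw [coeff_mul']
  simp only [J, coeff_ofFn, one_mul]
  rw [← h]
  exact Equiv.sum_comp (Equiv.subLeft k) σ.coeff

noncomputable def sw (σ : A) (a : ZMod 2) (S : A) : V :=
  Sum.elim (Fin.cons a fun i : Fin 45 => S.coeff (-zf i))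
    (Fin.cons (1 + aug S) fun j : Fin 45 => 1 + a + aug S + (S * σ).coeff (-zf j))

theorem aug_add (S T : A) : aug (S + T) = aug S + aug T := by
  unfold aug; rw [← Finset.sum_add_distrib]; exact Finset.sum_congr rfl fun i _ => by simp

theorem aug_J : aug J = 1 := by unfold aug J; simp; decide

theorem uu_sw {σ : A} (h : aug σ = 1) (a : ZMod 2) (S : A) : uu + sw σ a S = word σ (1 + a) (J + S) := by
  funext k
  have e2 : ∀ b : ZMod 2, 1 + 1 + b = b := by decide
  rcases k with k | k
  · refine Fin.cases ?_ (fun i => ?_) k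
    · rfl
    · show 1 + S.coeff (-zf i) = (J + S).coeff (-zf i)
      simp [J]
  · refine Fin.cases ?_ (fun i => ?_) k
    · show 0 + (1 + aug S) = aug (J + S)
      rw [aug_add, aug_J, zero_add]
    · show 0 + (1 + a + aug S + (S * σ).coeff (-zf i)) = 1 + a + aug (J + S) + ((J + S) * σ).coeff (-zf i)
      rw [aug_add, aug_J, add_mul, J_mul h]
      have : (J + S * σ).coeff (-zf i) = 1 + (S * σ).coeff (-zf i) := by simp [J]
      rw [this]
      generalize (S * σ).coeff (-zf i) = b; generalize aug S = d
      revert a b d; decide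

theorem mem_shadow {σ : A} (hu : σ * st σ = 1) (h4 : wt σ % 4 = 1) (x : V) :
    shadow (code σ) x ↔ ∃ a S, x = sw σ a S := by
  have haug := aug_unitary hu
  rw [shadow_iff hu h4, mem_code]
  have hinj : ∀ y : V, uu + x = uu + y ↔ x = y := fun y => add_right_inj _
  constructor
  · rintro ⟨a, S, h⟩
    refine ⟨1 + a, J + S, ?_⟩
    rw [← hinj, uu_sw haug, h]
    rw [← add_assoc, ← add_assoc, add_self, zero_add, CharTwo.add_self_eq_zero, zero_add]
  · rintro ⟨a, S, rfl⟩
    exact ⟨_, _, uu_sw haug a S⟩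

theorem hamming_sw (σ : A) (a : ZMod 2) (S : A) :
    hammingNorm (sw σ a S) = a.val + wt S + ((1 + aug S).val + ∑ j, (1 + a + aug S + (S * σ).coeff j).val) := by
  rw [hamming_val, Fintype.sum_sum_type, Fin.sum_univ_succ, Fin.sum_univ_succ]
  have h1 := sum_zf_neg fun i => (S.coeff i).val
  have h2 := sum_zf_neg fun j => (1 + a + aug S + (S * σ).coeff j).val
  unfold wt bit
  rw [← h1, ← h2]
  rfl

theorem sw14 {σ : A} (hg : Good σ) (a : ZMod 2) (S : A) :
    hammingNorm (sw σ a S) = 14 ↔ a = 0 ∧ wt S % 2 = 1 ∧ wt S + wt (S * σ) = 14 := by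
  rw [hamming_sw]
  have h1 := sum_one_add (S * σ)
  have h3 : ZMod.val (1 : ZMod 2) = 1 := rfl
  have h30 : ZMod.val (0 : ZMod 2) = 0 := rfl
  have h0 : ∑ j, ((0 : ZMod 2) + (S * σ).coeff j).val = wt (S * σ) := by
    unfold wt bit; exact Finset.sum_congr rfl fun i _ => by rw [zero_add]
  have key : ∀ z : ZMod 2, (z = 0 → ∑ j, (z + (S * σ).coeff j).val = wt (S * σ)) ∧
      (z = 1 → ∑ j, (z + (S * σ).coeff j).val + wt (S * σ) = 45) := by
    intro z; constructor
    · rintro rfl; exact h0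
    · rintro rfl; omega
  have k2 := key (1 + a + aug S)
  generalize ∑ j, (1 + a + aug S + (S * σ).coeff j).val = Q at k2 ⊢
  have n1 : ¬ (1 : ZMod 2) = 0 := by decide
  have hwl := wt_le (S * σ)
  have hS : S = 0 → wt S = 0 ∧ wt (S * σ) = 0 := by rintro rfl; simp [wt, bit]
  have hG : (wt S = 0 ∧ wt (S * σ) = 0) ∨ ((wt S % 2 = 0 → 16 ≤ wt S + wt (S * σ)) ∧
      (wt S % 2 = 1 → 14 ≤ wt S + wt (S * σ)) ∧ wt (S * σ) ≤ 30 + wt S) := by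
    by_cases hS0 : S = 0
    · exact Or.inl (hS hS0)
    · exact Or.inr (hg S hS0)
  rcases aug_cases S with ⟨ha, hp⟩ | ⟨ha, hp⟩ <;> rw [ha] at k2 ⊢ <;> rcases zm2 a with rfl | rfl
  · have := k2.2 (by decide)
    have e : ((1 : ZMod 2) + 0).val = 1 := rfl
    rw [e, h30]; simp only [true_and]; omega
  · have := k2.1 (by decide)
    have e : ((1 : ZMod 2) + 0).val = 1 := rfl
    rw [e, h3]; simp only [n1, false_and, iff_false]; omega
  · have := k2.1 (by decide)
    have e : ((1 : ZMod 2) + 1).val = 0 := rfl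
    rw [e, h30]; simp only [true_and]; omega
  · have := k2.2 (by decide)
    have e : ((1 : ZMod 2) + 1).val = 0 := rfl
    rw [e, h3]; simp only [n1, false_and, iff_false]; omega

noncomputable def WW (σ : A) : Finset A := univ.filter fun S => wt S % 2 = 1 ∧ wt S + wt (S * σ) = 14

theorem mem_WW (σ S : A) : S ∈ WW σ ↔ wt S % 2 = 1 ∧ wt S + wt (S * σ) = 14 := by simp [WW]

theorem lam_eq {σ : A} (hu : σ * st σ = 1) (h4 : wt σ % 4 = 1) (hg : Good σ) (p q : Fin 46 ⊕ Fin 46) :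
    lam (code σ) p q = ∑ S ∈ WW σ, (sw σ 0 S p).val * (sw σ 0 S q).val := by
  unfold lam
  symm
  refine Finset.sum_bij (fun S _ => sw σ 0 S) ?_ ?_ ?_ ?_
  · intro S hS
    rw [mem_WW] at hS
    simp only [sh14, mem_filter, mem_univ, true_and]
    exact ⟨(mem_shadow hu h4 _).2 ⟨0, S, rfl⟩, (sw14 hg 0 S).2 ⟨rfl, hS⟩⟩
  · intro S _ T _ h
    apply A_ext; intro i
    have := congrFun h (Sum.inl (Fin.succ (-i : ZMod 45)))
    have h2 : ∀ S, sw σ 0 S (Sum.inl (Fin.succ (-i : ZMod 45))) = S.coeff (- (-i)) := fun _ => rfl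
    rw [h2, h2, neg_neg] at this
    exact this
  · intro x hx
    simp only [sh14, mem_filter, mem_univ, true_and] at hx
    obtain ⟨a, S, rfl⟩ := (mem_shadow hu h4 _).1 hx.1
    obtain ⟨rfl, h⟩ := (sw14 hg a S).1 hx.2
    exact ⟨S, (mem_WW _ _).2 h, rfl⟩
  · intro S _; rfl

/-- orbit certificate -/
def Orb (σ : A) (O : List A) : Prop :=
  ∀ g : A → ℕ, ∑ S ∈ (WW σ).filter (fun S => wt S ≤ 7), g S = (O.map fun S => ∑ c, g (X c * S)).sum

theorem bit_X_mul (c : ZMod 45) (S : A) (k : ZMod 45) : bit (X c * S) k = bit S (k - c) := by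
  unfold bit; rw [coeff_X_mul]

theorem wt_X_mul (c : ZMod 45) (S : A) : wt (X c * S) = wt S := by
  unfold wt; simp_rw [bit_X_mul]; exact Equiv.sum_comp (Equiv.subRight c) (bit S)

theorem bit_st (S : A) (k : ZMod 45) : bit (st S) k = bit S (-k) := rfl

theorem wt_st (S : A) : wt (st S) = wt S := Equiv.sum_comp (Equiv.neg (ZMod 45)) (bit S)

theorem sum_conv (f g : ZMod 45 → ℕ) (a b : ZMod 45) :
    ∑ c, f (a - c) * g (b - c) = conv f (fun i => g (-i)) (a - b) := by
  unfold conv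
  rw [← Equiv.sum_comp (Equiv.subLeft a)]
  refine Finset.sum_congr rfl fun i _ => ?_
  simp only [Equiv.subLeft_apply]
  congr 2 <;> ring

theorem iota_iota {σ : A} (hu : σ * st σ = 1) (S : A) : st (st (S * σ) * σ) = S := by
  rw [st_mul, st_st, mul_assoc, hu, mul_one]

theorem iota_mul {σ : A} (hu : σ * st σ = 1) (S : A) : st (S * σ) * σ = st S := by
  rw [st_mul, mul_assoc, mul_comm (st σ), hu, mul_one]

theorem sum_WW {σ : A} (hu : σ * st σ = 1) {O : List A} (hO : Orb σ O) (g : A → ℕ) :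
    ∑ S ∈ WW σ, g S = (O.map fun S => ∑ c, (g (X c * S) +
      if wt S ≤ 5 then g (st ((X c * S) * σ)) else 0)).sum := by
  have h1 := hO fun S => g S + if wt S ≤ 5 then g (st (S * σ)) else 0
  simp only [wt_X_mul] at h1
  rw [← h1, Finset.sum_add_distrib, ← Finset.sum_filter, Finset.filter_filter,
    ← Finset.sum_filter_add_sum_filter_not (WW σ) fun S => wt S ≤ 7]
  refine congrArg₂ (· + ·) rfl ?_
  refine Finset.sum_nbij' (fun S => st (S * σ)) (fun S => st (S * σ)) ?_ ?_ ?_ ?_ ?_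
  · intro S hS
    simp only [mem_filter, mem_WW] at hS ⊢
    rw [iota_mul hu, wt_st, wt_st]; omega
  · intro S hS
    simp only [mem_filter, mem_WW] at hS ⊢
    rw [iota_mul hu, wt_st, wt_st]; omega
  · intro S _; exact iota_iota hu S
  · intro S _; exact iota_iota hu S
  · intro S _; simp only [iota_iota hu]

noncomputable def LLf (σ : A) (O : List A) (k : ZMod 45) : ℕ :=
  (O.map fun S => conv (bit S) (bit (st S)) k + if wt S ≤ 5 then conv (bit (S * σ)) (bit (st (S * σ))) k else 0).sum
noncomputable def RRf (σ : A) (O : List A) (k : ZMod 45) : ℕ :=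
  (O.map fun S => conv (bit (S * σ)) (bit (st (S * σ))) k + if wt S ≤ 5 then conv (bit S) (bit (st S)) k else 0).sum
noncomputable def LRf (σ : A) (O : List A) (k : ZMod 45) : ℕ :=
  (O.map fun S => conv (bit S) (bit (st (S * σ))) k + if wt S ≤ 5 then conv (bit S) (bit (st (S * σ))) k else 0).sum

theorem conv_comm (f g : ZMod 45 → ℕ) (k : ZMod 45) : conv f g k = conv g f k := by
  unfold conv
  rw [← Equiv.sum_comp (Equiv.subLeft k)]
  refine Finset.sum_congr rfl fun i _ => ?_
  simp [mul_comm]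

theorem X_neg_st (c : ZMod 45) (S σ : A) : st ((X c * S) * σ) = X (-c) * st (S * σ) := by
  rw [mul_assoc, st_mul, st_X]

theorem sum_pair {σ : A} (hu : σ * st σ = 1) {O : List A} (hO : Orb σ O) (u v : A → A)
    (hu' : ∀ c S, u (X c * S) = X c * u S) (hv : ∀ c S, v (X c * S) = X c * v S) (a b : ZMod 45) :
    ∑ S ∈ WW σ, bit (u S) a * bit (v S) b = (O.map fun S => conv (bit (u S)) (bit (st (v S))) (a - b) +
      if wt S ≤ 5 then conv (bit (u (st (S * σ)))) (bit (st (v (st (S * σ))))) (a - b) else 0).sum := by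
  rw [sum_WW hu hO]
  refine congrArg List.sum (List.map_congr_left fun S _ => ?_)
  rw [Finset.sum_add_distrib]
  refine congrArg₂ (· + ·) ?_ ?_
  · simp only [hu', hv, bit_X_mul]
    exact sum_conv _ _ _ _
  · by_cases h : wt S ≤ 5
    · simp only [h, if_true, X_neg_st, hu', hv, bit_X_mul]
      rw [← Equiv.sum_comp (Equiv.neg (ZMod 45))]
      simp only [Equiv.neg_apply, neg_neg]
      exact sum_conv _ _ _ _
    · simp [h]

theorem sum_shift (f : ZMod 45 → ℕ) : ∑ i : Fin 45, ∑ j : Fin 45, f (-zf i - -zf j) = 45 * ∑ d, f d := by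
  rw [sum_zf_neg fun i => ∑ j : Fin 45, f (i - -zf j)]
  have : ∀ i, ∑ j : Fin 45, f (i - -zf j) = ∑ d, f d := by
    intro i
    rw [sum_zf_neg fun j => f (i - j)]
    exact Equiv.sum_comp (Equiv.subLeft i) f
  rw [Finset.sum_congr rfl fun i _ => this i, Finset.sum_const, Finset.card_univ, ZMod.card, smul_eq_mul]

theorem inv_eq {σ : A} (hu : σ * st σ = 1) (h4 : wt σ % 4 = 1) (hg : Good σ) {O : List A} (hO : Orb σ O) :
    inv (code σ) = 45 * (∑ d, LLf σ O d ^ 3 + ∑ d, RRf σ O d ^ 3 + 2 * ∑ d, LRf σ O d ^ 3) := by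
  have hl := lam_eq hu h4 hg
  have v1 : ∀ S ∈ WW σ, (1 : ZMod 2) + aug S = 0 := by
    intro S hS
    rcases aug_cases S with ⟨h1, h2⟩ | ⟨h1, h2⟩
    · rw [mem_WW] at hS; omega
    · rw [h1]; decide
  have b1 : ∀ q, lam (code σ) (Sum.inl 0) q = 0 := by
    intro q; rw [hl]; apply Finset.sum_eq_zero; intro S _
    have : sw σ 0 S (Sum.inl 0) = 0 := rfl
    rw [this]; simp
  have b2 : ∀ q, lam (code σ) (Sum.inr 0) q = 0 := by
    intro q; rw [hl]; apply Finset.sum_eq_zero; intro S hS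
    have : sw σ 0 S (Sum.inr 0) = 1 + aug S := rfl
    rw [this, v1 S hS]; simp
  have hsym : ∀ p q, lam (code σ) p q = lam (code σ) q p := by
    intro p q; unfold lam; exact Finset.sum_congr rfl fun _ _ => mul_comm _ _
  have b1' : ∀ q, lam (code σ) q (Sum.inl 0) = 0 := fun q => by rw [hsym, b1]
  have b2' : ∀ q, lam (code σ) q (Sum.inr 0) = 0 := fun q => by rw [hsym, b2]
  have eR : ∀ S ∈ WW σ, ∀ j : Fin 45, (sw σ 0 S (Sum.inr j.succ)).val = bit (S * σ) (-zf j) := by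
    intro S hS j
    have : sw σ 0 S (Sum.inr j.succ) = 1 + 0 + aug S + (S * σ).coeff (-zf j) := rfl
    rw [this, add_zero, v1 S hS, zero_add]; rfl
  have eL : ∀ S, ∀ j : Fin 45, (sw σ 0 S (Sum.inl j.succ)).val = bit S (-zf j) := fun S j => rfl
  have cLL : ∀ i j : Fin 45, lam (code σ) (Sum.inl i.succ) (Sum.inl j.succ) = LLf σ O (-zf i - -zf j) := by
    intro i j; rw [hl]; simp only [eL]
    rw [sum_pair hu hO (fun S => S) (fun S => S) (fun _ _ => rfl) (fun _ _ => rfl)]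
    unfold LLf
    refine congrArg List.sum (List.map_congr_left fun S _ => ?_)
    rw [conv_comm (bit (st (S * σ))), st_st]
  have cRR : ∀ i j : Fin 45, lam (code σ) (Sum.inr i.succ) (Sum.inr j.succ) = RRf σ O (-zf i - -zf j) := by
    intro i j; rw [hl]
    rw [Finset.sum_congr rfl fun S hS => by rw [eR S hS, eR S hS]]
    rw [sum_pair hu hO (fun S => S * σ) (fun S => S * σ) (fun _ _ => mul_assoc _ _ _) (fun _ _ => mul_assoc _ _ _)]
    unfold RRf
    refine congrArg List.sum (List.map_congr_left fun S _ => ?_)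
    rw [iota_mul hu, st_st, conv_comm (bit (st S))]
  have cLR : ∀ i j : Fin 45, lam (code σ) (Sum.inl i.succ) (Sum.inr j.succ) = LRf σ O (-zf i - -zf j) := by
    intro i j; rw [hl]
    rw [Finset.sum_congr rfl fun S hS => by rw [eR S hS, eL S]]
    rw [sum_pair hu hO (fun S => S) (fun S => S * σ) (fun _ _ => rfl) (fun _ _ => mul_assoc _ _ _)]
    unfold LRf
    refine congrArg List.sum (List.map_congr_left fun S _ => ?_)
    rw [iota_mul hu, st_st, conv_comm (bit (st (S * σ)))]
  unfold inv
  simp only [Fintype.sum_sum_type, Fin.sum_univ_succ (n := 45), b1, b2, b1', b2', cLL, cRR, cLR,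
    fun i j : Fin 45 => hsym (Sum.inr i.succ) (Sum.inl j.succ)]
  simp only [ne_eq, OfNat.ofNat_ne_zero, not_false_eq_true, zero_pow, sum_const_zero, zero_add, add_zero, Finset.sum_add_distrib]
  rw [sum_shift fun d => LLf σ O d ^ 3, sum_shift fun d => RRf σ O d ^ 3, sum_shift fun d => LRf σ O d ^ 3,
    Finset.sum_comm, sum_shift fun d => LRf σ O d ^ 3]
  ring

/-- existence of weight sixteen words -/
theorem exists16 {σ : A} {S : A} (hS : S ∈ WW σ) : ∃ x ∈ code σ, x ≠ 0 ∧ hammingNorm x = 16 := by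
  rw [mem_WW] at hS
  refine ⟨word σ 1 S, (mem_code _ _).2 ⟨1, S, rfl⟩, ?_, ?_⟩
  · apply word_ne_zero; rintro rfl
    have : wt 0 = 0 := by simp [wt, bit]
    omega
  · rw [hw01 σ S hS.1]; omega

theorem ce_min16 {C D : Submodule (ZMod 2) V} (h : CodeEquiv C D) (hC : ∃ x ∈ C, x ≠ 0 ∧ hammingNorm x = 16) :
    ∃ x ∈ D, x ≠ 0 ∧ hammingNorm x = 16 := by
  obtain ⟨p, h⟩ := h
  obtain ⟨x, hx, _, h16⟩ := hC
  refine ⟨x ∘ p, (ce_mem p h x).2 hx, ?_, ?_⟩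
  · intro h0
    have := hamming_comp p x
    rw [h0, h16] at this
    simp at this
  · rw [hamming_comp, h16]

end BD

set_option linter.all false
namespace BD
open Finset

noncomputable def el (n : ℕ) : A := ofFn fun i => ((n / 2 ^ i.val % 2 : ℕ) : ZMod 2)

def spA : ℕ → ℕ → ℕ
  | 0, _ => 0
  | f + 1, n => Nat.add (Nat.mod n 2) (Nat.mul 4096 (spA f (Nat.div n 2)))

def sp (n : ℕ) : ℕ := spA 45 n

theorem spA_dig (f n : ℕ) : spA f n = dig (fun i => n / 2 ^ i % 2) f := by
  induction f generalizing n with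
  | zero => rfl
  | succ f ih =>
    rw [dig_succ]
    show n % 2 + 4096 * spA f (n / 2) = _
    rw [ih]
    have : (fun i => n / 2 / 2 ^ i % 2) = fun i => n / 2 ^ (i + 1) % 2 := by
      funext i; rw [Nat.div_div_eq_div_mul, pow_succ, mul_comm]
    rw [this]; simp

theorem enc_el (n : ℕ) : enc (el n) = sp n := by
  unfold enc sp
  rw [encF_dig, spA_dig]
  refine dig_congr fun i hi => ?_
  have h1 : ((i : ZMod 45)).val = i := ZMod.val_natCast_of_lt hi
  unfold bit el
  rw [coeff_ofFn, h1, ZMod.val_natCast, Nat.mod_mod]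

theorem st_el {n m : ℕ} (h : ∀ i : ZMod 45, n / 2 ^ (-i).val % 2 = m / 2 ^ i.val % 2) : st (el n) = el m := by
  apply A_ext; intro i
  rw [coeff_st]; unfold el
  rw [coeff_ofFn, coeff_ofFn, h]

theorem X_el (c : ZMod 45) : X c = el (2 ^ c.val) := by
  apply A_ext; intro i
  rw [coeff_X]; unfold el; rw [coeff_ofFn]
  revert c i; decide +kernel

theorem enc_X (c : ZMod 45) : enc (X c) = sp (2 ^ c.val) := by rw [X_el, enc_el]

theorem sum_X (s : A) : s = ∑ c, s.coeff c • X c := by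
  apply A_ext; intro i
  have h : ∀ t : Finset (ZMod 45), (∑ c ∈ t, s.coeff c • X c).coeff i = ∑ c ∈ t, s.coeff c * (if i = c then 1 else 0) := by
    intro t
    induction t using Finset.induction_on with
    | empty => simp
    | insert a t ha ih => rw [Finset.sum_insert ha, Finset.sum_insert ha, ← ih, ← coeff_X]; simp
  rw [h]; simp

/-- cyclic description of a component -/
theorem cyc {f g : A} {d n m : ℕ} (hn : n + 1 = 2 ^ d) (hff : f * f = f) (hd : d ≤ 44) (hm : m < 2 ^ d)
    (hX : f * X (d : ZMod 45) = f * el m) (hf0 : f ≠ 0) (hord : orderOf (1 + f + f * g) = n) (hn0 : 0 < n) (s : A) (hs : f * s ≠ 0) :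
    ∃ k < n, f * s = f * g ^ k := by
  classical
  set h := 1 + f + f * g with hh
  have fh : f * h = f * g := by
    rw [hh]
    calc f * (1 + f + f * g) = f + f * f + f * f * g := by ring
      _ = f * g := by rw [hff, add_self, zero_add]
  have fhk : ∀ k, f * h ^ k = f * g ^ k := by
    intro k
    induction k with
    | zero => simp
    | succ k ih => rw [pow_succ, ← mul_assoc, ih, mul_right_comm, fh, mul_right_comm, mul_assoc, ← pow_succ]
  have f1 : (1 + f) * f = 0 := by rw [add_mul, one_mul, hff, add_self]
  have nh : (1 + f) * h = 1 + f := by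
    rw [hh]
    calc (1 + f) * (1 + f + f * g) = (1 + f) + (1 + f) * f + (1 + f) * f * g := by ring
      _ = 1 + f := by rw [f1]; simp
  have nhk : ∀ k, (1 + f) * h ^ k = 1 + f := by
    intro k
    induction k with
    | zero => simp
    | succ k ih => rw [pow_succ, ← mul_assoc, ih, nh]
  have hk : ∀ k, h ^ k = (1 + f) + f * g ^ k := by
    intro k
    rw [← fhk]
    have := nhk k
    nth_rw 1 [← one_mul (h ^ k)]
    calc 1 * h ^ k = (1 + f) * h ^ k + f * h ^ k := by rw [← add_mul, add_assoc, add_self, add_zero]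
      _ = _ := by rw [this]
  let W : Submodule (ZMod 2) A := Submodule.span (ZMod 2) (Set.range fun i : Fin d => f * X ((i : ℕ) : ZMod 45))
  have gen : ∀ i, i < d → f * X (i : ZMod 45) ∈ W := fun i hi => Submodule.subset_span ⟨⟨i, hi⟩, rfl⟩
  have memd : f * X (d : ZMod 45) ∈ W := by
    rw [hX, sum_X (el m), Finset.mul_sum]
    refine Submodule.sum_mem _ fun c _ => ?_
    rw [mul_smul_comm]
    by_cases hc : c.val < d
    · have := gen c.val hc
      rw [ZMod.natCast_zmod_val] at this
      exact W.smul_mem _ this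
    · have : (el m).coeff c = 0 := by
        unfold el
        rw [coeff_ofFn, Nat.div_eq_of_lt]
        · simp
        · exact lt_of_lt_of_le hm (Nat.pow_le_pow_right (by norm_num) (by omega))
      rw [this, zero_smul]; exact W.zero_mem
  have clX : ∀ w ∈ W, w * X 1 ∈ W := by
    intro w hw
    induction hw using Submodule.span_induction with
    | mem y hy =>
      obtain ⟨i, rfl⟩ := hy
      have e : f * X ((i : ℕ) : ZMod 45) * X 1 = f * X ((i + 1 : ℕ) : ZMod 45) := by
        rw [mul_assoc, ← X_add]; push_cast; rfl
      show f * X ((i : ℕ) : ZMod 45) * X 1 ∈ W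
      rw [e]
      have := i.2
      rcases Nat.lt_or_ge (i + 1) d with h | h
      · exact gen _ h
      · have : (i : ℕ) + 1 = d := by omega
        rw [this]; exact memd
    | zero => rw [zero_mul]; exact W.zero_mem
    | add a b _ _ ha hb => rw [add_mul]; exact W.add_mem ha hb
    | smul r a _ ha => rw [smul_mul_assoc]; exact W.smul_mem _ ha
  have allX : ∀ i : ℕ, f * X (i : ZMod 45) ∈ W := by
    have hd0 : 0 < d := by
      rcases Nat.eq_zero_or_pos d with h | h
      · subst h; simp at hn; omega
      · exact h
    intro i
    induction i with
    | zero => exact gen 0 hd0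
    | succ i ih =>
      have := clX _ ih
      rw [mul_assoc, ← X_add] at this
      push_cast; exact this
  have all : ∀ s, f * s ∈ W := by
    intro s
    rw [sum_X s, Finset.mul_sum]
    refine Submodule.sum_mem _ fun c _ => ?_
    rw [mul_smul_comm]
    have := allX c.val
    rw [ZMod.natCast_zmod_val] at this
    exact W.smul_mem _ this
  have hcard : Nat.card W ≤ 2 ^ d := by
    have h1 : Nat.card W = Nat.card (ZMod 2) ^ Module.finrank (ZMod 2) W := Module.natCard_eq_pow_finrank
    rw [h1, Nat.card_zmod]
    refine Nat.pow_le_pow_right (by norm_num) ?_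
    have := finrank_range_le_card (R := ZMod 2) (fun i : Fin d => f * X ((i : ℕ) : ZMod 45))
    rw [Fintype.card_fin] at this
    exact this
  have hinj : ∀ a < n, ∀ b < n, f * g ^ a = f * g ^ b → a = b := by
    intro a ha b hb e
    have : h ^ a = h ^ b := by rw [hk, hk, e]
    exact pow_injOn_Iio_orderOf (by rw [hord]; exact ha) (by rw [hord]; exact hb) this
  have hnz : ∀ a < n, f * g ^ a ≠ 0 := by
    intro a ha e
    apply hf0
    have e2 : f * h ^ n = f := by rw [← hord, pow_orderOf_eq_one, mul_one]
    rw [← fhk] at e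
    have e3 : h ^ n = h ^ a * h ^ (n - a) := by rw [← pow_add]; congr 1; omega
    rw [← e2, e3, ← mul_assoc, e, zero_mul]
  let T : Finset A := insert 0 ((Finset.range n).image fun k => f * g ^ k)
  have hT : T.card = 2 ^ d := by
    rw [Finset.card_insert_of_notMem, Finset.card_image_of_injOn, Finset.card_range, hn]
    · intro a ha b hb e
      exact hinj a (by simpa using ha) b (by simpa using hb) e
    · intro h0
      rw [Finset.mem_image] at h0
      obtain ⟨k, hk1, hk2⟩ := h0
      exact hnz k (by simpa using hk1) hk2
  have hTW : (T : Set A) ⊆ (W : Set A) := by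
    intro x hx
    rw [Finset.mem_coe, Finset.mem_insert, Finset.mem_image] at hx
    rcases hx with rfl | ⟨k, _, rfl⟩
    · exact W.zero_mem
    · exact all _
  have hEq : (T : Set A) = (W : Set A) := by
    apply Set.eq_of_subset_of_ncard_le hTW
    rw [Set.ncard_coe_finset, hT]
    exact hcard
  have : f * s ∈ (T : Set A) := by rw [hEq]; exact all s
  rw [Finset.mem_coe, Finset.mem_insert, Finset.mem_image] at this
  rcases this with h | ⟨k, hk1, hk2⟩
  · exact absurd h hs
  · exact ⟨k, by simpa using hk1, hk2.symm⟩

noncomputable def E1 : A := el 35184372088831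
noncomputable def E3 : A := el 30158033218998
noncomputable def E5 : A := el 34049392344030
noncomputable def E9 : A := el 4957484912712
noncomputable def F15 : A := el 33750883007176
noncomputable def G15 : A := el 5323774432094
noncomputable def F45 : A := el 5025248313856
noncomputable def G45 : A := el 68870738504
noncomputable def H3 : A := el 15079016609498
noncomputable def H15 : A := el 16144201005754
noncomputable def H45 : A := el 198339713878
noncomputable def g5 : A := el 10
noncomputable def g9 : A := el 13
theorem sq_E1 : E1 * E1 = E1 := enc_inj (by simp only [enc_mul, enc_add, enc_one, enc_zero, enc_X, enc_el, E1, E3, E5, E9, F15, G15, F45, G45, H3, H15, H45, g5, g9]; decide +kernel)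
theorem nz_E1 : E1 ≠ 0 := fun h => by have := congrArg enc h; revert this; simp only [enc_zero, enc_el, E1, E3, E5, E9, F15, G15, F45, G45, H3, H15, H45, g5, g9]; decide +kernel
theorem sq_E3 : E3 * E3 = E3 := enc_inj (by simp only [enc_mul, enc_add, enc_one, enc_zero, enc_X, enc_el, E1, E3, E5, E9, F15, G15, F45, G45, H3, H15, H45, g5, g9]; decide +kernel)
theorem nz_E3 : E3 ≠ 0 := fun h => by have := congrArg enc h; revert this; simp only [enc_zero, enc_el, E1, E3, E5, E9, F15, G15, F45, G45, H3, H15, H45, g5, g9]; decide +kernel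
theorem sq_E5 : E5 * E5 = E5 := enc_inj (by simp only [enc_mul, enc_add, enc_one, enc_zero, enc_X, enc_el, E1, E3, E5, E9, F15, G15, F45, G45, H3, H15, H45, g5, g9]; decide +kernel)
theorem nz_E5 : E5 ≠ 0 := fun h => by have := congrArg enc h; revert this; simp only [enc_zero, enc_el, E1, E3, E5, E9, F15, G15, F45, G45, H3, H15, H45, g5, g9]; decide +kernel
theorem sq_E9 : E9 * E9 = E9 := enc_inj (by simp only [enc_mul, enc_add, enc_one, enc_zero, enc_X, enc_el, E1, E3, E5, E9, F15, G15, F45, G45, H3, H15, H45, g5, g9]; decide +kernel)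
theorem nz_E9 : E9 ≠ 0 := fun h => by have := congrArg enc h; revert this; simp only [enc_zero, enc_el, E1, E3, E5, E9, F15, G15, F45, G45, H3, H15, H45, g5, g9]; decide +kernel
theorem sq_F15 : F15 * F15 = F15 := enc_inj (by simp only [enc_mul, enc_add, enc_one, enc_zero, enc_X, enc_el, E1, E3, E5, E9, F15, G15, F45, G45, H3, H15, H45, g5, g9]; decide +kernel)
theorem nz_F15 : F15 ≠ 0 := fun h => by have := congrArg enc h; revert this; simp only [enc_zero, enc_el, E1, E3, E5, E9, F15, G15, F45, G45, H3, H15, H45, g5, g9]; decide +kernel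
theorem sq_F45 : F45 * F45 = F45 := enc_inj (by simp only [enc_mul, enc_add, enc_one, enc_zero, enc_X, enc_el, E1, E3, E5, E9, F15, G15, F45, G45, H3, H15, H45, g5, g9]; decide +kernel)
theorem nz_F45 : F45 ≠ 0 := fun h => by have := congrArg enc h; revert this; simp only [enc_zero, enc_el, E1, E3, E5, E9, F15, G15, F45, G45, H3, H15, H45, g5, g9]; decide +kernel
theorem st_E1 : st E1 = E1 := st_el (by decide +kernel)
theorem st_E3 : st E3 = E3 := st_el (by decide +kernel)
theorem st_E5 : st E5 = E5 := st_el (by decide +kernel)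
theorem st_E9 : st E9 = E9 := st_el (by decide +kernel)
theorem st_F15 : st F15 = G15 := st_el (by decide +kernel)
theorem st_F45 : st F45 = G45 := st_el (by decide +kernel)
theorem sum_E : E1 + E3 + E5 + E9 + F15 + G15 + F45 + G45 = 1 := enc_inj (by simp only [enc_mul, enc_add, enc_one, enc_zero, enc_X, enc_el, E1, E3, E5, E9, F15, G15, F45, G45, H3, H15, H45, g5, g9]; decide +kernel)
theorem a_E1_H3 : E1 * H3 = E1 := enc_inj (by simp only [enc_mul, enc_add, enc_one, enc_zero, enc_X, enc_el, E1, E3, E5, E9, F15, G15, F45, G45, H3, H15, H45, g5, g9]; decide +kernel)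
theorem a_E1_H15 : E1 * H15 = E1 := enc_inj (by simp only [enc_mul, enc_add, enc_one, enc_zero, enc_X, enc_el, E1, E3, E5, E9, F15, G15, F45, G45, H3, H15, H45, g5, g9]; decide +kernel)
theorem a_E1_H45 : E1 * H45 = E1 := enc_inj (by simp only [enc_mul, enc_add, enc_one, enc_zero, enc_X, enc_el, E1, E3, E5, E9, F15, G15, F45, G45, H3, H15, H45, g5, g9]; decide +kernel)
theorem a_E3_H15 : E3 * H15 = E3 := enc_inj (by simp only [enc_mul, enc_add, enc_one, enc_zero, enc_X, enc_el, E1, E3, E5, E9, F15, G15, F45, G45, H3, H15, H45, g5, g9]; decide +kernel)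
theorem a_E3_H45 : E3 * H45 = E3 := enc_inj (by simp only [enc_mul, enc_add, enc_one, enc_zero, enc_X, enc_el, E1, E3, E5, E9, F15, G15, F45, G45, H3, H15, H45, g5, g9]; decide +kernel)
theorem a_E5_H3 : E5 * H3 = E5 := enc_inj (by simp only [enc_mul, enc_add, enc_one, enc_zero, enc_X, enc_el, E1, E3, E5, E9, F15, G15, F45, G45, H3, H15, H45, g5, g9]; decide +kernel)
theorem a_E5_H15 : E5 * H15 = E5 := enc_inj (by simp only [enc_mul, enc_add, enc_one, enc_zero, enc_X, enc_el, E1, E3, E5, E9, F15, G15, F45, G45, H3, H15, H45, g5, g9]; decide +kernel)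
theorem a_E5_H45 : E5 * H45 = E5 := enc_inj (by simp only [enc_mul, enc_add, enc_one, enc_zero, enc_X, enc_el, E1, E3, E5, E9, F15, G15, F45, G45, H3, H15, H45, g5, g9]; decide +kernel)
theorem a_E9_H3 : E9 * H3 = E9 := enc_inj (by simp only [enc_mul, enc_add, enc_one, enc_zero, enc_X, enc_el, E1, E3, E5, E9, F15, G15, F45, G45, H3, H15, H45, g5, g9]; decide +kernel)
theorem a_E9_H15 : E9 * H15 = E9 := enc_inj (by simp only [enc_mul, enc_add, enc_one, enc_zero, enc_X, enc_el, E1, E3, E5, E9, F15, G15, F45, G45, H3, H15, H45, g5, g9]; decide +kernel)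
theorem a_E9_H45 : E9 * H45 = E9 := enc_inj (by simp only [enc_mul, enc_add, enc_one, enc_zero, enc_X, enc_el, E1, E3, E5, E9, F15, G15, F45, G45, H3, H15, H45, g5, g9]; decide +kernel)
theorem a_F15_H3 : F15 * H3 = F15 := enc_inj (by simp only [enc_mul, enc_add, enc_one, enc_zero, enc_X, enc_el, E1, E3, E5, E9, F15, G15, F45, G45, H3, H15, H45, g5, g9]; decide +kernel)
theorem a_F15_H45 : F15 * H45 = F15 := enc_inj (by simp only [enc_mul, enc_add, enc_one, enc_zero, enc_X, enc_el, E1, E3, E5, E9, F15, G15, F45, G45, H3, H15, H45, g5, g9]; decide +kernel)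
theorem a_G15_H3 : G15 * H3 = G15 := enc_inj (by simp only [enc_mul, enc_add, enc_one, enc_zero, enc_X, enc_el, E1, E3, E5, E9, F15, G15, F45, G45, H3, H15, H45, g5, g9]; decide +kernel)
theorem a_G15_H45 : G15 * H45 = G15 := enc_inj (by simp only [enc_mul, enc_add, enc_one, enc_zero, enc_X, enc_el, E1, E3, E5, E9, F15, G15, F45, G45, H3, H15, H45, g5, g9]; decide +kernel)
theorem a_F45_H3 : F45 * H3 = F45 := enc_inj (by simp only [enc_mul, enc_add, enc_one, enc_zero, enc_X, enc_el, E1, E3, E5, E9, F15, G15, F45, G45, H3, H15, H45, g5, g9]; decide +kernel)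
theorem a_F45_H15 : F45 * H15 = F45 := enc_inj (by simp only [enc_mul, enc_add, enc_one, enc_zero, enc_X, enc_el, E1, E3, E5, E9, F15, G15, F45, G45, H3, H15, H45, g5, g9]; decide +kernel)
theorem a_G45_H3 : G45 * H3 = G45 := enc_inj (by simp only [enc_mul, enc_add, enc_one, enc_zero, enc_X, enc_el, E1, E3, E5, E9, F15, G15, F45, G45, H3, H15, H45, g5, g9]; decide +kernel)
theorem a_G45_H15 : G45 * H15 = G45 := enc_inj (by simp only [enc_mul, enc_add, enc_one, enc_zero, enc_X, enc_el, E1, E3, E5, E9, F15, G15, F45, G45, H3, H15, H45, g5, g9]; decide +kernel)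
theorem E3H3 : E3 * H3 = E3 * X 1 := enc_inj (by simp only [enc_mul, enc_add, enc_one, enc_zero, enc_X, enc_el, E1, E3, E5, E9, F15, G15, F45, G45, H3, H15, H45, g5, g9]; decide +kernel)
theorem uni_H3 : H3 * st H3 = 1 := by
  have h1 : st H3 = el 25131694349164 := st_el (by decide +kernel)
  rw [h1]; exact enc_inj (by simp only [enc_mul, enc_add, enc_one, enc_zero, enc_X, enc_el, E1, E3, E5, E9, F15, G15, F45, G45, H3, H15, H45, g5, g9]; decide +kernel)
theorem uni_H15 : H15 * st H15 = 1 := by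
  have h1 : st H15 = el 25664286547292 := st_el (by decide +kernel)
  rw [h1]; exact enc_inj (by simp only [enc_mul, enc_add, enc_one, enc_zero, enc_X, enc_el, E1, E3, E5, E9, F15, G15, F45, G45, H3, H15, H45, g5, g9]; decide +kernel)
theorem uni_H45 : H45 * st H45 = 1 := by
  have h1 : st H45 = el 29373212990720 := st_el (by decide +kernel)
  rw [h1]; exact enc_inj (by simp only [enc_mul, enc_add, enc_one, enc_zero, enc_X, enc_el, E1, E3, E5, E9, F15, G15, F45, G45, H3, H15, H45, g5, g9]; decide +kernel)
theorem no_g5 : E5 * (g5 * st g5) = E5 * g5 ^ 5 := by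
  have h1 : st g5 = el 21990232555520 := st_el (by decide +kernel)
  rw [h1]; exact enc_inj (by rw [enc_mul, enc_mul, enc_mul, enc_pow 12 _ _ (by norm_num)]; simp only [enc_mul, enc_add, enc_one, enc_zero, enc_X, enc_el, E1, E3, E5, E9, F15, G15, F45, G45, H3, H15, H45, g5, g9]; decide +kernel)
theorem no_g9 : E9 * (g9 * st g9) = E9 * g9 ^ 9 := by
  have h1 : st g9 = el 13194139533313 := st_el (by decide +kernel)
  rw [h1]; exact enc_inj (by rw [enc_mul, enc_mul, enc_mul, enc_pow 12 _ _ (by norm_num)]; simp only [enc_mul, enc_add, enc_one, enc_zero, enc_X, enc_el, E1, E3, E5, E9, F15, G15, F45, G45, H3, H15, H45, g5, g9]; decide +kernel)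
theorem rt_g5 : E5 * g5 ^ 3 = E5 * X 1 := enc_inj (by rw [enc_mul, enc_mul, enc_pow 12 _ _ (by norm_num)]; simp only [enc_mul, enc_add, enc_one, enc_zero, enc_X, enc_el, E1, E3, E5, E9, F15, G15, F45, G45, H3, H15, H45, g5, g9]; decide +kernel)
theorem rt_g9 : E9 * g9 ^ 7 = E9 * X 1 := enc_inj (by rw [enc_mul, enc_mul, enc_pow 12 _ _ (by norm_num)]; simp only [enc_mul, enc_add, enc_one, enc_zero, enc_X, enc_el, E1, E3, E5, E9, F15, G15, F45, G45, H3, H15, H45, g5, g9]; decide +kernel)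
theorem E5X5 : E5 * X 5 = E5 := enc_inj (by simp only [enc_mul, enc_add, enc_one, enc_zero, enc_X, enc_el, E1, E3, E5, E9, F15, G15, F45, G45, H3, H15, H45, g5, g9]; decide +kernel)
theorem E9X9 : E9 * X 9 = E9 := enc_inj (by simp only [enc_mul, enc_add, enc_one, enc_zero, enc_X, enc_el, E1, E3, E5, E9, F15, G15, F45, G45, H3, H15, H45, g5, g9]; decide +kernel)
theorem E1X : E1 * X 1 = E1 := enc_inj (by simp only [enc_mul, enc_add, enc_one, enc_zero, enc_X, enc_el, E1, E3, E5, E9, F15, G15, F45, G45, H3, H15, H45, g5, g9]; decide +kernel)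

theorem ord_aux {h : A} {n : ℕ} (h0 : 0 < n) (h12 : n < 2 ^ 12) (h1 : powN 12 (enc h) n = 1) (ps : List ℕ)
    (hp : ∀ p, p.Prime → p ∣ n → p ∈ ps) (h2 : ∀ p ∈ ps, powN 12 (enc h) (n / p) ≠ 1) : orderOf h = n := by
  refine orderOf_eq_of_pow_and_pow_div_prime h0 ?_ ?_
  · apply enc_inj; rw [enc_pow 12 _ _ h12, h1, enc_one]
  · intro p pp pd e
    apply h2 p (hp p pp pd)
    rw [← enc_pow 12 _ _ (lt_of_le_of_lt (Nat.div_le_self _ _) h12), e, enc_one]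

theorem pd {p a b : ℕ} {ps : List ℕ} (hp : p.Prime) (ha : a.Prime) (h : p ∣ a * b) (h2 : p ∣ b → p ∈ ps) (h3 : a ∈ ps) : p ∈ ps := by
  rcases hp.dvd_mul.1 h with h | h
  · rw [(Nat.prime_dvd_prime_iff_eq hp ha).1 h]; exact h3
  · exact h2 h

theorem p1 {p : ℕ} {ps : List ℕ} (hp : p.Prime) (h : p ∣ 1) : p ∈ ps := absurd (Nat.dvd_one.1 h) hp.one_lt.ne'

theorem ord_E1 : orderOf (1 + E1 + E1 * 1) = 1 := by
  refine ord_aux (by norm_num) (by norm_num) ?_ [] ?_ ?_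
  · simp only [enc_mul, enc_add, enc_one, enc_zero, enc_X, enc_el, E1, E3, E5, E9, F15, G15, F45, G45, H3, H15, H45, g5, g9]; decide +kernel
  · intro p hp h
    exact p1 hp h
  · simp only [enc_mul, enc_add, enc_one, enc_zero, enc_X, enc_el, E1, E3, E5, E9, F15, G15, F45, G45, H3, H15, H45, g5, g9]; decide +kernel
theorem mx_E1 : E1 * X ((1 : ℕ) : ZMod 45) = E1 * el 1 := enc_inj (by simp only [enc_mul, enc_add, enc_one, enc_zero, enc_X, enc_el, E1, E3, E5, E9, F15, G15, F45, G45, H3, H15, H45, g5, g9]; decide +kernel)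
theorem cyc_E1 (s : A) (hs : E1 * s ≠ 0) : ∃ k < 1, E1 * s = E1 * (1) ^ k :=
  cyc (d := 1) (m := 1) (by norm_num) sq_E1 (by norm_num) (by norm_num) mx_E1 nz_E1 ord_E1 (by norm_num) s hs

theorem ord_E3 : orderOf (1 + E3 + E3 * X 1) = 3 := by
  refine ord_aux (by norm_num) (by norm_num) ?_ [3] ?_ ?_
  · simp only [enc_mul, enc_add, enc_one, enc_zero, enc_X, enc_el, E1, E3, E5, E9, F15, G15, F45, G45, H3, H15, H45, g5, g9]; decide +kernel
  · intro p hp h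
    exact pd hp (a := 3) (b := 1) (by norm_num) h (fun h => p1 hp h) (by decide)
  · simp only [enc_mul, enc_add, enc_one, enc_zero, enc_X, enc_el, E1, E3, E5, E9, F15, G15, F45, G45, H3, H15, H45, g5, g9]; decide +kernel
theorem mx_E3 : E3 * X ((2 : ℕ) : ZMod 45) = E3 * el 3 := enc_inj (by simp only [enc_mul, enc_add, enc_one, enc_zero, enc_X, enc_el, E1, E3, E5, E9, F15, G15, F45, G45, H3, H15, H45, g5, g9]; decide +kernel)
theorem cyc_E3 (s : A) (hs : E3 * s ≠ 0) : ∃ k < 3, E3 * s = E3 * (X 1) ^ k :=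
  cyc (d := 2) (m := 3) (by norm_num) sq_E3 (by norm_num) (by norm_num) mx_E3 nz_E3 ord_E3 (by norm_num) s hs

theorem ord_E5 : orderOf (1 + E5 + E5 * g5) = 15 := by
  refine ord_aux (by norm_num) (by norm_num) ?_ [3, 5] ?_ ?_
  · simp only [enc_mul, enc_add, enc_one, enc_zero, enc_X, enc_el, E1, E3, E5, E9, F15, G15, F45, G45, H3, H15, H45, g5, g9]; decide +kernel
  · intro p hp h
    exact pd hp (a := 3) (b := 5) (by norm_num) h (fun h => pd hp (a := 5) (b := 1) (by norm_num) h (fun h => p1 hp h) (by decide)) (by decide)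
  · simp only [enc_mul, enc_add, enc_one, enc_zero, enc_X, enc_el, E1, E3, E5, E9, F15, G15, F45, G45, H3, H15, H45, g5, g9]; decide +kernel
theorem mx_E5 : E5 * X ((4 : ℕ) : ZMod 45) = E5 * el 15 := enc_inj (by simp only [enc_mul, enc_add, enc_one, enc_zero, enc_X, enc_el, E1, E3, E5, E9, F15, G15, F45, G45, H3, H15, H45, g5, g9]; decide +kernel)
theorem cyc_E5 (s : A) (hs : E5 * s ≠ 0) : ∃ k < 15, E5 * s = E5 * (g5) ^ k :=
  cyc (d := 4) (m := 15) (by norm_num) sq_E5 (by norm_num) (by norm_num) mx_E5 nz_E5 ord_E5 (by norm_num) s hs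

theorem ord_E9 : orderOf (1 + E9 + E9 * g9) = 63 := by
  refine ord_aux (by norm_num) (by norm_num) ?_ [3, 7] ?_ ?_
  · simp only [enc_mul, enc_add, enc_one, enc_zero, enc_X, enc_el, E1, E3, E5, E9, F15, G15, F45, G45, H3, H15, H45, g5, g9]; decide +kernel
  · intro p hp h
    exact pd hp (a := 3) (b := 21) (by norm_num) h (fun h => pd hp (a := 3) (b := 7) (by norm_num) h (fun h => pd hp (a := 7) (b := 1) (by norm_num) h (fun h => p1 hp h) (by decide)) (by decide)) (by decide)
  · simp only [enc_mul, enc_add, enc_one, enc_zero, enc_X, enc_el, E1, E3, E5, E9, F15, G15, F45, G45, H3, H15, H45, g5, g9]; decide +kernel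
theorem mx_E9 : E9 * X ((6 : ℕ) : ZMod 45) = E9 * el 9 := enc_inj (by simp only [enc_mul, enc_add, enc_one, enc_zero, enc_X, enc_el, E1, E3, E5, E9, F15, G15, F45, G45, H3, H15, H45, g5, g9]; decide +kernel)
theorem cyc_E9 (s : A) (hs : E9 * s ≠ 0) : ∃ k < 63, E9 * s = E9 * (g9) ^ k :=
  cyc (d := 6) (m := 9) (by norm_num) sq_E9 (by norm_num) (by norm_num) mx_E9 nz_E9 ord_E9 (by norm_num) s hs

theorem ord_F15 : orderOf (1 + F15 + F15 * H15) = 15 := by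
  refine ord_aux (by norm_num) (by norm_num) ?_ [3, 5] ?_ ?_
  · simp only [enc_mul, enc_add, enc_one, enc_zero, enc_X, enc_el, E1, E3, E5, E9, F15, G15, F45, G45, H3, H15, H45, g5, g9]; decide +kernel
  · intro p hp h
    exact pd hp (a := 3) (b := 5) (by norm_num) h (fun h => pd hp (a := 5) (b := 1) (by norm_num) h (fun h => p1 hp h) (by decide)) (by decide)
  · simp only [enc_mul, enc_add, enc_one, enc_zero, enc_X, enc_el, E1, E3, E5, E9, F15, G15, F45, G45, H3, H15, H45, g5, g9]; decide +kernel
theorem mx_F15 : F15 * X ((4 : ℕ) : ZMod 45) = F15 * el 9 := enc_inj (by simp only [enc_mul, enc_add, enc_one, enc_zero, enc_X, enc_el, E1, E3, E5, E9, F15, G15, F45, G45, H3, H15, H45, g5, g9]; decide +kernel)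
theorem cyc_F15 (s : A) (hs : F15 * s ≠ 0) : ∃ k < 15, F15 * s = F15 * (H15) ^ k :=
  cyc (d := 4) (m := 9) (by norm_num) sq_F15 (by norm_num) (by norm_num) mx_F15 nz_F15 ord_F15 (by norm_num) s hs

theorem ord_F45 : orderOf (1 + F45 + F45 * H45) = 4095 := by
  refine ord_aux (by norm_num) (by norm_num) ?_ [3, 5, 7, 13] ?_ ?_
  · simp only [enc_mul, enc_add, enc_one, enc_zero, enc_X, enc_el, E1, E3, E5, E9, F15, G15, F45, G45, H3, H15, H45, g5, g9]; decide +kernel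
  · intro p hp h
    exact pd hp (a := 3) (b := 1365) (by norm_num) h (fun h => pd hp (a := 3) (b := 455) (by norm_num) h (fun h => pd hp (a := 5) (b := 91) (by norm_num) h (fun h => pd hp (a := 7) (b := 13) (by norm_num) h (fun h => pd hp (a := 13) (b := 1) (by norm_num) h (fun h => p1 hp h) (by decide)) (by decide)) (by decide)) (by decide)) (by decide)
  · simp only [enc_mul, enc_add, enc_one, enc_zero, enc_X, enc_el, E1, E3, E5, E9, F15, G15, F45, G45, H3, H15, H45, g5, g9]; decide +kernel
theorem mx_F45 : F45 * X ((12 : ℕ) : ZMod 45) = F45 * el 513 := enc_inj (by simp only [enc_mul, enc_add, enc_one, enc_zero, enc_X, enc_el, E1, E3, E5, E9, F15, G15, F45, G45, H3, H15, H45, g5, g9]; decide +kernel)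
theorem cyc_F45 (s : A) (hs : F45 * s ≠ 0) : ∃ k < 4095, F45 * s = F45 * (H45) ^ k :=
  cyc (d := 12) (m := 513) (by norm_num) sq_F45 (by norm_num) (by norm_num) mx_F45 nz_F45 ord_F45 (by norm_num) s hs


theorem absorb {e h : A} (H : e * h = e) (n : ℕ) : e * h ^ n = e := by
  induction n with
  | zero => simp
  | succ n ih => rw [pow_succ, ← mul_assoc, ih, H]

noncomputable def U (i j k : ℕ) : A := H3 ^ i * H15 ^ j * H45 ^ k

theorem st_U (s : A) (n : ℕ) (h : s * st s = 1) : s ^ n * st s ^ n = 1 := by rw [← mul_pow, h, one_pow]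

theorem ne_of_unit {f s : A} (hf : f ≠ 0) (hs : s * st s = 1) : f * s ≠ 0 := by
  intro h; apply hf
  calc f = f * (s * st s) := by rw [hs, mul_one]
    _ = 0 := by rw [← mul_assoc, h, zero_mul]

/-- unit-norm elements of a component -/
theorem norm_comp {e g s : A} {n q r t : ℕ} (he : e * e = e) (hst : st e = e) (hs : s * st s = 1) {k : ℕ}
    (hk : e * s = e * g ^ k) (hno : e * (g * st g) = e * g ^ q) (hord : orderOf (1 + e + e * g) = n)
    (hn : n = q * r) (hq : 0 < q) (hrt : e * g ^ r = e * X 1) : ∃ t : ℕ, e * s = e * X (t : ZMod 45) := by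
  have h1 : e * st s = e * st g ^ k := by
    have := congrArg st hk
    rwa [st_mul, st_mul, hst, st_pow] at this
  have h2 : e = e * (g * st g) ^ k := by
    calc e = e * (s * st s) := by rw [hs, mul_one]
      _ = (e * s) * (e * st s) := by nth_rw 1 [← he]; ring
      _ = e * e * (g * st g) ^ k := by rw [hk, h1, mul_pow]; ring
      _ = _ := by rw [he]
  have pw : ∀ (a b : A), e * a = e * b → ∀ k, e * a ^ k = e * b ^ k := by
    intro a b hab k
    induction k with
    | zero => simp
    | succ k ih =>
      calc e * a ^ (k + 1) = (e * a ^ k) * (e * a) := by nth_rw 1 [← he]; ring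
        _ = (e * e) * b ^ (k + 1) := by rw [ih, hab]; ring
        _ = _ := by rw [he]
  have h3 : e * g ^ (q * k) = e := by rw [pow_mul, ← pw _ _ hno, ← h2]
  have h4 : (1 + e + e * g) ^ (q * k) = 1 := by
    have f1 : ∀ m, (1 + e + e * g) ^ m = 1 + e + e * g ^ m := by
      intro m
      induction m with
      | zero => rw [pow_zero, pow_zero, mul_one, add_assoc, add_self, add_zero]
      | succ m ih =>
        rw [pow_succ, ih]
        have : (1 + e + e * g ^ m) * (1 + e + e * g) = 1 + (e + e) + e * e * 1 + (e * g + e * e * g) + (e * g ^ m + e * e * g ^ m) + e * e * g ^ (m + 1) := by ring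
        rw [this, he, add_self, add_self, add_self]; simp
    rw [f1, h3, add_assoc, add_self, add_zero]
  have h5 : n ∣ q * k := by rw [← hord]; exact orderOf_dvd_of_pow_eq_one h4
  rw [hn] at h5
  obtain ⟨m, rfl⟩ := Nat.dvd_of_mul_dvd_mul_left hq h5
  refine ⟨m, ?_⟩
  rw [hk, pow_mul, pw _ _ hrt, X_pow, mul_one]

theorem pair_comp {f f' h s : A} (hst : st f = f') (hs : s * st s = 1) (hh : h * st h = 1) {k : ℕ}
    (hk : f * s = f * h ^ k) : f' * s = f' * h ^ k := by
  have h1 : f' * st s = f' * st h ^ k := by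
    have := congrArg st hk
    rwa [st_mul, st_mul, hst, st_pow] at this
  have h2 := st_U h k hh
  calc f' * s = f' * s * (h ^ k * st h ^ k) := by rw [h2, mul_one]
    _ = (f' * st h ^ k) * s * h ^ k := by ring
    _ = f' * (s * st s) * h ^ k := by rw [← h1]; ring
    _ = _ := by rw [hs, mul_one]

theorem X_mod {e : A} {d : ℕ} (h : e * X (d : ZMod 45) = e) {a b : ℕ} (hab : a ≡ b [MOD d]) :
    e * X (a : ZMod 45) = e * X (b : ZMod 45) := by
  have key : ∀ a : ℕ, e * X (a : ZMod 45) = e * X ((a % d : ℕ) : ZMod 45) := by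
    intro a
    nth_rw 1 [← Nat.mod_add_div a d]
    rw [Nat.cast_add, X_add, Nat.cast_mul, mul_comm (d : ZMod 45), ← X_pow, mul_comm (X _), ← mul_assoc, absorb h]
  rw [key a, key b, hab]

theorem classify {s : A} (hs : s * st s = 1) : ∃ c : ZMod 45, ∃ i < 3, ∃ j < 15, ∃ k < 4095, s = X c * U i j k := by
  obtain ⟨t5, h5⟩ : ∃ t : ℕ, E5 * s = E5 * X (t : ZMod 45) := by
    obtain ⟨k, _, hk⟩ := cyc_E5 s (ne_of_unit nz_E5 hs)
    exact norm_comp (t := 0) sq_E5 st_E5 hs hk no_g5 ord_E5 (by norm_num : 15 = 5 * 3) (by norm_num) rt_g5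
  obtain ⟨t9, h9⟩ : ∃ t : ℕ, E9 * s = E9 * X (t : ZMod 45) := by
    obtain ⟨k, _, hk⟩ := cyc_E9 s (ne_of_unit nz_E9 hs)
    exact norm_comp (t := 0) sq_E9 st_E9 hs hk no_g9 ord_E9 (by norm_num : 63 = 9 * 7) (by norm_num) rt_g9
  obtain ⟨c, hc5, hc9⟩ := Nat.chineseRemainder (by norm_num : Nat.Coprime 5 9) t5 t9
  have h5' : E5 * s = E5 * X (c : ZMod 45) := by rw [h5]; exact X_mod (d := 5) E5X5 hc5.symm
  have h9' : E9 * s = E9 * X (c : ZMod 45) := by rw [h9]; exact X_mod (d := 9) E9X9 hc9.symm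
  set s' := X (-(c : ZMod 45)) * s with hs'
  have hcc : X (-(c : ZMod 45)) * X (c : ZMod 45) = 1 := by rw [← X_add, neg_add_cancel, X_zero]
  have hss : s = X (c : ZMod 45) * s' := by rw [hs', ← mul_assoc, mul_comm (X (c : ZMod 45)), hcc, one_mul]
  have hu : s' * st s' = 1 := by
    rw [hs', st_mul, st_X, neg_neg]
    calc _ = (X (-(c : ZMod 45)) * X (c : ZMod 45)) * (s * st s) := by ring
      _ = 1 := by rw [hcc, hs, mul_one]
  have k5 : E5 * s' = E5 := by
    rw [hs', mul_left_comm, h5', mul_left_comm, hcc, mul_one]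
  have k9 : E9 * s' = E9 := by
    rw [hs', mul_left_comm, h9', mul_left_comm, hcc, mul_one]
  have k1 : E1 * s' = E1 := by
    obtain ⟨k, _, hk⟩ := cyc_E1 s' (ne_of_unit nz_E1 hu)
    rw [hk, one_pow, mul_one]
  obtain ⟨i, hi, k3⟩ := cyc_E3 s' (ne_of_unit nz_E3 hu)
  have k3' : E3 * s' = E3 * H3 ^ i := by
    rw [k3]
    have e2 : ∀ i, E3 * H3 ^ i = E3 * X 1 ^ i := by
      intro i
      induction i with
      | zero => simp
      | succ i ih => rw [pow_succ, ← mul_assoc, ih, mul_right_comm, E3H3, mul_right_comm, mul_assoc, ← pow_succ]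
    rw [e2]
  obtain ⟨j, hj, kf⟩ := cyc_F15 s' (ne_of_unit nz_F15 hu)
  have kg := pair_comp st_F15 hu uni_H15 kf
  obtain ⟨k, hk, kF⟩ := cyc_F45 s' (ne_of_unit nz_F45 hu)
  have kG := pair_comp st_F45 hu uni_H45 kF
  refine ⟨c, i, hi, j, hj, k, hk, ?_⟩
  rw [hss]
  refine congrArg _ ?_
  have r3 : ∀ e, e * H3 = e → e * H15 = e → e * H45 = e → e * U i j k = e := by
    intro e a b c; unfold U; rw [← mul_assoc, ← mul_assoc, absorb a, absorb b, absorb c]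
  have rA : ∀ e, e * H15 = e → e * H45 = e → e * U i j k = e * H3 ^ i := by
    intro e b c; unfold U
    rw [show e * (H3 ^ i * H15 ^ j * H45 ^ k) = (e * H15 ^ j) * H45 ^ k * H3 ^ i by ring, absorb b, absorb c]
  have rB : ∀ e, e * H3 = e → e * H45 = e → e * U i j k = e * H15 ^ j := by
    intro e b c; unfold U
    rw [show e * (H3 ^ i * H15 ^ j * H45 ^ k) = (e * H3 ^ i) * H45 ^ k * H15 ^ j by ring, absorb b, absorb c]
  have rC : ∀ e, e * H3 = e → e * H15 = e → e * U i j k = e * H45 ^ k := by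
    intro e b c; unfold U
    rw [← mul_assoc, ← mul_assoc, absorb b, absorb c]
  rw [← one_mul s', ← one_mul (U i j k), ← sum_E]
  simp only [add_mul]
  rw [k1, k3', k5, k9, kf, kg, kF, kG, r3 E1 a_E1_H3 a_E1_H15 a_E1_H45, rA E3 a_E3_H15 a_E3_H45,
    r3 E5 a_E5_H3 a_E5_H15 a_E5_H45, r3 E9 a_E9_H3 a_E9_H15 a_E9_H45, rB F15 a_F15_H3 a_F15_H45,
    rB G15 a_G15_H3 a_G15_H45, rC F45 a_F45_H3 a_F45_H15, rC G45 a_G45_H3 a_G45_H15]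

end BD

set_option linter.all false
namespace BD
open Finset

theorem U_uni (i j k : ℕ) : U i j k * st (U i j k) = 1 := by
  unfold U
  rw [st_mul, st_mul, st_pow, st_pow, st_pow]
  calc _ = (H3 ^ i * st H3 ^ i) * (H15 ^ j * st H15 ^ j) * (H45 ^ k * st H45 ^ k) := by ring
    _ = 1 := by rw [st_U _ _ uni_H3, st_U _ _ uni_H15, st_U _ _ uni_H45]; simp

theorem H3_3 : H3 ^ 3 = 1 := enc_inj (by rw [enc_pow 12 _ _ (by norm_num)]; simp only [enc_one, H3, enc_el]; decide +kernel)
theorem H15_15 : H15 ^ 15 = 1 := enc_inj (by rw [enc_pow 12 _ _ (by norm_num)]; simp only [enc_one, H15, enc_el]; decide +kernel)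
theorem H45_4095 : H45 ^ 4095 = 1 := enc_inj (by rw [enc_pow 12 _ _ (by norm_num)]; simp only [enc_one, H45, enc_el]; decide +kernel)

theorem U_mod (i j k : ℕ) : U i j k = U (i % 3) (j % 15) (k % 4095) := by
  unfold U
  rw [pow_eq_pow_mod i H3_3, pow_eq_pow_mod j H15_15, pow_eq_pow_mod k H45_4095]

theorem U_pow (i j k m : ℕ) : U i j k ^ m = U (i * m) (j * m) (k * m) := by
  unfold U; rw [mul_pow, mul_pow, ← pow_mul, ← pow_mul, ← pow_mul]

theorem U_st (i j k : ℕ) : st (U i j k) = U i j k ^ 4094 := by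
  have h : U i j k ^ 4095 = 1 := by
    rw [U_pow, U_mod, Nat.mul_mod_left, Nat.mul_mod i, Nat.mul_mod j]
    unfold U; simp
  calc st (U i j k) = st (U i j k) * U i j k ^ (4094 + 1) := by rw [h, mul_one]
    _ = U i j k * st (U i j k) * U i j k ^ 4094 := by rw [pow_succ]; ring
    _ = _ := by rw [U_uni, one_mul]

theorem ce_pow2 (σ : A) (r : ℕ) : CodeEquiv (code (σ ^ 2 ^ r)) (code σ) := by
  induction r with
  | zero => rw [pow_zero, pow_one]; exact ce_refl _
  | succ r ih => rw [pow_succ, pow_mul]; exact ce_trans (ce_sq _) ih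

def isM (m : ℕ) : Prop := ∃ r, m = 2 ^ r ∨ m = 4094 * 2 ^ r

theorem ce_U (i j k m : ℕ) (hm : isM m) : CodeEquiv (code (U (i * m) (j * m) (k * m))) (code (U i j k)) := by
  rw [← U_pow]
  obtain ⟨r, rfl | rfl⟩ := hm
  · exact ce_pow2 _ r
  · rw [pow_mul, ← U_st]
    exact ce_trans (ce_pow2 _ r) (ce_st _)

def badN (S s : ℕ) : Bool :=
  Nat.beq (Nat.land S mask) S && (
  (fun k w => Nat.ble 1 k && (Nat.ble (Nat.add 31 k) w || cond (Nat.beq (Nat.mod k 2) 0) (Nat.ble (Nat.add k w) 15) (Nat.ble (Nat.add k w) 13)))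
    (Nat.mod S 4095) (Nat.mod (mulN S s) 4095))

theorem bad_of {S : ℕ} {σ : A} (h : badN S (enc σ) = true) : ¬ Good σ := by
  unfold badN at h
  rw [Bool.and_eq_true] at h
  obtain ⟨h1, h2⟩ := h
  have h1' : Nat.land S mask = S := Nat.eq_of_beq_eq_true h1
  have e := enc_ofN h1'
  rw [← e, ← enc_mul, enc_mod, enc_mod] at h2
  intro hg
  generalize ofN S = T at *
  have hT : wt T ≠ 0 → T ≠ 0 := by rintro h rfl; exact h (by simp [wt, bit])
  simp only [Bool.and_eq_true, Bool.or_eq_true, Nat.ble_eq] at h2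
  obtain ⟨h3, h4⟩ := h2
  obtain ⟨g1, g2, g3⟩ := hg T (hT (by omega))
  have h5 : ∀ a b, Nat.add a b = a + b := fun _ _ => rfl
  rw [h5] at h4
  rcases h4 with h4 | h4
  · omega
  · have h6 : Nat.mod (wt T) 2 = wt T % 2 := rfl
    rw [h6] at h4
    rcases Nat.mod_two_eq_zero_or_one (wt T) with h7 | h7
    · have e0 : Nat.beq 0 0 = true := rfl
      rw [h7, e0, cond_true, Nat.ble_eq, h5] at h4
      have := g1 h7
      omega
    · have e0 : Nat.beq 1 0 = false := rfl
      rw [h7, e0, cond_false, Nat.ble_eq, h5] at h4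
      have := g2 h7
      omega

def tws : List ℕ := [68853957121, 9663971337, 35434561569, 1073774593]

def mlt (i j : ℕ) : Bool := (List.range 4).any fun r => (i * 2 ^ r % 3 == 1 && (j * 2 ^ r % 15 == 2 || j * 2 ^ r % 15 == 3)) ||
   (i * (4094 * 2 ^ r) % 3 == 1 && (j * (4094 * 2 ^ r) % 15 == 2 || j * (4094 * 2 ^ r) % 15 == 3))

theorem tws_per : ∀ t ∈ tws, mulN (sp t) (sp 198339713878) = sp t := by decide +kernel

theorem tws_bad : ∀ i < 3, ∀ j < 15, mlt i j = true ∨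
    ∃ t ∈ tws, badN (sp t) (mulN (powN 12 (sp 15079016609498) i) (powN 12 (sp 16144201005754) j)) = true := by decide +kernel

theorem bad_per {T s h : A} (hT : T * h = T) (k : ℕ) (hb : badN (enc T) (enc s) = true) : badN (enc T) (enc (s * h ^ k)) = true := by
  unfold badN at hb ⊢
  rw [← enc_mul, mul_left_comm, absorb hT, mul_comm, enc_mul]
  exact hb

theorem pair_ok {i j k : ℕ} (hi : i < 3) (hj : j < 15) (hg : Good (U i j k)) : mlt i j = true := by
  rcases tws_bad i hi j hj with h | ⟨t, ht, hb⟩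
  · exact h
  · exfalso
    refine bad_of (S := enc (el t)) ?_ hg
    refine bad_per (h := H45) (enc_inj ?_) k ?_
    · rw [enc_mul, H45, enc_el, enc_el]; exact tws_per t ht
    · rw [enc_mul, enc_pow 12 _ _ (by omega), enc_pow 12 _ _ (by omega), H3, H15, enc_el, enc_el, enc_el]
      exact hb

theorem to_base {i j k : ℕ} (h : mlt i j = true) : ∃ c < 2, ∃ k' < 4095, CodeEquiv (code (U 1 (2 + c) k')) (code (U i j k)) := by
  have key : ∃ m, isM m ∧ i * m % 3 = 1 ∧ (j * m % 15 = 2 ∨ j * m % 15 = 3) := by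
    unfold mlt at h
    rw [List.any_eq_true] at h
    obtain ⟨r, _, h⟩ := h
    simp only [Bool.or_eq_true, Bool.and_eq_true, beq_iff_eq] at h
    rcases h with h | h
    · exact ⟨2 ^ r, ⟨r, Or.inl rfl⟩, h⟩
    · exact ⟨4094 * 2 ^ r, ⟨r, Or.inr rfl⟩, h⟩
  obtain ⟨m, hm, h1, h2⟩ := key
  have h3 := ce_U i j k m hm
  rw [U_mod, h1] at h3
  have h4 : k * m % 4095 < 4095 := Nat.mod_lt _ (by norm_num)
  rcases h2 with h2 | h2 <;> rw [h2] at h3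
  · exact ⟨0, by norm_num, _, h4, h3⟩
  · exact ⟨1, by norm_num, _, h4, h3⟩

def can (k : ℕ) : Bool := Nat.ble k (Nat.mod (Nat.mul k 16) 4095) && Nat.ble k (Nat.mod (Nat.mul k 256) 4095)

theorem can_ex : ∀ k < 4095, can k = true ∨ can (k * 16 % 4095) = true ∨ can (k * 256 % 4095) = true := by
  intro k hk
  have h1 : ∀ k, can k = true ↔ k ≤ k * 16 % 4095 ∧ k ≤ k * 256 % 4095 := by
    intro k; unfold can; rw [Bool.and_eq_true, Nat.ble_eq, Nat.ble_eq]; rfl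
  rw [h1, h1, h1]
  have e1 : k * 16 % 4095 * 16 % 4095 = k * 256 % 4095 := by omega
  have q : ∀ m a : ℕ, a < 4095 → (4095 * m + a) % 4095 = a := fun m a h => by omega
  have e2 : k * 16 % 4095 * 256 % 4095 = k := by
    rw [Nat.mod_mul_mod, show k * 16 * 256 = 4095 * k + k by ring]; exact q _ _ hk
  have e3 : k * 256 % 4095 * 16 % 4095 = k := by
    rw [Nat.mod_mul_mod, show k * 256 * 16 = 4095 * k + k by ring]; exact q _ _ hk
  have e4 : k * 256 % 4095 * 256 % 4095 = k * 16 % 4095 := by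
    rw [Nat.mod_mul_mod, show k * 256 * 256 = k * 16 + 4095 * (16 * k) by ring, Nat.add_mul_mod_self_left]
  rw [e1, e2, e3, e4]
  generalize k * 16 % 4095 = a
  generalize k * 256 % 4095 = b
  omega

theorem to_can {c k : ℕ} (hc : c < 2) (hk : k < 4095) : ∃ k' < 4095, can k' = true ∧
    CodeEquiv (code (U 1 (2 + c) k')) (code (U 1 (2 + c) k)) := by
  have h16 := ce_U 1 (2 + c) k 16 ⟨4, Or.inl rfl⟩
  have h256 := ce_U 1 (2 + c) k 256 ⟨8, Or.inl rfl⟩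
  rw [U_mod] at h16 h256
  have e1 : (2 + c) * 16 % 15 = 2 + c := by omega
  have e2 : (2 + c) * 256 % 15 = 2 + c := by omega
  rw [e1] at h16
  rw [e2] at h256
  rcases can_ex k hk with h | h | h
  · exact ⟨k, hk, h, ce_refl _⟩
  · exact ⟨_, Nat.mod_lt _ (by norm_num), h, h16⟩
  · exact ⟨_, Nat.mod_lt _ (by norm_num), h, h256⟩

def force {α : Type} (x : ℕ) (f : ℕ → α) : α := Nat.rec (f 0) (fun n _ => f n) (Nat.add x 1)

theorem force_eq {α : Type} (x : ℕ) (f : ℕ → α) : force x f = f x := rfl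

/-- decode a set from a base 24 stream of gaps -/
def dcd {α : Type} (k : ℕ → ℕ → α) : ℕ → ℕ → ℕ → α
  | 0, st, acc => k acc st
  | f + 1, st, acc => force (Nat.div st 24) fun st' =>
      cond (Nat.beq (Nat.mod st 24) 0) (k acc st') (force (Nat.add (Nat.mul acc (Nat.pow 4096 (Nat.mod st 24))) 1) fun acc' => dcd k f st' acc')

theorem dcd_ex {α : Type} (k : ℕ → ℕ → α) (f st acc : ℕ) : ∃ a b, dcd k f st acc = k a b := by
  induction f generalizing st acc with
  | zero => exact ⟨_, _, rfl⟩
  | succ f ih =>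
    unfold dcd
    rw [force_eq]
    cases Nat.beq (Nat.mod st 24) 0
    · rw [cond_false, force_eq]; exact ih _ _
    · exact ⟨_, _, rfl⟩

def memN (k : ℕ) : List ℕ → Bool
  | [] => false
  | a :: l => Nat.beq a k || memN k l

theorem memN_iff {k : ℕ} {l : List ℕ} (h : memN k l = true) : k ∈ l := by
  induction l with
  | nil => cases h
  | cons a l ih =>
    unfold memN at h
    rw [Bool.or_eq_true] at h
    rcases h with h | h
    · rw [Nat.eq_of_beq_eq_true h]; exact List.mem_cons_self
    · exact List.mem_cons_of_mem _ (ih h)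

def walk (gs : List ℕ) (h : ℕ) : ℕ → ℕ → ℕ → ℕ → Bool
  | 0, _, _, _ => true
  | f + 1, k, N, st => force (Nat.add k 1) fun k' => force (mulN N h) fun N' =>
      cond (can k && Bool.not (memN k gs))
        (dcd (fun S st' => badN S N && walk gs h f k' N' st') 8 st 1)
        (walk gs h f k' N' st)

theorem walk_spec {gs : List ℕ} {h : A} {s : ℕ → A} (hs : ∀ k, s (k + 1) = s k * h) (f : ℕ) : ∀ (k N st : ℕ), N = enc (s k) →
    walk gs (enc h) f k N st = true → ∀ k', k ≤ k' → k' < k + f → can k' = true → k' ∈ gs ∨ ¬ Good (s k') := by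
  induction f with
  | zero => intro k N st _ _ k' h1 h2; omega
  | succ f ih =>
    intro k N st hN hw k' h1 h2 hc
    unfold walk at hw
    rw [force_eq, force_eq] at hw
    have hN' : mulN N (enc h) = enc (s (k + 1)) := by rw [hs, enc_mul, hN]
    have step : (can k = true → k ∈ gs ∨ ¬ Good (s k)) ∧ ∃ st', walk gs (enc h) f (k + 1) (mulN N (enc h)) st' = true := by
      cases hck : (can k && Bool.not (memN k gs)) with
      | false =>
        rw [hck, cond_false] at hw
        refine ⟨fun hcan => Or.inl ?_, st, hw⟩
        rw [hcan, Bool.true_and] at hck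
        apply memN_iff
        cases hm : memN k gs with
        | true => rfl
        | false => rw [hm] at hck; cases hck
      | true =>
        rw [hck, cond_true] at hw
        obtain ⟨a, b, e⟩ := dcd_ex (fun S st' => badN S N && walk gs (enc h) f (Nat.add k 1) (mulN N (enc h)) st') 8 st 1
        rw [e, Bool.and_eq_true] at hw
        refine ⟨fun _ => Or.inr (bad_of (S := a) ?_), b, hw.2⟩
        rw [← hN]; exact hw.1
    rcases Nat.eq_or_lt_of_le h1 with rfl | h3
    · exact step.1 hc
    · obtain ⟨st', h4⟩ := step.2
      exact ih (k + 1) _ st' hN' h4 k' h3 (by omega) hc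

def walks (B h : ℕ) : ℕ → List (ℕ × List ℕ) → Bool
  | _, [] => true
  | k, (st, gs) :: r => walk gs h 273 k (mulN B (powN 12 h k)) st && walks B h (Nat.add k 273) r

theorem walks_spec (B h : A) (r : List (ℕ × List ℕ)) : ∀ k, k + 273 * r.length ≤ 4095 → walks (enc B) (enc h) k r = true →
    ∀ k', k ≤ k' → k' < k + 273 * r.length → can k' = true → k' ∈ r.flatMap Prod.snd ∨ ¬ Good (B * h ^ k') := by
  induction r with
  | nil => intro k _ _ k' h1 h2; rw [List.length_nil] at h2; omega
  | cons a r ih =>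
    obtain ⟨st, gs⟩ := a
    intro k hk hw k' h1 h2 hc
    rw [List.length_cons] at hk h2
    unfold walks at hw
    rw [Bool.and_eq_true] at hw
    rw [List.flatMap_cons, List.mem_append]
    rcases Nat.lt_or_ge k' (k + 273) with h3 | h3
    · rcases walk_spec (s := fun k => B * h ^ k) (fun k => by rw [pow_succ, mul_assoc]) 273 k _ st
        (by rw [enc_mul, enc_pow 12 _ _ (by omega)]) hw.1 k' h1 h3 hc with h | h
      · exact Or.inl (Or.inl h)
      · exact Or.inr h
    · rcases ih (k + 273) (by omega) hw.2 k' h3 (by omega) hc with h | h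
      · exact Or.inl (Or.inr h)
      · exact Or.inr h

def hd0 : List (ℕ × List ℕ) := [
  (0x4098ec49db1d721cfe27a4e90185f7d6639416acdc0201c2d1a750b8a2c89049e672146115ce4d1ae16f786724675b77e8109448438ce879ff8942a9de35a36e8c65aa4f9536e7330c2a51dd4aac06689d3dcb220ebd10aab090b858523fe1b2d3d9e128e27e05f34130b6573b06fbb0d8c8352a8c56dc6c7f08c9bf8e6065bdfa7887dd8b0e555f02dd1dc6f51733897baec3a223927040617eb32d44b6ff1452f0266fd5df2b4a9267501bb114de774d6b9c1a4e6b518ec71d543f7eeb2200302235392f10bf20aabe8e8aabf5a82339511a3737b99cf32f244c3b83c1af63f108513dc028c93ae53a4c0614330df3d3a83309a1b2126716503bbf9e877d81089f257ca83c21c819c935d21477c12dd4cf23aebb97f28e47b06631bd0216b4f5f2622fb3958570f962c1577aa08b325c49e2b6f855f5b79a4b11a686246d0a978c8fbeee0fc52f585a9804af739be42ae16f97bb2b4192238adb9eea1e28d10db2514208c535095dfda6f25b66dc9a16dd8ba648828d548f8e701332981d065e9d1c2003e749dbbd0053f015bdfb751bf50bfb361e31faec2eb0542acf9eff9de6a43597addba7e064ffa6878805d762998abec1b85a5eed86046ba302deb06c4d64545cb056f5b5cfeab4e88df60932779eedd1581534b187b451b1c315be3185d7e341f60142e0679ef10ff972fcc6b5e99c093401ed2cabab9916cce6e1433bacb6bcc1d6f4bd4a16bdd15dbd5da1b546dde3170a90871e55bcd501dc05fc989a3c26d2cbb3d75af20166c3e1d57f2b204b54d38d2e9742a1fc82f55e89b73abff06305bc086b7cf7d2d7e7ac7145de044f,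 [17, 30, 35, 66, 70, 94, 153, 169, 194, 202, 203, 213, 230, 245, 247]),
  (0xcc5382daa122a1822b273f2dda4e23f336a85ca54ab15a4ec855329f84692a321e817cf05e78fd4afabcb9e8f8e397099654aecf4dfecdd0dcb34714c311efbe68ca5ba6b6c51944a22ba00ec6d784e4d48a49e2b0711beb370a25b1c5e19de6254b7d883ae69bde74872e3dec8a6c2f35326f4f957b0509f7e97f6516cf222878fea5ac16a432407cb65b4a3548230d799cfc3e1417c9a522146807326e58cf8ab2cdb47386c0d44ea1383db8749d6390d48f1168fa5282468f57f460f4e9058579d7d80def63ae38b3c9beffbaf6d37f8deca091609ee8d50499c94a945ae5b8881c97f6224037257a64fb717d4bfb69286ceed35d7b2bd80a3b1404bb9d0aa68f8fad09a3472050d36e20277a895d488db102f6f2bf4748247bfc06599a4937634c7197a61ce195b8d3a24aced791a103bce99c7c7f314c8e723e753b7acf49c97deefe7ef3d676b61712a612e825d7b62218c371798938daa8733d8ac93417f09077af4899873cf1cb6e45bf77a188129167cc7d5a47dbb815baf7aaf5b6863bf38d1b66f34d2ec02015de237443d466d1b5fd5d4ac110ca174db5a98b3afa56a2aee1da5bbb91bf797b694ec5173043e53f6eab7f1cd60fa9a009019e1424519e80ed7a65e31de4ae699de824b460fb4ff88605b6ff7b193a9611574e44f913e3008f926b490651238308782fa7a0416c9fea777fb95d94797ed356cf,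 [295, 308, 357, 383, 389, 390, 439, 463, 502]),
  (0x77ad997530d14e47313fac90621bdfdd7f528ee96638ed6c9013cbe27b1f58977067fc36cebaaad9d9a05bf3da076c826c8e73685b3d9afc559e9362a2f9997eae5f8b41dd2fb80ba056361b24d906b774ee4ba83fd3f9edb273a00440af39cd6927eefee0c8e4444e158ddfb9b65ddaf64c8166864871e639ed1dc3cea8741c641bff4329f0049511840639226ea31e6e25a5d337ba70a51c87430decc04264174c9b2fda3c01a9b222b54887345fca38b4509d57e18c70273fe32fe67cdfd77d4d4c3ebb87b1334c10c88be26bb0ff0b97f4381e94913be42b35ae104e265855bdebb5038076e3eb16221d4a2165f5a64f837cde5e740d2dd6a9488ee326a04417cf2b4d16f823167534761203c925d5f740d7ed70db5be82936c3ea408bfbb41c586fd690cbdb18677e1989e8e82afad5f4eb56ef621b187ff91f7dd81395ef941cd4e3d14a84f4180d810db0372ca54252fa638463167dea1c31fd4b98d139dc83885b118a7f2a349e10effb8abb465e1bbc80787e0f6285c166d1b63184b6b761fd4790ce987eefeb05b71e3785241596ba08d9f422edb2ce9a052234998510a4a96f5e03f390b819d5dcd701c121ac6c78f0ba992211c0310e80d2cfc68c9a48aeb875a9ace342c8f,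 [574, 590, 595, 622, 650, 701, 713, 741, 760]),
  (0x2916c43bf21102d374ea0ddf0ca010357b45a7d4433e7cd6e5a2c9df799eeb2d7a1e66d8f8b170c48c6e29d0b6d7018dee697df3fcb2acdefcca1cd4d4bd3fb5a4781b54348d1c8bbe2990f7421af969763ec3ea5df553ff5c1009eb277a2bc26678dcb52d8e7f5c6789b5117f33945835d46c250a4e4312fb352841ebb3c32fa081d841112749ae85d0df6f1fcacf328bab35a2ba0e503cfce05eca6e86c865937093c57c44b16b295c3ebfa49a9b26c4772fa902a7cf27c95319cd4be17afdf502688fb2d013386a839451bcb253d26b3288556350dc16535388bc58e6e5a0900057d30220828313aff9b6827f7647b7cd301ece9e511fdefaf950d03be39d66fa62f59e0a99928b2ec408fadcf0ef0dd91c72f803bec559167eb68ed0f60f957b229b5f94c985d72def65697306cceb1ab30cf13bc5ebea98335bcc9f526923024d1999ea6ccfe7a9bf3ba7f708d9c91fdd6569891369f1a947bf678962d3a74d91ad0bf992bc7fa3fafb6a528c94f996dc579f24bba0e3266ccf, [830, 863, 876, 890, 903, 933, 952, 954, 973, 984, 987, 999, 1002, 1013]),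
  (0xc2f121f528e781e3ace8f70c69549b0d689b77c30f26ca3bfddf23ebbabc48808d4c789b0312896b4b6f657bc7e3c512aab5e6eb96bf4613c2ae6a106dc5b21757588842eb400410904202bfd4747e5fdde8738084c94825db986b1090489803fad62826d27e4f8a177473c0ef067a1512c104196d90a5384d1e172a0bc5489aeaa82383a0fdab60670600d6d5de390e5917e84d269ad921159acaad8a7e3a83513d84f475e9a9beeca40f090b8e1ac5f891bf0d96f5c76ed0aa680b9646fc76b538425b288f7bd57fe2d9c07a1ca3bf43c5679c56eea320ec353ffdbc27c1df1d9259ac2f2f82a5078386120c90ccc3bcc5246f4e07ee4df30f8c1ddfe7df142748b29489c40d89798ad882b88e30d144a79f4ff417b7e4c9053d960c55e73c3b448862b13ce941ee15b412dad033080268740ce4dd0f9307e0ab75fc0885eb6ec3bd80a256bf8104ecf, [1095, 1127, 1165, 1179, 1182, 1195, 1253, 1258]),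
  (0xd898d09cceeea083c89c0b3c2b4b16a41107ea41ba215c271b3d714ac1c2865dfc686e768ba711a79f6144375aff2c8eed3185ceca3d1b531958cc3ddbafa112388287ebf0e8462c5f57589ff4df356c7da85931d2ccdde9b8344d9950fbd8f656e71f4ab5608526002c46717b1724aabf25b97e2557425fe9620b8d5dfe177c0c0543f1e16c3a8913a314ef0e6af86426947f30b9a9fe7045f0382ca1c41a0103c39a2a907aacc84f024634f4833af4fa6e78ba10bdcd32caa8f2a1a0e0bb288593907c0e4cf2141e985f8c5e1c9739a2e59862293bb5d9aed1c68023a9de072b255fb85ab467b6aa973bf0cf8906895bbe82df613373892b402fe800c776dd61d27651b42e9100d4490cceb1f502330ae42b115d289ed04e660864f, [1383, 1416, 1419, 1433]),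
  (0x5cb34eb87d1566a4e4a3a6c5262e40cfbf17e7c3cbfaa9c2771921e4f27798233c378c5003d0232c1deca1f35a2216e01badb797b0ee0c915510466bdf3d21ef47bb7cfea9117a2311a527b3b48ff1e0025e5d061ca238f4cb3e5c5a2d9cca3fdb43aa2f5d5ba005cbc5dcbb2c4c814ea93e4b2ef46b32c07add0cfc3670a71e339c583b1a0d3d56e6016641c59fddd6fe59395e4c50a7b6f45e300fa5be079e98de01eeb42ddff37d7857f65e4ceeab52e52bd3d7df72a9076f9b242c042731112115f05ba43cf3aa33847277c41ab68f, [1640, 1671, 1677, 1695, 1737, 1755, 1769, 1774, 1786, 1788]),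
  (0x75c140b41da6aecb096d1297bc52affc1955630337314a755c9ab7a9daecb00e8fbb6465abfb785e0cf0f4208457970c26ab11cd78a85300af9d7d505179963459d280714d37a112b944880aa823722432ba0fba27d0f07ee31b325fbb5603523dbc91ade5c57d33af24d8896f47c6b59a0ad8cc76d1873a498f55aea0935b29e1bd981cf2f8ac95c02095c29641c40af9325127c8f7d41631f1e18ca3dabbcea72896c3c3167456fc1e7484bef4b2640f, [1914, 1929, 1966, 1981, 1998, 2042]),
  (0x472939adb25de25b4f89414e53815763b18b9512ee21888f634d2ee0d8474385c8f4455f90b648ae1dcfa2771de73317d2fa3cea6f74b05376412a4fd68e2466c76ee05e2d87a0d5960ce0b039db0a2eae085e9bc4453ea9faa7f64b4d9de8865f9b7a566a6efad4856cf9f1ca87cc924aa0892915c18d3376f027ecd16c74e0d8609b2b8f, [2250, 2255, 2282, 2298]),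
  (0x4de8a02d7b6f65324a333c6fb0c4bdb674751d9ed6a577acf82452ed8f83c0fe91aefb6dce7e32b62e39b50fc19fe670461076f519754d78a5d00cd84fd68b7e6abc9e3899b48afd08a7770df34ca29adc241905eb27c6f43ba8ab157a4ff7ffc7509e86c0ba14278f, [2479, 2511]),
  (0x2d8b876ea593b0e9af7791205509e9685b4710cec9e7bdfbdee09934590189b84a131b4163fc3e85a94c30ebfed338753f968e921f66f31c2ade4f1b18e72b860941a4a7dc8d54e58795072e0eee0f, [2750]),
  (0x81d6596e1ecd860bd1cf5226f991d6e28e2526715274052463b9aea94977d166d348c3b18c73e6acdf91838d9b2402284f, [3021, 3071]),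
  (0x165b1585980ca4d388754cf0fee840043fddfc11d4e62e1800e933db6b8f, [3310]),
  (0xac0385555828dac19678d049915853a0f, []),
  (0x21da0a97da24f, [])]

theorem hd0_ok : walks (mulN (sp 15079016609498) (powN 12 (sp 16144201005754) 2)) (sp 198339713878) 0 hd0 = true := by decide +kernel

theorem hd0_spec (k : ℕ) (hk : k < 4095) (hc : can k = true) : k ∈ hd0.flatMap Prod.snd ∨ ¬ Good (U 1 2 k) := by
  have e : U 1 2 k = (H3 * H15 ^ 2) * H45 ^ k := by unfold U; rw [pow_one]
  rw [e]
  refine walks_spec (H3 * H15 ^ 2) H45 hd0 0 (by decide) ?_ k (by omega) (lt_of_lt_of_le hk (by decide)) hc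
  rw [enc_mul, enc_pow 12 _ _ (by norm_num), H3, H15, H45, enc_el, enc_el, enc_el]
  exact hd0_ok

def hd1 : List (ℕ × List ℕ) := [
  (0x7bb0f39ed9a5f9f19706b6c1aa02615109e101e9dfd35c78be281b8d76f2a99c84f2dbddb426b9f904d14019a84106f4c959533b07943effbda9bd71ebbed19f5b6e282b39ec0b654a2a9cfd7bb743813e5bf567adf8f9482f1c75c615c8a17689e30f26de9101e498dc2938c079e3be5632c4586a62bc55ffa467a01c80749a7b5eeee01ec370e9e66610a3f0157625c7e8e41e37718b06defb4af9b87006b0a436756db90f92ccd752829222c760c9bc0f0775e37fbf135a252c69159f3282ff6a6514021a70b67894c0e3f2b96f01a33386f2b9b8bf89f0b9ae00ca74e6ebada3af62f0acbd2affb574aa1919a2bf081e47d2561a0d8096549df4ddb44362a9a4b585547f8fab31982c507a8c6b13d9cb4c5cb057d7706d45348138cc6b4fe59231b69dec6cbbe2cb599bb47737ec1db82b2c723dfc002312e00d8cbc3cdb497e1da1208de7c40c9c7df74b91e8bd9c9ea8bed78dc766c4cdb07493fd08a8def11a6f90a375529497247d27d490a43811ff64503f88bfe4b73fd919bde530cb02f43101aabc41a4b2d9b0c12a2a911278c8e7815ba1c2fdeec72fa610baf4bdc155c341525cd37167cd01f7209f225a460992b0f0d7df7a39e552981932c7670fd91885f233024dfca09325245b53ec77c4317b847dc5da9a43610245a6958640dda3beb7dbcc92884347b5e5184f11ef88dd989a4bcd3a7bf528f47504bbcf8c6428e60ab2cab70264b594100ce6f16088c0d1d0f1ff1c8d774203be22b1d141f2292ef93924e3358bacb9c3d82918f5f2055f849e94722b9891af12344b846cb4a55a243feb36871fc4d562736bb8bd49f189055d7d9fd3e4afd0f,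 [33, 34, 81, 143, 170, 177, 197, 212]),
  (0xe5caacd97e32d278b51b6648eda281f74ef7d8ab7f95e88f387d837ac10584555ec4c7d9b8ad2ce58d0a79b8badd08748e24a342d83ce17d97553be7e9df39e5f94f475297cab9c749ad0a5eba8d979d3e1b097a821e8cf0ad2d9c2c3295a9c9466a7423efd3a6746c0e7f4409d437a4e8aaa7ed55dd585920ae0c0b8f94841a2812678cd31141a9a7d7d537d4281b75b6000ce0a705d9d0bcda2536b01175d99f6907a5776fba833880b26289cc924f4dda5c19db94a6dd0976a57dba6a969433d21cc34b6ac14afb9b2b73e9e3bbfb9b029b78d5b0b05cae3c4a442083047c365380f3ee7e813f511b708d4158cdf0a2412f0f77ecb58aa54318c585219c0349a15eb5a9c580e4c8cab23b27f6777a4adab336f4044cdb382ff3efcbd79185ad6bde3e001c39e70fd53d75abda6fc6809f0ca416605859c317b76a491a352a1f586ed996c77a3b805927d1cb2a6766854261d3c46d6e8decc227bf02e0578bb1edab0060e4892188510ff08a3edd63586a8129994bc891da32585f7f86b7b1697fef76ef64aaf303b4e3ff6f2b8d2446778fa189046d97d76e0535f9366b0e9162329b3a89f26a0e7f72fcb02706229f41e70ecdb01b84845c099dc712cc4f62c06c18f71b9635b01913aac68f0e30133c54343296c28a45289d7e5ab31a9b02a4f36daf2a598a15b8b829653249a2794abbb761627f9a3d10131323a9669ed0b86f12f04ee15c53f97df46,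 [297, 302, 310, 344, 361, 366, 376, 389, 405, 442, 460, 474, 501]),
  (0x31af1fda00d44eb75cb8ba3861630bacea4504290bdf63291556960b968ce8115c1010adcb422a12c9b084ca8813797c2ec6c7217272a090a0331ce9e3a11d50e7b285b0ce5c62caa9ed3efc192906e1c72986a950654be934f41b4077c6219480a2ea3fd49160d21f8b444fc14e116cf1884dd91fcffe53a9794c6ba4e1cb957fbbbd54e7be1b5adc21d894993374da075a10e0114eea1505ed2a71f2e66c3d550bd7399b7abf9e3d59c0f34469c6320e678cf32031e51ef0f29c98f7abc9ee6f35c427c38c64d7b86430d9061ebf53a57f717c2801c8773a1274e7905186a656d6909b11d6d3c195767305f2ceab4bcaf3d7510ee2bb4d793114c0d50d69fc262056ca1a09b90c9e6ba356e0ac0cf1954dd2fc7b185552bfc92883ac32602e8a37fd6b6f16615b0d879be573b75df2d9a553ee609cefbe10bf66285a64c040d91eddb6441d61d1b174617bc26322d7e144a199545f89418eebc281071ec982f6941e25d91432233e13ac982e92ed23061428475fbc667d2907489b93d074482c4a0080c0d56b1ee43b15317fcffa03a6d74001ffd86616e22e46f49514b90a25b7d040cc09869e747f00a3b504474497ff90dcb32263f2bd18fc5ae6fd9c82a88fd445bd186e2f95c149,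 [585, 618, 622, 663, 696, 713, 725, 749, 763]),
  (0x10e1a59ef8a960a6a137008b9bbc3399341906651a40458a72a32e8bb0d086086858f2ac815cc34cd3c31c68ffa84951beccba368d2f15ad3df02bef2ee07be72c2a14f2ccfa1086b143f9ec77d5148f55d2a5fa4e650e2730fb46f5f0954578ac2ab04669328e35cdd8344ee04a36f70aab29dc314d1d6137ddb4e921d01bf18637482a045d6160dc62950d91085981b3879a4dc6ede9c0891faded3a34fc2ea1e008f067271a46acf88c5dd14a6a25dc65887bed8d01e91eb1d641fbccaf348a5a7e50ac935108b2c5257ee027501f85c668872db73d2f236e4f0b7dd86be0e58124ee48d5bd5fbca2bd0c67c8b700a99fb8df307c23599b6ea6ca208f826cb1920572a376c1e16af91cc07a603400794c3171982c0a185752649b0c7c377845cdd9bfbc5b00286194020b8d0313d5b9c0ccb09f912b113410ed3143d5e430a0e7217df3758fd7640c848e494ad9036eaf1b1310eb05a1830d2428aa57bbaddd6b6c617890e312f349ba9b923d674bad5a87e73422618357808b2bb63d481ed2534b2adbc7f646, [876, 877, 886, 927, 942, 957, 966, 973, 996, 1007]),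
  (0x27e695b757d6c3c8015ead4a5c034b1c7b0102dd4e9b57000bd3d24588581fa64e2c4d535ff181a1a7fba3fbb67c7061c41c41e9c946c2e6aa29a0cdfea585f1879c10390548de1cdb92e2db720e2e02607c128707fc004e4b1f13b6f06f6b4498067e4e3f35cb8033f3d6101b7399af8e02c33590657e1f391618e04a8bca162cb453b7f2613e3101a8f0ee52ea69a0e61b1dbb42e14f5eb4710362b0cd62e516098bca9d2f8781bd9ef0556ae13723e4e90c5614b49a2765b4daefb0ad922532dbe0ccf6f284006353c7224dd0601fe29d6250b6e289cbd22422e96f2605a3fb09600b6074b4402180111ce5b11a13fab577fbc56daf8f945a57e899eb690134f26ed7d7824db2509b9db7965f9cd52cf2b139d6d180e9bae5df5d7d808209c8dbac3ccc6063506b19952602c1480dd0d396f1305c479bc77ceb8a25d3cc462a329438cfb525f68348d5cf, [1100, 1118, 1167, 1175, 1224, 1228, 1243, 1270]),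
  (0x20afca5243f16ee358bdb98f2dff90e7aaa59397caca4a52754093e980f2a43d9c37eca516307871915b77d85f21fd4067279d1082e3396cc113f019d74376763fdd8288c866a37901b0a8625be59b7e2e8bbd65aff5c32a13590eebda8c08444e2c69a8fdff04a381bdfd351cdb074f767b6cd1126f15ff327e3b454cf5840bbef75b240c66cc804cc9f1a8ee831165ab910f8b07758a29e85b60f39dfcd97d7df04a7487f86d4bfb19367e524b342e7a38279c0d3bfaf82e8857058c43b35de53c91459972eeef43ba35a1cee3a0e350a7675d74b3ba2ee412a622e329cc73d81c67ab8d536a85d5dd3319b39dd8ecb88de473b6a2e7b2375450909a0e3f7053554a9f19e06b39872fa16b77d77dd05b0b3506, [1389, 1405, 1423, 1529]),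
  (0x15b3174b8495671d230ee0ac8d30ab94b7bf61ce4eebb4fecf0b5d21e87107ad56b66b27bd7c2a08d5043a4ee5e519bbd29b7fb6202c1fee7dd1a717fe38fe6e784c44c1e7ee67417abd07b1320f648287c8f61a653fe79184e712c670e15481c7289744e0042e4fccac69fb8d5681d651c17b7ad279169a4791d61262bcdf1fdd9a0d9aa898906b7b49c00b67b446d20fcb871c6ba6c984883996f28ddf033a09a36cdded69c5d3cb7e73455e98de6ff08620e664bfb0de9f1716fa79d96b3c6a19e56fd2d6ba95f927388c530248054840269706f01dd8c355c08166da5176878c2e4f, [1661, 1691, 1719, 1721, 1756, 1791]),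
  (0x38f39805e621296776f286936c8c536e58d0e173c2159a2b8350a1f61252e879f3e43206b7b5b5df84333626855b8d0fc267d68b3f70496701529ed1302249147daf150bfef6558cdee2d807997bdb8cdd69e950bb53cd65e7c008d70c8043005fc0af83fe34ebf6b27a37bca2a3b00e8e38c88074a28ac135d163babc410390dbed60e3da10305c936f311aa5da924980ca40692bde1ddb516d38d40317882643c39e16275870e6e78e4d098777430f709, [1914, 1919, 1929, 1934, 1993]),
  (0x738a5ddcbb3d11ea9d5b17ee5a44715393873cf5937aef1ea837d24e5106462a795a2006feea03cc0abfe7196235d4545105d195ad2172fb89cdcffd3582883e5d9ff1495727782d3a5ae9b9a1165810381fe61e0a03463a4fcd4b1114b5b6bdfd8df03060356f86469bb1ba8580a356704ec5353b062ea34a7c2a250512261861b687dc2eb2c773673208c20b2089, [2223, 2282]),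
  (0x2c59fdd3ad8be754931734e029a95cbec93bc5526cfbf7e4564119f3aa80aecb40db0fe6dcb9c2c6395f40f11779f77b25af7c846092aa87890bc461094758bbe7931f690ca773cb6ceaab8237a47650ddc2c716156fd9b8add68cb7964a9f115a3f6839dc71cc7cf, [2461, 2539]),
  (0x1eb7e1c4d64e14e7111a134d00e240d4b09ecf408b9a933309b6eaa8ce5bb54c846e93701cb5687caabb612103f6e5bb20750dbd0f949011e2be61c2f6868fa60f91034a7927e5806, [2733, 2780, 2782]),
  (0x81f3f7d46e2aca2d60db2d9a46203815b7bbd0e87df7f557db91ef7b73af3cf86d1faaf06c4bed0d321ec137729988ba180679004f, [3022]),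
  (0x6d85818fdcdcd346a6c0dc08a6f0c1f81c85fc8f7091d7a86ddc9af57a4525886, [3310]),
  (0x282b2cdd37e81a1df5284337e0d649, [3567]),
  (0x1d2dc4fbf5d46, [])]

theorem hd1_ok : walks (mulN (sp 15079016609498) (powN 12 (sp 16144201005754) 3)) (sp 198339713878) 0 hd1 = true := by decide +kernel

theorem hd1_spec (k : ℕ) (hk : k < 4095) (hc : can k = true) : k ∈ hd1.flatMap Prod.snd ∨ ¬ Good (U 1 3 k) := by
  have e : U 1 3 k = (H3 * H15 ^ 3) * H45 ^ k := by unfold U; rw [pow_one]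
  rw [e]
  refine walks_spec (H3 * H15 ^ 3) H45 hd1 0 (by decide) ?_ k (by omega) (lt_of_lt_of_le hk (by decide)) hc
  rw [enc_mul, enc_pow 12 _ _ (by norm_num), H3, H15, H45, enc_el, enc_el, enc_el]
  exact hd1_ok


def keys : ℕ → List ℕ
  | 0 => hd0.flatMap Prod.snd
  | _ => hd1.flatMap Prod.snd

theorem reduce {σ : A} (hu : σ * st σ = 1) (hg : Good σ) : ∃ c < 2, ∃ k ∈ keys c, CodeEquiv (code (U 1 (2 + c) k)) (code σ) := by
  obtain ⟨d, i, hi, j, hj, k, hk, rfl⟩ := classify hu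
  have h1 := ce_X d (U i j k)
  have g1 := ce_good h1 hg
  obtain ⟨c, hc, k1, hk1, h2⟩ := to_base (k := k) (pair_ok hi hj g1)
  obtain ⟨k2, hk2, hcan, h3⟩ := to_can hc hk1
  have h4 := ce_trans h3 (ce_trans h2 (ce_symm h1))
  refine ⟨c, hc, k2, ?_, h4⟩
  have g2 := ce_good (ce_symm h4) hg
  obtain rfl | rfl : c = 0 ∨ c = 1 := by omega
  · rcases hd0_spec k2 hk2 hcan with h | h
    · exact h
    · exact absurd g2 h
  · rcases hd1_spec k2 hk2 hcan with h | h
    · exact h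
    · exact absurd g2 h

end BD

set_option linter.all false
namespace BD
open Finset

def tb (v l : ℕ) : ℕ := (v.testBit l).toNat
def cnt (x : List ℕ) (l : ℕ) : ℕ := (x.map fun v => tb v l).sum
def val : List ℕ → ℕ → ℕ
  | [], _ => 0
  | a :: r, l => tb a l + 2 * val r l

theorem cnt_nil (l : ℕ) : cnt [] l = 0 := rfl
theorem cnt_cons (a : ℕ) (x : List ℕ) (l : ℕ) : cnt (a :: x) l = tb a l + cnt x l := by simp [cnt]
theorem cnt_append (x y : List ℕ) (l : ℕ) : cnt (x ++ y) l = cnt x l + cnt y l := by simp [cnt]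

theorem tb_le (v l : ℕ) : tb v l ≤ 1 := Bool.toNat_le _

theorem tbx (a b l : ℕ) : (Nat.xor a b).testBit l = (a.testBit l ^^ b.testBit l) := Nat.testBit_xor a b l
theorem tba (a b l : ℕ) : (Nat.land a b).testBit l = (a.testBit l && b.testBit l) := Nat.testBit_and a b l
theorem tbo (a b l : ℕ) : (Nat.lor a b).testBit l = (a.testBit l || b.testBit l) := Nat.testBit_or a b l

/-! families of masks -/
def zipS {β : Type} (c : ℕ) : List ℕ → List ℕ → (List ℕ → β) → β
  | x :: xs, ys, k => List.casesOn ys (k []) (fun y ys => force (Nat.lor x (Nat.shiftLeft y c)) fun z => zipS c xs ys fun l => k (z :: l))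
  | [], _, k => k []
def stepS {β : Type} : List (ℕ × List ℕ) → ℕ → List ℕ → (List (ℕ × List ℕ) → β) → β
  | [], c, m, k => k [(c, 0 :: m)]
  | (c', m') :: r, c, m, k =>
      force (Nat.add c c') fun cc => force (Nat.shiftLeft (Nat.sub (Nat.pow 2 c') 1) c) fun h =>
      zipS c m m' fun l => stepS r c' m' fun t => k ((cc, h :: l) :: t)
def tabS {β : Type} : ℕ → List (ℕ × List ℕ) → (List (ℕ × List ℕ) → β) → β
  | 0, t, k => k t
  | n+1, t, k => List.casesOn t (k []) fun a r => Prod.casesOn a fun c m => stepS r c m fun t' => tabS n t' k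
def famS {β : Type} (n k : ℕ) (f : ℕ → List ℕ → β) (d : β) : β :=
  tabS n (List.replicate (k+1) (1,[])) fun t => List.casesOn (motive := fun _ => β) t d fun a _ => Prod.casesOn (motive := fun _ => β) a f

theorem zipS_eq {β : Type} (c : ℕ) (x : List ℕ) : ∀ (y : List ℕ) (k : List ℕ → β),
    zipS c x y k = k (List.zipWith (fun a b => a ||| b <<< c) x y) := by
  induction x with
  | nil => intro y k; rfl
  | cons a x ih =>
    intro y k
    cases y with
    | nil => rfl
    | cons b y => exact ih y _

def cN : ℕ → ℕ → ℕ
  | 0, _ => 1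
  | n + 1, 0 => cN n 0
  | n + 1, k + 1 => cN n (k + 1) + cN n k

def rk : ℕ → List Bool → ℕ
  | _, [] => 0
  | k, false :: b => rk k b
  | 0, true :: _ => 0
  | k + 1, true :: b => cN b.length (k + 1) + rk k b

def OK (n k c : ℕ) (m : List ℕ) : Prop := m.length = n ∧ (∀ x ∈ m, x < 2 ^ c) ∧ c = cN n k ∧
  ∀ b : List Bool, b.length = n → b.count true ≤ k → rk k b < c ∧ m.map (fun v => v.testBit (rk k b)) = b

def InvT (n : ℕ) : List (ℕ × List ℕ) → Prop
  | [] => True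
  | a :: r => OK n r.length a.1 a.2 ∧ InvT n r

theorem zip_lo (c l : ℕ) (hl : l < c) (x : List ℕ) : ∀ y : List ℕ, x.length = y.length →
    (List.zipWith (fun a b => a ||| b <<< c) x y).map (fun v => v.testBit l) = x.map (fun v => v.testBit l) := by
  induction x with
  | nil => intro y _; rfl
  | cons a x ih =>
    intro y h
    cases y with
    | nil => simp at h
    | cons b y =>
      simp only [List.zipWith_cons_cons, List.map_cons, Nat.testBit_or, Nat.testBit_shiftLeft]
      rw [ih y (by simpa using h)]
      have : ¬ (l ≥ c) := by omega
      simp [this]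

theorem zip_hi (c l : ℕ) (x : List ℕ) (hx : ∀ a ∈ x, a < 2 ^ c) : ∀ y : List ℕ, x.length = y.length →
    (List.zipWith (fun a b => a ||| b <<< c) x y).map (fun v => v.testBit (c + l)) = y.map (fun v => v.testBit l) := by
  induction x with
  | nil => intro y h; cases y with
    | nil => rfl
    | cons b y => simp at h
  | cons a x ih =>
    intro y h
    cases y with
    | nil => simp at h
    | cons b y =>
      simp only [List.zipWith_cons_cons, List.map_cons, Nat.testBit_or, Nat.testBit_shiftLeft]
      rw [ih (fun a ha => hx a (List.mem_cons_of_mem _ ha)) y (by simpa using h)]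
      have h1 : a.testBit (c + l) = false := Nat.testBit_lt_two_pow
        (lt_of_lt_of_le (hx a List.mem_cons_self) (Nat.pow_le_pow_right (by norm_num) (by omega)))
      have h2 : c + l ≥ c := by omega
      simp [h1, h2]

theorem zip_lt (c d : ℕ) (x : List ℕ) (hx : ∀ a ∈ x, a < 2 ^ c) : ∀ y : List ℕ, (∀ a ∈ y, a < 2 ^ d) →
    ∀ a ∈ List.zipWith (fun a b => a ||| b <<< c) x y, a < 2 ^ (c + d) := by
  induction x with
  | nil => intro y _ a ha; simp at ha
  | cons u x ih =>
    intro y hy a ha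
    cases y with
    | nil => simp at ha
    | cons v y =>
      rw [List.zipWith_cons_cons, List.mem_cons] at ha
      rcases ha with rfl | ha
      · apply Nat.or_lt_two_pow
        · exact lt_of_lt_of_le (hx u List.mem_cons_self) (Nat.pow_le_pow_right (by norm_num) (by omega))
        · rw [Nat.shiftLeft_eq, mul_comm, pow_add]
          exact Nat.mul_lt_mul_of_pos_left (hy v List.mem_cons_self) (by positivity)
      · exact ih (fun a ha => hx a (List.mem_cons_of_mem _ ha)) y (fun a ha => hy a (List.mem_cons_of_mem _ ha)) a ha

theorem stepS_spec {β : Type} (n : ℕ) (r : List (ℕ × List ℕ)) : ∀ (c : ℕ) (m : List ℕ) (k : List (ℕ × List ℕ) → β),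
    OK n r.length c m → InvT n r → ∃ t, stepS r c m k = k t ∧ InvT (n + 1) t ∧ t.length = r.length + 1 := by
  induction r with
  | nil =>
    intro c m k hm _
    refine ⟨_, rfl, ⟨⟨?_, ?_, ?_, ?_⟩, trivial⟩, rfl⟩
    · simp [hm.1]
    · intro x hx
      simp only [List.mem_cons] at hx
      rcases hx with rfl | hx
      · positivity
      · exact hm.2.1 x hx
    · exact hm.2.2.1
    · intro b hb hc
      cases b with
      | nil => simp at hb
      | cons a b =>
        have hc' : (a :: b).count true = 0 := by simpa using hc
        cases a with
        | true => simp at hc'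
        | false =>
          obtain ⟨hl, e⟩ := hm.2.2.2 b (by simpa using hb) (by simpa using hc')
          have h1 : rk ([] : List (ℕ × List ℕ)).length (false :: b) = rk ([] : List (ℕ × List ℕ)).length b := by
            simp [rk]
          rw [h1]
          exact ⟨hl, by rw [List.map_cons, e, Nat.zero_testBit]⟩
  | cons a r ih =>
    obtain ⟨c', m'⟩ := a
    intro c m k hm hr
    obtain ⟨hm', hr'⟩ := hr
    obtain ⟨t, e, ht, hl⟩ := ih c' m' (fun t => k ((c + c', ((2 ^ c' - 1) <<< c) :: List.zipWith (fun a b => a ||| b <<< c) m m') :: t)) hm' hr'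
    refine ⟨(c + c', ((2 ^ c' - 1) <<< c) :: List.zipWith (fun a b => a ||| b <<< c) m m') :: t, ?_, ?_, ?_⟩
    · unfold stepS
      rw [force_eq, force_eq, zipS_eq]
      exact e
    · refine ⟨?_, ht⟩
      rw [hl]
      obtain ⟨p1, p2, p3, p4⟩ := hm
      obtain ⟨q1, q2, q3, q4⟩ := hm'
      simp only at q1 q2 q3 q4
      rw [List.length_cons] at p3 p4
      refine ⟨?_, ?_, ?_, ?_⟩
      · simp [p1, q1]
      · intro x hx
        simp only [List.mem_cons] at hx
        rcases hx with rfl | hx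
        · rw [Nat.shiftLeft_eq, mul_comm, pow_add]
          exact Nat.mul_lt_mul_of_pos_left (Nat.sub_lt (by positivity) (by norm_num)) (by positivity)
        · exact zip_lt c c' m p2 m' q2 x hx
      · show c + c' = cN n (r.length + 1) + cN n r.length
        rw [← p3, ← q3]
      · intro b hb hc
        cases b with
        | nil => simp at hb
        | cons a b =>
          have hb' : b.length = n := by simpa using hb
          cases a with
          | true =>
            obtain ⟨hl, e⟩ := q4 b hb' (by simpa using hc)
            have h1 : rk (r.length + 1) (true :: b) = c + rk r.length b := by rw [rk, hb', ← p3]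
            rw [h1]
            refine ⟨by simp only; omega, ?_⟩
            simp only [List.map_cons]
            rw [zip_hi c _ m p2 m' (by omega), e, Nat.testBit_shiftLeft, Nat.add_sub_cancel_left, Nat.testBit_two_pow_sub_one]
            simp [hl]
          | false =>
            obtain ⟨hl, e⟩ := p4 b hb' (by simpa using hc)
            have h1 : rk (r.length + 1) (false :: b) = rk (r.length + 1) b := by rw [rk]
            rw [h1]
            refine ⟨by simp only; omega, ?_⟩
            simp only [List.map_cons]
            have : ¬ (rk (r.length + 1) b ≥ c) := by omega
            rw [zip_lo c _ hl m m' (by omega), e, Nat.testBit_shiftLeft]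
            simp [this]
    · simp [hl]

theorem tabS_spec {β : Type} (n : ℕ) : ∀ (i K : ℕ) (t : List (ℕ × List ℕ)) (k : List (ℕ × List ℕ) → β), InvT i t → t.length = K + 1 →
    ∃ t', tabS n t k = k t' ∧ InvT (i + n) t' ∧ t'.length = K + 1 := by
  induction n with
  | zero => intro i K t k h hl; exact ⟨t, rfl, h, hl⟩
  | succ n ih =>
    intro i K t k h hl
    cases t with
    | nil => simp at hl
    | cons a r =>
      obtain ⟨c, m⟩ := a
      obtain ⟨t1, e1, h1, l1⟩ := stepS_spec i r c m (fun t' => tabS n t' k) h.1 h.2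
      obtain ⟨t2, e2, h2, l2⟩ := ih (i + 1) K t1 k h1 (by rw [l1]; simpa using hl)
      refine ⟨t2, ?_, by rw [show i + (n + 1) = i + 1 + n by ring]; exact h2, l2⟩
      rw [← e2, ← e1]; rfl

theorem inv0 (K : ℕ) : InvT 0 (List.replicate K (1, [])) := by
  induction K with
  | zero => trivial
  | succ K ih =>
    rw [List.replicate_succ]
    refine ⟨⟨rfl, by simp, rfl, ?_⟩, ih⟩
    intro b hb _
    rw [List.length_eq_zero_iff.1 hb]
    exact ⟨by simp [rk], rfl⟩

theorem famS_spec {β : Type} (n K : ℕ) (f : ℕ → List ℕ → β) (d : β) : ∃ c ms, famS n K f d = f c ms ∧ OK n K c ms := by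
  obtain ⟨t, e, h, hl⟩ := tabS_spec n 0 K (List.replicate (K + 1) (1, []))
    (fun t => List.casesOn (motive := fun _ => β) t d fun a _ => Prod.casesOn (motive := fun _ => β) a f) (inv0 _) (by simp)
  cases t with
  | nil => simp at hl
  | cons a r =>
    refine ⟨a.1, a.2, ?_, ?_⟩
    · unfold famS; rw [e]
    · have := h.1
      rw [zero_add] at this
      have h2 : r.length = K := by simpa using hl
      rwa [h2] at this

/-! slices -/
inductive B5 | mk (a b c d e : ℕ)
def mkB : List ℕ → List B5
  | a :: b :: c :: d :: e :: l => .mk a b c d e :: mkB l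
  | _ => []
def bx (m : ℕ) (b : Bool) (r : ℕ) : ℕ := Bool.casesOn b r (Nat.xor m r)
def blk (B : B5) (b1 b2 b3 b4 b5 : Bool) : ℕ :=
  B5.casesOn B fun m1 m2 m3 m4 m5 => bx m1 b1 (bx m2 b2 (bx m3 b3 (bx m4 b4 (bx m5 b5 0))))
def unc (v : List Bool) (f : Bool → List Bool → ℕ) : ℕ := List.casesOn v 0 f
def sl : List B5 → List Bool → ℕ
  | [], _ => 0
  | B :: Bs, v => unc v fun b1 v => unc v fun b2 v => unc v fun b3 v => unc v fun b4 v => unc v fun b5 v => Nat.xor (blk B b1 b2 b3 b4 b5) (sl Bs v)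
def forceL {β α : Type} : List α → (List α → β) → β
  | [], k => k []
  | x :: l, k => forceL l fun l' => k (x :: l')
def slicesS {β : Type} (ms : List B5) : ℕ → List Bool → (List ℕ → β) → β
  | 0, _, k => k []
  | n+1, s, k => List.casesOn s (k []) fun _ t => slicesS ms n t fun l => k (sl ms s :: l)

theorem forceL_eq {β α : Type} (l : List α) : ∀ k : List α → β, forceL l k = k l := by
  induction l with
  | nil => intro k; rfl
  | cons a l ih => intro k; exact ih _

def dotB : List Bool → List Bool → Bool
  | a :: x, b :: v => (a && b) ^^ dotB x v
  | _, _ => false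

theorem bx_tb (m : ℕ) (b : Bool) (r l : ℕ) : (bx m b r).testBit l = ((m.testBit l && b) ^^ r.testBit l) := by
  cases b
  · simp [bx]
  · simp only [bx, tbx, Bool.and_true]

theorem sl_spec (l q : ℕ) : ∀ (m : List ℕ) (v : List Bool), m.length = 5 * q → m.length ≤ v.length →
    (sl (mkB m) v).testBit l = dotB (m.map fun x => x.testBit l) v := by
  induction q with
  | zero =>
    intro m v h _
    obtain rfl := List.length_eq_zero_iff.1 (by simpa using h : m.length = 0)
    simp [mkB, sl, dotB]
  | succ q ih =>
    intro m v h hv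
    match m, h, hv with
    | a :: b :: c :: d :: e :: m, h, hv =>
      match v, hv with
      | b1 :: b2 :: b3 :: b4 :: b5 :: v, hv =>
        have h1 := ih m v (by simp at h; omega) (by simp at hv; omega)
        have h2 : sl (mkB (a :: b :: c :: d :: e :: m)) (b1 :: b2 :: b3 :: b4 :: b5 :: v) =
          Nat.xor (bx a b1 (bx b b2 (bx c b3 (bx d b4 (bx e b5 0))))) (sl (mkB m) v) := rfl
        rw [h2, tbx, h1]
        simp only [bx_tb, List.map_cons, dotB, Nat.zero_testBit, Bool.xor_assoc, Bool.xor_false]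
      | [], hv => simp only [List.length_cons, List.length_nil] at hv; omega
      | [_], hv => simp only [List.length_cons, List.length_nil] at hv; omega
      | [_, _], hv => simp only [List.length_cons, List.length_nil] at hv; omega
      | [_, _, _], hv => simp only [List.length_cons, List.length_nil] at hv; omega
      | [_, _, _, _], hv => simp only [List.length_cons, List.length_nil] at hv; omega
    | [], h, hv => simp only [List.length_cons, List.length_nil] at h; omega
    | [_], h, hv => simp only [List.length_cons, List.length_nil] at h; omega
    | [_, _], h, hv => simp only [List.length_cons, List.length_nil] at h; omega
    | [_, _, _], h, hv => simp only [List.length_cons, List.length_nil] at h; omega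
    | [_, _, _, _], h, hv => simp only [List.length_cons, List.length_nil] at h; omega

theorem slices_spec {β : Type} (m : List ℕ) (q : ℕ) (hm : m.length = 5 * q) (n : ℕ) : ∀ (s : List Bool) (k : List ℕ → β), n + m.length ≤ s.length →
    ∃ o, slicesS (mkB m) n s k = k o ∧ ∀ l, cnt o l = ∑ j ∈ range n, (dotB (m.map fun x => x.testBit l) (s.drop j)).toNat := by
  induction n with
  | zero => intro s k _; exact ⟨[], rfl, fun l => by simp [cnt]⟩
  | succ n ih =>
    intro s k hs
    cases s with
    | nil => simp at hs
    | cons b t =>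
      obtain ⟨o, e, h⟩ := ih t (fun l => k (sl (mkB m) (b :: t) :: l)) (by simp at hs; omega)
      refine ⟨_, e, fun l => ?_⟩
      rw [Finset.sum_range_succ', cnt_cons, h, add_comm, tb, sl_spec l q m (b :: t) hm (by omega)]
      simp

/-! bit counting -/
def levS {β : Type} : List ℕ → ℕ → List ℕ → (ℕ → List ℕ → β) → β
  | [], a, c, k => k a c
  | [x], a, c, k => k (Nat.xor a x) (Nat.land a x::c)
  | x :: y :: r, a, c, k => (fun ax => levS r (Nat.xor ax y) (Nat.xor a (Nat.land ax (Nat.xor a y))::c) k) (Nat.xor a x)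

theorem levS_spec {β : Type} (x : List ℕ) (a : ℕ) (c : List ℕ) (k : ℕ → List ℕ → β) :
    ∃ a' c', levS x a c k = k a' c' ∧ ∀ l, cnt x l + tb a l + 2 * cnt c l = tb a' l + 2 * cnt c' l := by
  match x with
  | [] => exact ⟨a, c, rfl, fun l => by simp [cnt]⟩
  | [x] =>
    refine ⟨_, _, rfl, fun l => ?_⟩
    simp only [cnt_cons, cnt_nil, tb, tbx, tba]
    cases a.testBit l <;> cases x.testBit l <;> simp <;> omega
  | x :: y :: r =>
    obtain ⟨a', c', e, h⟩ := levS_spec r (Nat.xor (Nat.xor a x) y) (Nat.xor a (Nat.land (Nat.xor a x) (Nat.xor a y))::c) k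
    refine ⟨a', c', e, fun l => ?_⟩
    rw [← h l]
    simp only [cnt_cons, tb, tbx, tba]
    cases a.testBit l <;> cases x.testBit l <;> cases y.testBit l <;> simp <;> omega
  termination_by x.length

def apS : List ℕ → List ℕ → List ℕ
  | [], y => y
  | a :: x, y => a :: apS x y

theorem apS_eq (x y : List ℕ) : apS x y = x ++ y := by
  induction x with
  | nil => rfl
  | cons a x ih => simp [apS, ih]

def pcnW {β : Type} : List (List ℕ) → List ℕ → (List ℕ → β) → β
  | [], _, k => k []
  | x :: xs, c, k => levS (apS x c) 0 [] fun a c' => force a fun a => pcnW xs c' fun r => k (a :: r)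

def vals : List (List ℕ) → ℕ → ℕ
  | [], _ => 0
  | x :: xs, l => cnt x l + 2 * vals xs l

theorem pcnW_spec {β : Type} (xs : List (List ℕ)) : ∀ (c : List ℕ) (k : List ℕ → β),
    ∃ r, pcnW xs c k = k r ∧ r.length = xs.length ∧ ∀ l, ∃ e, vals xs l + cnt c l = val r l + 2 ^ xs.length * e := by
  induction xs with
  | nil => intro c k; exact ⟨[], rfl, rfl, fun l => ⟨cnt c l, by simp [vals, val]⟩⟩
  | cons x xs ih =>
    intro c k
    obtain ⟨a, c', e1, h1⟩ := levS_spec (apS x c) 0 [] (fun a c' => force a fun a => pcnW xs c' fun r => k (a :: r))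
    obtain ⟨r, e2, hl, h2⟩ := ih c' (fun r => k (a :: r))
    refine ⟨a :: r, ?_, by simp [hl], fun l => ?_⟩
    · unfold pcnW; rw [e1, force_eq, e2]
    · obtain ⟨e, he⟩ := h2 l
      refine ⟨e, ?_⟩
      have := h1 l
      rw [apS_eq, cnt_append] at this
      simp only [tb, Nat.zero_testBit, cnt_nil, Bool.toNat_false] at this
      simp only [vals, val, List.length_cons, pow_succ, tb]
      have h3 : 2 ^ xs.length * 2 * e = 2 * (2 ^ xs.length * e) := by ring
      rw [h3]
      omega

/-! digits of a number as booleans, most significant first -/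
def bitsS {β : Type} : ℕ → ℕ → List Bool → (List Bool → β) → β
  | 0, _, acc, k => k acc
  | n+1, s, acc, k => force (Nat.div s 4096) fun s' => Bool.casesOn (Nat.beq (Nat.mod s 4096) 1) (bitsS n s' (false :: acc) k) (bitsS n s' (true :: acc) k)

theorem bitsS_eq {β : Type} (n : ℕ) : ∀ (s : ℕ) (acc : List Bool) (k : List Bool → β),
    bitsS n s acc k = k (((List.range n).map fun i => decide (s / 4096 ^ i % 4096 = 1)).reverse ++ acc) := by
  induction n with
  | zero => intro s acc k; rfl
  | succ n ih =>
    intro s acc k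
    have h1 : bitsS (n + 1) s acc k = bitsS n (s / 4096) (decide (s % 4096 = 1) :: acc) k := by
      unfold bitsS
      rw [force_eq]
      have h2 : Nat.beq (Nat.mod s 4096) 1 = decide (s % 4096 = 1) := by
        show Nat.beq (s % 4096) 1 = _
        rw [Bool.eq_iff_iff, Nat.beq_eq, decide_eq_true_iff]
      rw [h2]
      cases n <;> cases decide (s % 4096 = 1) <;> rfl
    rw [h1, ih, List.range_succ_eq_map]
    congr 1
    simp only [List.map_cons, List.map_map, List.reverse_cons, List.append_assoc, List.singleton_append, pow_zero, Nat.div_one]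
    congr 3
    funext i
    simp [Function.comp, pow_succ', Nat.div_div_eq_div_mul]

end BD

set_option linter.all false
namespace BD
open Finset

def un {β : Type} (d : β) (x : List ℕ) (f : ℕ → List ℕ → β) : β := List.casesOn x d f

def mids (ones K0 K1 K2 W0 W1 W2 W3 W4 W5 : ℕ) (k : ℕ → Bool) : Bool :=
  pcnW [[W0, K0], [W1, K1, K0], [W2, K2], [W3], [W4], [W5]] [] fun Z =>
  un false Z fun Z0 Z => un false Z fun Z1 Z => un false Z fun Z2 Z => un false Z fun Z3 Z => un false Z fun Z4 Z => un false Z fun Z5 _ =>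
  pcnW [[Nat.xor ones W0, K0, ones], [Nat.xor ones W1, K1, ones], [Nat.xor ones W2, K2, ones], [Nat.xor ones W3, ones], [Nat.xor ones W4, ones], [Nat.xor ones W5], []] [] fun C =>
  un false C fun _ C => un false C fun _ C => un false C fun _ C => un false C fun _ C => un false C fun _ C => un false C fun _ C => un false C fun C6 _ =>
  cond (Nat.beq (Nat.lor Z4 Z5) ones) (cond (Nat.beq C6 ones)
    (force (Nat.xor K0 (Nat.land K0 (Nat.lor Z0 (Nat.lor Z1 (Nat.lor Z2 (Nat.lor Z3 Z5)))))) k) false) false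

def mid (ones K0 K1 K2 : ℕ) (bs : List B5) (N : ℕ) (k : ℕ → Bool) : Bool :=
  bitsS 90 (Nat.mul N (Nat.add 1 (Nat.pow 4096 45))) [] fun b => slicesS bs 45 b fun x => pcnW [[], [], [], [], [], []] x fun W =>
  un false W fun W0 W => un false W fun W1 W => un false W fun W2 W => un false W fun W3 W => un false W fun W4 W => un false W fun W5 _ =>
  mids ones K0 K1 K2 W0 W1 W2 W3 W4 W5 k


theorem un_true {x : List ℕ} {f : ℕ → List ℕ → Bool} (h : un false x f = true) : ∃ a r, x = a :: r ∧ f a r = true := by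
  cases x with
  | nil => exact absurd h (by simp [un])
  | cons a r => exact ⟨a, r, rfl, h⟩

theorem un_cons {a : ℕ} {r : List ℕ} {f : ℕ → List ℕ → Bool} : un false (a :: r) f = f a r := rfl

theorem cond_true' {b c : Bool} (h : cond b c false = true) : b = true ∧ c = true := by
  cases b
  · exact absurd h (by simp)
  · exact ⟨rfl, h⟩

theorem tb_one {v l : ℕ} : v.testBit l = true ↔ tb v l = 1 := by
  unfold tb; cases v.testBit l <;> simp

theorem tb_xor_one {ones v l : ℕ} (h : ones.testBit l = true) : tb (Nat.xor ones v) l = 1 - tb v l := by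
  unfold tb; rw [tbx, h]; cases v.testBit l <;> simp

theorem mids_spec {ones K0 K1 K2 W0 W1 W2 W3 W4 W5 : ℕ} {k : ℕ → Bool} (h : mids ones K0 K1 K2 W0 W1 W2 W3 W4 W5 k = true) :
    ∃ F, k F = true ∧ ∀ l kk w, ones.testBit l = true → tb K0 l + 2 * tb K1 l + 4 * tb K2 l = kk →
      val [W0, W1, W2, W3, W4, W5] l = w → w ≤ 45 →
      16 ≤ w + kk + 2 * (kk % 2) ∧ w ≤ 30 + kk ∧ (F.testBit l = true ↔ kk % 2 = 1 ∧ w + kk = 14) := by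
  unfold mids at h
  obtain ⟨Z, eZ, lZ, hZ⟩ := pcnW_spec [[W0, K0], [W1, K1, K0], [W2, K2], [W3], [W4], [W5]] []
    (fun Z => un false Z fun Z0 Z => un false Z fun Z1 Z => un false Z fun Z2 Z => un false Z fun Z3 Z => un false Z fun Z4 Z => un false Z fun Z5 _ =>
  pcnW [[Nat.xor ones W0, K0, ones], [Nat.xor ones W1, K1, ones], [Nat.xor ones W2, K2, ones], [Nat.xor ones W3, ones], [Nat.xor ones W4, ones], [Nat.xor ones W5], []] [] fun C =>
  un false C fun _ C => un false C fun _ C => un false C fun _ C => un false C fun _ C => un false C fun _ C => un false C fun _ C => un false C fun C6 _ =>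
  cond (Nat.beq (Nat.lor Z4 Z5) ones) (cond (Nat.beq C6 ones)
    (force (Nat.xor K0 (Nat.land K0 (Nat.lor Z0 (Nat.lor Z1 (Nat.lor Z2 (Nat.lor Z3 Z5)))))) k) false) false)
  rw [eZ] at h
  obtain ⟨Z0, YZ0, qZ0, gZ0⟩ := un_true h
  obtain ⟨Z1, YZ1, qZ1, gZ1⟩ := un_true gZ0
  obtain ⟨Z2, YZ2, qZ2, gZ2⟩ := un_true gZ1
  obtain ⟨Z3, YZ3, qZ3, gZ3⟩ := un_true gZ2
  obtain ⟨Z4, YZ4, qZ4, gZ4⟩ := un_true gZ3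
  obtain ⟨Z5, YZ5, qZ5, gZ5⟩ := un_true gZ4
  subst qZ5 qZ4 qZ3 qZ2 qZ1 qZ0
  obtain rfl : YZ5 = [] := by
    rw [← List.length_eq_zero_iff]
    simp only [List.length_cons, List.length_nil] at lZ; omega
  obtain ⟨C, eC, lC, hC⟩ := pcnW_spec [[Nat.xor ones W0, K0, ones], [Nat.xor ones W1, K1, ones], [Nat.xor ones W2, K2, ones], [Nat.xor ones W3, ones], [Nat.xor ones W4, ones], [Nat.xor ones W5], []] []
    (fun C => un false C fun _ C => un false C fun _ C => un false C fun _ C => un false C fun _ C => un false C fun _ C => un false C fun _ C => un false C fun C6 _ =>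
  cond (Nat.beq (Nat.lor Z4 Z5) ones) (cond (Nat.beq C6 ones)
    (force (Nat.xor K0 (Nat.land K0 (Nat.lor Z0 (Nat.lor Z1 (Nat.lor Z2 (Nat.lor Z3 Z5)))))) k) false) false)
  rw [eC] at gZ5
  obtain ⟨C0, YC0, qC0, gC0⟩ := un_true gZ5
  obtain ⟨C1, YC1, qC1, gC1⟩ := un_true gC0
  obtain ⟨C2, YC2, qC2, gC2⟩ := un_true gC1
  obtain ⟨C3, YC3, qC3, gC3⟩ := un_true gC2
  obtain ⟨C4, YC4, qC4, gC4⟩ := un_true gC3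
  obtain ⟨C5, YC5, qC5, gC5⟩ := un_true gC4
  obtain ⟨C6, YC6, qC6, gC6⟩ := un_true gC5
  subst qC6 qC5 qC4 qC3 qC2 qC1 qC0
  obtain rfl : YC6 = [] := by
    rw [← List.length_eq_zero_iff]
    simp only [List.length_cons, List.length_nil] at lC; omega
  obtain ⟨h1, h3⟩ := cond_true' gC6
  obtain ⟨h2, h''⟩ := cond_true' h3
  rw [force_eq] at h''
  refine ⟨_, h'', ?_⟩
  intro l kk w ho hk hw h45
  have e1 := Nat.eq_of_beq_eq_true h1
  have e2 := Nat.eq_of_beq_eq_true h2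
  have f1 : Z4.testBit l = true ∨ Z5.testBit l = true := by
    have := congrArg (fun v => v.testBit l) e1
    simp only [tbo, ho] at this
    simpa using this
  have f2 : tb C6 l = 1 := by rw [e2, ← tb_one]; exact ho
  rw [tb_one, tb_one] at f1
  obtain ⟨e, he⟩ := hZ l
  obtain ⟨e', he'⟩ := hC l
  have ho' := tb_one.1 ho
  simp only [vals, val, cnt_cons, cnt_nil, List.length_cons, List.length_nil, tb_xor_one ho] at he he' hw
  norm_num at he he'
  have f3 : (Nat.xor K0 (Nat.land K0 (Nat.lor Z0 (Nat.lor Z1 (Nat.lor Z2 (Nat.lor Z3 Z5)))))).testBit l = true ↔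
      tb K0 l = 1 ∧ tb Z0 l = 0 ∧ tb Z1 l = 0 ∧ tb Z2 l = 0 ∧ tb Z3 l = 0 ∧ tb Z5 l = 0 := by
    simp only [tb, tbx, tba, tbo]
    cases K0.testBit l <;> cases Z0.testBit l <;> cases Z1.testBit l <;> cases Z2.testBit l <;> cases Z3.testBit l <;> cases Z5.testBit l <;> simp
  rw [f3]
  have := tb_le K0 l; have := tb_le K1 l; have := tb_le K2 l
  have := tb_le W0 l; have := tb_le W1 l; have := tb_le W2 l; have := tb_le W3 l; have := tb_le W4 l; have := tb_le W5 l
  have := tb_le Z0 l; have := tb_le Z1 l; have := tb_le Z2 l; have := tb_le Z3 l; have := tb_le Z4 l; have := tb_le Z5 l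
  have := tb_le C0 l; have := tb_le C1 l; have := tb_le C2 l; have := tb_le C3 l; have := tb_le C4 l; have := tb_le C5 l
  clear f3 hZ hC
  generalize tb K0 l = k0 at *
  generalize tb K1 l = k1 at *
  generalize tb K2 l = k2 at *
  generalize tb W0 l = w0 at *
  generalize tb W1 l = w1 at *
  generalize tb W2 l = w2 at *
  generalize tb W3 l = w3 at *
  generalize tb W4 l = w4 at *
  generalize tb W5 l = w5 at *
  generalize tb Z0 l = z0 at *
  generalize tb Z1 l = z1 at *
  generalize tb Z2 l = z2 at *
  generalize tb Z3 l = z3 at *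
  generalize tb Z4 l = z4 at *
  generalize tb Z5 l = z5 at *
  generalize tb C0 l = c0 at *
  generalize tb C1 l = c1 at *
  generalize tb C2 l = c2 at *
  generalize tb C3 l = c3 at *
  generalize tb C4 l = c4 at *
  generalize tb C5 l = c5 at *
  have hkk : kk % 2 = k0 := by omega
  have hZs : w + kk + 2 * k0 = z0 + 2 * z1 + 4 * z2 + 8 * z3 + 16 * z4 + 32 * z5 + 64 * e := by omega
  have he0 : e = 0 := by omega
  have hCs : 94 + kk = w + (c0 + 2 * c1 + 4 * c2 + 8 * c3 + 16 * c4 + 32 * c5 + 64 * tb C6 l) + 128 * e' := by omega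
  rw [f2] at hCs
  clear he he' hk hw
  subst he0
  refine ⟨by omega, by omega, ?_⟩
  rw [hkk]
  constructor
  · rintro ⟨a0, a1, a2, a3, a4, a5⟩; exact ⟨a0, by omega⟩
  · rintro ⟨a0, a1⟩; exact ⟨a0, by omega, by omega, by omega, by omega, by omega⟩

end BD

set_option linter.all false
namespace BD
open Finset

theorem sumR {M : Type*} [AddCommMonoid M] (f : ZMod 45 → M) : ∑ k, f k = ∑ i ∈ range 45, f (i : ZMod 45) := by
  rw [Finset.sum_range]
  refine Fintype.sum_equiv (Equiv.refl (Fin 45)) _ _ fun i => ?_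
  have : ((i.val : ℕ) : ZMod 45) = i := ZMod.natCast_zmod_val (n := 45) i
  simp only [Equiv.refl_apply]
  rw [this]

def Win (T : A) : Prop := T.coeff 0 = 1 ∧ ∀ i : ℕ, 39 ≤ i → i < 45 → T.coeff (i : ZMod 45) = 0

def tB (T : A) (i : ℕ) : Bool := decide (bit T (i : ZMod 45) = 1)

def pT (T : A) : List Bool := (List.range 38).map fun i => tB T (i + 1)

def L (T : A) : ℕ := rk 6 (pT T)

theorem tB_toNat (T : A) (i : ℕ) : (tB T i).toNat = bit T (i : ZMod 45) := by
  have := bit_le T (i : ZMod 45)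
  unfold tB
  by_cases h : bit T (i : ZMod 45) = 1
  · rw [h]; simp
  · have h0 : bit T (i : ZMod 45) = 0 := by omega
    rw [h0]; simp

theorem count_sum (b : List Bool) : b.count true = (b.map Bool.toNat).sum := by
  induction b with
  | nil => rfl
  | cons a b ih => cases a <;> simp [ih, List.count_cons, Nat.add_comm]

theorem cnt_count (m : List ℕ) (l : ℕ) : cnt m l = (m.map fun v => v.testBit l).count true := by
  rw [count_sum, List.map_map]; rfl

theorem sum_mapR (f : ℕ → ℕ) (n : ℕ) : ((List.range n).map f).sum = ∑ i ∈ range n, f i := rfl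

theorem bit_coeff0 {T : A} {i : ZMod 45} (h : T.coeff i = 0) : bit T i = 0 := by unfold bit; rw [h]; rfl
theorem bit_coeff1 {T : A} {i : ZMod 45} (h : T.coeff i = 1) : bit T i = 1 := by unfold bit; rw [h]; rfl

theorem wt_win {T : A} (h : Win T) : wt T = 1 + (pT T).count true := by
  have e : (pT T).count true = ∑ i ∈ range 38, bit T ((i + 1 : ℕ) : ZMod 45) := by
    rw [count_sum, pT, List.map_map, ← sum_mapR]
    congr 1
    apply List.map_congr_left
    intro i _
    exact tB_toNat T (i + 1)
  have hz : ∑ i ∈ range 6, bit T ((39 + i : ℕ) : ZMod 45) = 0 := by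
    apply Finset.sum_eq_zero
    intro i hi
    have := Finset.mem_range.1 hi
    exact bit_coeff0 (h.2 _ (by omega) (by omega))
  have h1 : bit T ((0 : ℕ) : ZMod 45) = 1 := by
    rw [Nat.cast_zero]; exact bit_coeff1 h.1
  have e1 : wt T = ∑ i ∈ range 39, bit T (i : ZMod 45) + ∑ i ∈ range 6, bit T ((39 + i : ℕ) : ZMod 45) :=
    (sumR (bit T)).trans (Finset.sum_range_add (fun i : ℕ => bit T (i : ZMod 45)) 39 6)
  have e2 : ∑ i ∈ range 39, bit T (i : ZMod 45) = ∑ i ∈ range 38, bit T ((i + 1 : ℕ) : ZMod 45) + bit T ((0 : ℕ) : ZMod 45) :=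
    Finset.sum_range_succ' (fun i : ℕ => bit T (i : ZMod 45)) 38
  omega

theorem pw_eq {T : A} (h : Win T) : (true :: pT T) ++ [false] = (List.range 40).map (tB T) := by
  have h1 : tB T 0 = true := by
    unfold tB; rw [Nat.cast_zero, bit_coeff1 h.1]; rfl
  have h2 : tB T 39 = false := by
    unfold tB; rw [bit_coeff0 (h.2 39 (by omega) (by omega))]; rfl
  rw [show (40 : ℕ) = 39 + 1 from rfl, List.range_succ, List.map_append, show (39 : ℕ) = 38 + 1 from rfl, List.range_succ_eq_map, List.map_cons, h1, List.map_map,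
    List.map_cons, List.map_nil, h2]
  rfl

theorem L_inj {c : ℕ} {ms : List ℕ} (hO : OK 38 6 c ms) {T T' : A} (h : Win T) (h7 : wt T ≤ 7) (h' : Win T') (h7' : wt T' ≤ 7) (e : L T = L T') : T = T' := by
  have l1 : (pT T).length = 38 := by simp [pT]
  have l2 : (pT T').length = 38 := by simp [pT]
  have q1 := (hO.2.2.2 (pT T) l1 (by have := wt_win h; omega)).2
  have q2 := (hO.2.2.2 (pT T') l2 (by have := wt_win h'; omega)).2
  have ee : pT T = pT T' := by
    unfold L at e
    rw [← q1, ← q2, e]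
  have pe : (List.range 40).map (tB T) = (List.range 40).map (tB T') := by rw [← pw_eq h, ← pw_eq h', ee]
  apply A_ext
  intro i
  obtain ⟨n, hn, rfl⟩ : ∃ n : ℕ, n < 45 ∧ (n : ZMod 45) = i := ⟨i.val, ZMod.val_lt i, ZMod.natCast_zmod_val i⟩
  by_cases h40 : n < 40
  · have := List.map_inj_left.1 pe n (List.mem_range.2 h40)
    have := congrArg Bool.toNat this
    rw [tB_toNat, tB_toNat] at this
    exact bit_eq_iff.2 this
  · rw [h.2 n (by omega) hn, h'.2 n (by omega) hn]

theorem dotB_range (n : ℕ) : ∀ (a : ℕ → Bool) (v : List Bool), n ≤ v.length →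
    ((dotB ((List.range n).map a) v).toNat : ZMod 2) = ∑ q ∈ range n, ((a q).toNat : ZMod 2) * ((v.getD q false).toNat : ZMod 2) := by
  induction n with
  | zero => intro a v _; simp [dotB]
  | succ n ih =>
    intro a v hv
    cases v with
    | nil => simp at hv
    | cons b v =>
      have := ih (fun i => a (i + 1)) v (by simpa using hv)
      rw [List.range_succ_eq_map, List.map_cons, List.map_map, dotB, Finset.sum_range_succ']
      have e2 : (List.map (a ∘ Nat.succ) (List.range n)) = (List.range n).map fun i => a (i + 1) := rfl
      rw [e2]
      simp only [List.getD_cons_succ, List.getD_cons_zero]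
      rw [← this]
      cases a 0 <;> cases b <;> cases dotB ((List.range n).map fun i => a (i + 1)) v <;> decide

theorem mul_h (a b c : ℕ) : Nat.mul a (Nat.add 1 (Nat.pow b c)) = a * (1 + b ^ c) := rfl

theorem dig_dbl (f : ℕ → ℕ) (n : ℕ) (hf : ∀ i, f (n + i) = f i) : dig f n * (1 + 4096 ^ n) = dig f (n + n) := by
  unfold dig
  rw [Finset.sum_range_add, Nat.mul_add, Nat.mul_one, Finset.sum_mul]
  refine congrArg (_ + ·) (Finset.sum_congr rfl fun i _ => ?_)
  rw [hf, Nat.pow_add]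
  ac_rfl

theorem digits90 (σ : A) (i : ℕ) (hi : i < 90) :
    Nat.mul (enc σ) (Nat.add 1 (Nat.pow 4096 45)) / 4096 ^ i % 4096 = bit σ (i : ZMod 45) := by
  have e : Nat.mul (enc σ) (Nat.add 1 (Nat.pow 4096 45)) = dig (fun i => bit σ (i : ZMod 45)) 90 := by
    have e0 : enc σ = dig (fun i => bit σ (i : ZMod 45)) 45 := encF_dig _
    have e1 := dig_dbl (fun i => bit σ (i : ZMod 45)) 45 (fun i => by rw [Nat.cast_add, show ((45 : ℕ) : ZMod 45) = 0 from rfl, zero_add])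
    rw [mul_h, e0]
    exact e1
  rw [e, dig_digit _ _ (fun i => by have := bit_le σ (i : ZMod 45); omega) _ hi]

theorem slice_bit {σ T : A} (h : Win T) (j : ℕ) (hj : j < 45) :
    (dotB ((List.range 40).map (tB T)) ((((List.range 90).map (tB σ)).reverse).drop j)).toNat = bit (T * σ) (44 - (j : ZMod 45)) := by
  have hle : (dotB ((List.range 40).map (tB T)) ((((List.range 90).map (tB σ)).reverse).drop j)).toNat ≤ 1 := Bool.toNat_le _
  have hc := dotB_range 40 (tB T) ((((List.range 90).map (tB σ)).reverse).drop j) (by simp; omega)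
  have hv : ∀ q ∈ range 40, ((tB T q).toNat : ZMod 2) * ((((((List.range 90).map (tB σ)).reverse).drop j).getD q false).toNat : ZMod 2)
      = T.coeff (q : ZMod 45) * σ.coeff (44 - (j : ZMod 45) - (q : ZMod 45)) := by
    intro q hq
    have hq := Finset.mem_range.1 hq
    have e1 : ((((List.range 90).map (tB σ)).reverse).drop j).getD q false = tB σ (89 - (j + q)) := by
      rw [List.getD_eq_getElem?_getD, List.getElem?_drop, List.getElem?_reverse (by simp; omega), List.getElem?_map, List.getElem?_range (by simp; omega)]
      simp
    have e2 : ((89 - (j + q) : ℕ) : ZMod 45) = 44 - (j : ZMod 45) - (q : ZMod 45) := by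
      rw [Nat.cast_sub (by omega), Nat.cast_add, show ((89 : ℕ) : ZMod 45) = 44 from rfl]; ring
    rw [e1, tB_toNat, tB_toNat, e2]
    unfold bit
    rw [ZMod.natCast_zmod_val, ZMod.natCast_zmod_val]
  rw [Finset.sum_congr rfl hv] at hc
  have hm : (T * σ).coeff (44 - (j : ZMod 45)) = ∑ q ∈ range 40, T.coeff (q : ZMod 45) * σ.coeff (44 - (j : ZMod 45) - (q : ZMod 45)) := by
    rw [coeff_mul', sumR]
    refine (Finset.sum_range_add (fun q : ℕ => T.coeff (q : ZMod 45) * σ.coeff (44 - (j : ZMod 45) - (q : ZMod 45))) 40 5).trans ?_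
    rw [add_eq_left]
    apply Finset.sum_eq_zero
    intro i hi
    have := Finset.mem_range.1 hi
    rw [h.2 _ (by omega) (by omega), zero_mul]
  rw [← hm] at hc
  unfold bit
  rw [← hc, ZMod.val_natCast, Nat.mod_eq_of_lt (by omega)]

theorem mid_spec {c K0 K1 K2 : ℕ} {ms : List ℕ} {σ : A} {k : ℕ → Bool} (hO : OK 38 6 c ms)
    (hK : ∀ l, ∃ e, cnt ((2 ^ c - 1) :: ms) l = val [K0, K1, K2] l + 8 * e)
    (h : mid (2 ^ c - 1) K0 K1 K2 (mkB ((2 ^ c - 1) :: (ms ++ [0]))) (enc σ) k = true) :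
    ∃ F, k F = true ∧ ∀ T, Win T → wt T ≤ 7 → 16 ≤ wt (T * σ) + wt T + 2 * (wt T % 2) ∧ wt (T * σ) ≤ 30 + wt T ∧
      (F.testBit (L T) = true ↔ wt T % 2 = 1 ∧ wt (T * σ) + wt T = 14) := by
  unfold mid at h
  rw [bitsS_eq] at h
  have hD : (((List.range 90).map fun i => decide (Nat.mul (enc σ) (Nat.add 1 (Nat.pow 4096 45)) / 4096 ^ i % 4096 = 1)).reverse ++ [])
      = ((List.range 90).map (tB σ)).reverse := by
    rw [List.append_nil]
    refine congrArg _ (List.map_congr_left fun i hi => ?_)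
    rw [digits90 σ i (List.mem_range.1 hi)]; rfl
  rw [hD] at h
  have hl : ((2 ^ c - 1) :: (ms ++ [0])).length = 5 * 8 := by simp [hO.1]
  obtain ⟨o, eo, ho⟩ := slices_spec ((2 ^ c - 1) :: (ms ++ [0])) 8 hl 45 ((List.range 90).map (tB σ)).reverse
    (fun x => pcnW [[], [], [], [], [], []] x fun W =>
  un false W fun W0 W => un false W fun W1 W => un false W fun W2 W => un false W fun W3 W => un false W fun W4 W => un false W fun W5 _ =>
  mids (2 ^ c - 1) K0 K1 K2 W0 W1 W2 W3 W4 W5 k) (by rw [hl]; simp)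
  rw [eo] at h
  obtain ⟨W, eW, lW, hW⟩ := pcnW_spec [[], [], [], [], [], []] o (fun W =>
  un false W fun W0 W => un false W fun W1 W => un false W fun W2 W => un false W fun W3 W => un false W fun W4 W => un false W fun W5 _ =>
  mids (2 ^ c - 1) K0 K1 K2 W0 W1 W2 W3 W4 W5 k)
  rw [eW] at h
  obtain ⟨W0, Y0, q0, g0⟩ := un_true h
  obtain ⟨W1, Y1, q1, g1⟩ := un_true g0
  obtain ⟨W2, Y2, q2, g2⟩ := un_true g1
  obtain ⟨W3, Y3, q3, g3⟩ := un_true g2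
  obtain ⟨W4, Y4, q4, g4⟩ := un_true g3
  obtain ⟨W5, Y5, q5, g5⟩ := un_true g4
  subst q5 q4 q3 q2 q1 q0
  obtain rfl : Y5 = [] := by
    rw [← List.length_eq_zero_iff]
    simp only [List.length_cons, List.length_nil] at lW; omega
  obtain ⟨F, hF, hs⟩ := mids_spec g5
  refine ⟨F, hF, fun T hT h7 => ?_⟩
  have hcount : (pT T).count true ≤ 6 := by have := wt_win hT; omega
  obtain ⟨hlt, hmap⟩ := hO.2.2.2 (pT T) (by simp [pT]) hcount
  change L T < c at hlt
  change ms.map (fun v => v.testBit (L T)) = pT T at hmap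
  have hones : (2 ^ c - 1).testBit (L T) = true := by rw [Nat.testBit_two_pow_sub_one]; simpa using hlt
  have hkk : tb K0 (L T) + 2 * tb K1 (L T) + 4 * tb K2 (L T) = wt T := by
    obtain ⟨e, he⟩ := hK (L T)
    rw [cnt_count, List.map_cons, hmap, hones] at he
    have := wt_win hT
    simp only [List.count_cons_self, val] at he
    have := tb_le K0 (L T); have := tb_le K1 (L T); have := tb_le K2 (L T)
    omega
  have hw : val [W0, W1, W2, W3, W4, W5] (L T) = wt (T * σ) := by
    obtain ⟨e, he⟩ := hW (L T)
    have hm : ((2 ^ c - 1) :: (ms ++ [0])).map (fun x => x.testBit (L T)) = (List.range 40).map (tB T) := by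
      rw [← pw_eq hT, List.map_cons, List.map_append, hmap, hones]; simp
    have ho' := ho (L T)
    rw [hm, Finset.sum_congr rfl fun j hj => slice_bit (σ := σ) hT j (Finset.mem_range.1 hj)] at ho'
    have hwt : ∑ j ∈ range 45, bit (T * σ) (44 - (j : ZMod 45)) = wt (T * σ) := by
      rw [← sumR fun j => bit (T * σ) (44 - j)]
      exact Equiv.sum_comp (Equiv.subLeft (44 : ZMod 45)) (bit (T * σ))
    rw [hwt] at ho'
    simp only [vals, cnt_nil, List.length_cons, List.length_nil, ho'] at he
    have := wt_le (T * σ)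
    omega
  exact hs (L T) (wt T) (wt (T * σ)) hones hkk hw (wt_le _)

/-! window lemma -/
theorem win_of {S : A} (h0 : S ≠ 0) (h7 : wt S ≤ 7) : ∃ c, Win (X c * S) := by
  by_contra hn
  push Not at hn
  -- every point of the support has a predecessor within distance six
  have hp : ∀ i : ZMod 45, S.coeff i = 1 → ∃ d : ℕ, 1 ≤ d ∧ d ≤ 6 ∧ S.coeff (i - d) = 1 := by
    intro i hi
    have := hn (-i)
    unfold Win at this
    simp only [coeff_X_mul] at this
    rw [zero_sub, neg_neg] at this
    by_contra hc
    push Not at hc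
    refine this ⟨hi, fun n hn hn' => ?_⟩
    have := hc (45 - n) (by omega) (by omega)
    rw [Nat.cast_sub (by omega), show ((45 : ℕ) : ZMod 45) = 0 from rfl] at this
    rw [show (n : ZMod 45) - -i = i - (0 - n) by ring]
    rcases zm2 (S.coeff (i - (0 - (n : ZMod 45)))) with h | h
    · exact h
    · exact absurd h this
  obtain ⟨i0, hi0⟩ : ∃ i, S.coeff i = 1 := by
    by_contra hc
    push Not at hc
    refine h0 (A_ext fun i => ?_)
    rcases zm2 (S.coeff i) with h | h
    · exact h
    · exact absurd h (hc i)
  have hall : ∀ n : ℕ, ∃ d : ℕ, d ≤ 5 ∧ S.coeff (i0 - n - d) = 1 := by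
    intro n
    induction n with
    | zero => exact ⟨0, by omega, by simpa using hi0⟩
    | succ n ih =>
      obtain ⟨d, hd, hS⟩ := ih
      cases d with
      | zero =>
        obtain ⟨e, he1, he6, he⟩ := hp _ hS
        refine ⟨e - 1, by omega, ?_⟩
        rw [Nat.cast_sub he1]
        rw [← he]; congr 1; push_cast; ring
      | succ d =>
        refine ⟨d, by omega, ?_⟩
        rw [← hS]; congr 1; push_cast; ring
  have hall' : ∀ j : ZMod 45, ∃ d ∈ range 6, S.coeff (j - (d : ℕ)) = 1 := by
    intro j
    obtain ⟨d, hd, h⟩ := hall (i0 - j).val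
    refine ⟨d, Finset.mem_range.2 (by omega), ?_⟩
    rw [ZMod.natCast_zmod_val] at h
    rw [← h]; congr 1; ring
  have hb : ∀ j : ZMod 45, 1 ≤ ∑ d ∈ range 6, bit S (j - (d : ℕ)) := by
    intro j
    obtain ⟨d, hd, h⟩ := hall' j
    have := Finset.single_le_sum (f := fun d : ℕ => bit S (j - (d : ℕ))) (fun _ _ => Nat.zero_le _) hd
    simp only [bit_coeff1 h] at this
    exact this
  have hs : ∑ j : ZMod 45, ∑ d ∈ range 6, bit S (j - (d : ℕ)) = 6 * wt S := by
    rw [Finset.sum_comm]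
    have : ∀ d ∈ range 6, ∑ j : ZMod 45, bit S (j - (d : ℕ)) = wt S := fun d _ =>
      Equiv.sum_comp (Equiv.subRight ((d : ℕ) : ZMod 45)) (bit S)
    rw [Finset.sum_congr rfl this]; simp
  have h45 : (45 : ℕ) ≤ ∑ j : ZMod 45, ∑ d ∈ range 6, bit S (j - (d : ℕ)) := by
    have := Finset.sum_le_sum (s := (univ : Finset (ZMod 45))) fun j _ => hb j
    simpa [ZMod.card] using this
  omega

theorem wt_J_add (S : A) : wt (J + S) + wt S = 45 := sum_one_add S

theorem wt_par {σ : A} (h : aug σ = 1) (S : A) : wt (S * σ) % 2 = wt S % 2 := by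
  rw [← aug_val, ← aug_val, aug_mul, h, mul_one]

theorem good_of {σ : A} (hu : σ * st σ = 1) (hB : ∀ T, Win T → wt T ≤ 7 → 16 ≤ wt (T * σ) + wt T + 2 * (wt T % 2) ∧ wt (T * σ) ≤ 30 + wt T) :
    Good σ := by
  have ha := aug_unitary hu
  have hB' : ∀ T, T ≠ 0 → wt T ≤ 7 → 16 ≤ wt (T * σ) + wt T + 2 * (wt T % 2) ∧ wt (T * σ) ≤ 30 + wt T := by
    intro T h0 h7
    obtain ⟨c, hc⟩ := win_of h0 h7
    have := hB _ hc (by rw [wt_X_mul]; exact h7)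
    rwa [mul_assoc, wt_X_mul, wt_X_mul] at this
  have hpos : ∀ T : A, T ≠ 0 → 0 < wt T := fun T h => Nat.pos_of_ne_zero fun e => h (wt_eq_zero e)
  intro S hS
  have hpar := wt_par ha S
  have hk := hpos S hS
  have hPne : S * σ ≠ 0 := by
    intro e
    apply hS
    have : S * (σ * st σ) = 0 := by rw [← mul_assoc, e, zero_mul]
    rwa [hu, mul_one] at this
  have hmain : 16 ≤ wt S + wt (S * σ) + 2 * (wt S % 2) := by
    by_cases h7 : wt S ≤ 7
    · have := (hB' S hS h7).1; omega
    · by_cases hw7 : wt (S * σ) ≤ 7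
      · have hne : st (S * σ) ≠ 0 := by
          intro e
          have := hpos _ hPne
          rw [← wt_st, e] at this
          simp [wt, bit] at this
        have := (hB' _ hne (by rw [wt_st]; exact hw7)).1
        rw [iota_mul hu, wt_st, wt_st] at this
        omega
      · omega
  refine ⟨fun h => by omega, fun h => by omega, ?_⟩
  by_cases h7 : wt S ≤ 7
  · exact (hB' S hS h7).2
  · by_contra hc
    have e1 := wt_J_add (S * σ)
    have hT : (st (J + S * σ)) * σ = J + st S := by
      rw [st_add, add_mul, iota_mul hu]
      have : st J = J := rfl
      rw [this, J_mul ha]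
    by_cases hz : st (J + S * σ) = 0
    · rw [hz, zero_mul] at hT
      have e2 := wt_J_add (st S)
      rw [← hT, wt_st] at e2
      have : wt (0 : A) = 0 := by simp [wt, bit]
      rw [this] at e2
      have := wt_le (S * σ)
      omega
    · have := (hB' _ hz (by rw [wt_st]; omega)).2
      have e2 := wt_J_add (st S)
      rw [hT] at this
      rw [wt_st] at this e2
      have := (hB' _ hz (by rw [wt_st]; omega)).1
      rw [hT, wt_st] at this
      omega

end BD

set_option linter.all false
namespace BD
open Finset

def tabC : ℕ := 0xad0c007c9d0048c5c0211a000b000002600000647dc81b14e0104980079fc0029b000094000017a84805dca803a24001c080009dc00024000005993541437300cedc0066d00025400008c0000154f3884567202dd68017820008c800022000005188590ed2240a1e90055c400211000084000013988e4326200239a4013800007c400020000004bb8d40aa59407cbb0046b8001d200007c0000125f0c023ca401b30400ffa0006d00001e00000479dea07791805e5e00398c001970000740000118446818cd00145d800ce80005ec0001c0000044ca38051b88045ee002e200016000006c000010efc0810b3600eeb000a420005180001a0000042e66303627c032970024540012d0000640000108e16c0ae0800aa5c00800000454000180000041ade80229cc02395001c08000fe00005c000010503c006cf80075ec0061a0003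a0000160000040ec2c0153100183400151c000d30000540000102ac5004118004eb0004880002fc00014000004079cc00c52000fd0000f70000ac00004c00001015448024ba003238003420002680001200000403a2d006b94009d5000ae40008900004400001009b7401350001e54002400001e4000100000040194c003644005bf0007580006a00003c000010040000094c0011140017a0001700000e000004009ce0018c80031a0004ac0004f00003400001001738004000008c8000e800010c0000c000004003500009f8001820002c00003800002c000010007480017e000400000820000b80000a000004000f700036c000a300017400025000024000010001fc0007800018c0004000007400008000004000400000fc000390000a80001600001c000010000800002000007c0001a00004000006000004000100000400001000003c0000b00001400001000020000080000200000800001c0000400000400004000010000040000100000400000c0000100000800002000008000020000080000200000400001000004000010000040000100000400001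

def lkC (n K : ℕ) : ℕ := Nat.mod (Nat.shiftRight tabC (Nat.mul 22 (Nat.add (Nat.mul 7 n) K))) 4194304

def rkS (k : ℕ → Bool) : ℕ → ℕ → ℕ → ℕ → Bool
  | 0, _, _, a => k a
  | n + 1, N, K, a => force (Nat.div N 2) fun N' =>
      cond (Nat.beq (Nat.mod N 2) 0) (rkS k n N' K a) (force (Nat.add a (lkC n K)) fun a' => rkS k n N' (Nat.sub K 1) a')

def winB (b : ℕ) : Bool := cond (Nat.beq (Nat.mod b 2) 0) false (Nat.ble b 549755813887)

def rotR (k : ℕ → Bool) : ℕ → ℕ → ℕ → Bool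
  | 0, _, F => k F
  | n + 1, b, F => force (Nat.div (Nat.add b (Nat.mul (Nat.mod b 2) 35184372088832)) 2) fun b' =>
      cond (winB b) (rkS (fun r => force (Nat.pow 2 r) fun p => cond (Nat.beq (Nat.land F p) 0) false (force (Nat.xor F p) fun F' => rotR k n b' F')) 38 (Nat.div b 2) 6 0)
         (rotR k n b' F)

def decO (k : ℕ → ℕ → ℕ → ℕ → Bool) : ℕ → ℕ → ℕ → ℕ → ℕ → Bool
  | 0, _, _, _, _ => false
  | f + 1, st, b, S, R => force (Nat.div st 24) fun st' => force (Nat.mod st 24) fun g => cond (Nat.beq g 0) (k b S R st')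
      (force (Nat.add (Nat.mul b (Nat.pow 2 g)) 1) fun b' => force (Nat.xor (mulN S (Nat.pow 4096 g)) 1) fun S' =>
       force (Nat.xor (mulN R (Nat.pow 4096 (Nat.sub 45 g))) 1) fun R' => cond (Nat.ble b' 35184372088831) (decO k f st' b' S' R') false)

def cub : ℕ → ℕ → ℕ → ℕ
  | 0, _, a => a
  | n + 1, N, a => force (Nat.div N 4096) fun N' => force (Nat.add a (Nat.pow (Nat.mod N 4096) 3)) fun a' => cub n N' a'

def orbR (s s' Fv : ℕ) : ℕ → ℕ → ℕ → ℕ → ℕ → ℕ → Bool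
  | 0, _, _, _, _, _ => false
  | n + 1, st, F, LL, RR, LR => cond (Nat.beq st 0)
      (cond (Nat.beq F 0) (Nat.beq (Nat.add (Nat.add (cub 45 LL 0) (cub 45 RR 0)) (Nat.mul 2 (cub 45 LR 0))) Fv) false)
      (decO (fun b S S' st' => force (Nat.mod S 4095) fun kk => force (mulN S s) fun P => force (mulN S' s') fun P' =>
        cond (Nat.beq (Nat.mod kk 2) 1) (cond (Nat.ble kk 7) (cond (Nat.beq (Nat.add kk (Nat.mod P 4095)) 14)
        (rotR (fun F' =>
          force (mulI S S') fun a => force (mulI P P') fun b => force (mulI S P') fun c =>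
          cond (Nat.ble kk 5)
            (force (Nat.add a b) fun d => force (Nat.add LL d) fun LL => force (Nat.add RR d) fun RR => force (Nat.add LR (Nat.mul 2 c)) fun LR => orbR s s' Fv n st' F' LL RR LR)
            (force (Nat.add LL a) fun LL => force (Nat.add RR b) fun RR => force (Nat.add LR c) fun LR => orbR s s' Fv n st' F' LL RR LR)) 45 b F) false) false) false) 9 st 1 1 1)

def chk1 (ones K0 K1 K2 : ℕ) (bs : List B5) (N st Fv : ℕ) : Bool :=
  cond (Nat.beq st 0) false (cond (Nat.beq (Nat.mod (Nat.mod N 4095) 4) 1)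
    (mid ones K0 K1 K2 bs N fun F => force (powN 12 N 4094) fun s' => orbR N s' Fv 30 st F 0 0 0) false)

def codeN (c k : ℕ) : ℕ := mulN (mulN (sp 15079016609498) (powN 12 (sp 16144201005754) (Nat.add 2 c))) (powN 12 (sp 198339713878) k)

inductive Ent | mk (c k st Fv : ℕ)

def chkL (ones K0 K1 K2 : ℕ) (bs : List B5) : List Ent → Bool
  | [] => true
  | e :: es => Ent.casesOn (motive := fun _ => Bool) e fun c k st Fv => cond (force (codeN c k) fun N => chk1 ones K0 K1 K2 bs N st Fv) (chkL ones K0 K1 K2 bs es) false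

def chkS (es : List Ent) : Bool := famS 38 6 (fun c ms => force (Nat.sub (Nat.pow 2 c) 1) fun ones =>
  pcnW [[], [], []] (ones :: ms) fun K => un false K fun K0 K => un false K fun K1 K => un false K fun K2 _ =>
  forceL (mkB (ones :: apS ms [0])) fun bs => chkL ones K0 K1 K2 bs es) false

end BD

set_option linter.all false
namespace BD
open Finset

theorem coeff_el (b : ℕ) (i : ZMod 45) : (el b).coeff i = if b.testBit i.val then 1 else 0 := by
  unfold el
  rw [coeff_ofFn, Nat.testBit_eq_decide_div_mod_eq]
  rcases Nat.mod_two_eq_zero_or_one (b / 2 ^ i.val) with h | h <;> rw [h] <;> simp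

theorem bit_el (b : ℕ) (i : ZMod 45) : bit (el b) i = (b.testBit i.val).toNat := by
  unfold bit; rw [coeff_el]; cases b.testBit i.val <;> rfl

theorem tB_el (b i : ℕ) (hi : i < 45) : tB (el b) i = b.testBit i := by
  unfold tB; rw [bit_el, ZMod.val_natCast_of_lt hi]; cases b.testBit i <;> rfl

theorem el_rot (b : ℕ) (hb : b < 2 ^ 45) :
    (b + b % 2 * 35184372088832) / 2 < 2 ^ 45 ∧ el ((b + b % 2 * 35184372088832) / 2) = X (-1) * el b := by
  refine ⟨by have : b % 2 < 2 := Nat.mod_lt _ (by norm_num); omega, ?_⟩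
  apply A_ext
  intro i
  rw [coeff_X_mul, coeff_el, coeff_el, sub_neg_eq_add, ← Nat.testBit_succ]
  have e : b + b % 2 * 35184372088832 = 2 ^ 45 * (b % 2) + b := by omega
  rw [e, Nat.testBit_two_pow_mul_add _ hb]
  by_cases h : i.val + 1 < 45
  · have : (i + 1).val = i.val + 1 := by
      rw [ZMod.val_add_of_lt]
      · rfl
      · exact h
    rw [if_pos h, this]
  · have hi : i = 44 := by
      apply ZMod.val_injective
      have := ZMod.val_lt i
      show i.val = 44
      omega
    subst hi
    have h1 : ((44 : ZMod 45) + 1).val = 0 := by decide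
    have h2 : (44 : ZMod 45).val = 44 := by decide
    rw [h1, h2]
    simp

theorem el_step (b g : ℕ) (h1 : 1 ≤ g) (hg : g < 24) (h : b * 2 ^ g + 1 < 2 ^ 45) : el (b * 2 ^ g + 1) = X (g : ZMod 45) * el b + 1 := by
  apply A_ext
  intro i
  have hadd : (X (g : ZMod 45) * el b + 1).coeff i = (X (g : ZMod 45) * el b).coeff i + (1 : A).coeff i := rfl
  rw [hadd, coeff_X_mul, coeff_one', coeff_el, coeff_el, Nat.mul_comm,
    Nat.testBit_two_pow_mul_add _ (Nat.one_lt_two_pow (by omega))]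
  have hgv : (g : ZMod 45).val = g := ZMod.val_natCast_of_lt (by omega)
  have hiv := ZMod.val_lt i
  by_cases hi : i.val < g
  · have e : (i - (g : ZMod 45)).val = i.val + 45 - g := by
      have : i - (g : ZMod 45) = ((i.val + 45 - g : ℕ) : ZMod 45) := by
        rw [Nat.cast_sub (by omega), Nat.cast_add, ZMod.natCast_zmod_val, show ((45 : ℕ) : ZMod 45) = 0 from rfl, add_zero]
      rw [this, ZMod.val_natCast_of_lt (by omega)]
    have hb : b < 2 ^ (i.val + 45 - g) := by
      by_contra hc
      have h2 : 2 ^ (i.val + 45 - g) * 2 ^ g ≤ b * 2 ^ g := Nat.mul_le_mul_right _ (by omega)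
      rw [← Nat.pow_add] at h2
      have h3 : 2 ^ 45 ≤ 2 ^ (i.val + 45 - g + g) := Nat.pow_le_pow_right (by norm_num) (by omega)
      omega
    rw [if_pos hi, e, Nat.testBit_lt_two_pow hb]
    by_cases h0 : i = 0
    · subst h0; simp
    · have : i.val ≠ 0 := fun h => h0 ((ZMod.val_eq_zero i).1 h)
      rw [if_neg h0]
      have h1f : (1 : ℕ).testBit i.val = false := by
        cases hh : (1 : ℕ).testBit i.val
        · rfl
        · exact absurd (Nat.testBit_one_eq_true_iff_self_eq_zero.1 hh) this
      rw [h1f]; simp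
  · have e : (i - (g : ZMod 45)).val = i.val - g := by
      have : i - (g : ZMod 45) = ((i.val - g : ℕ) : ZMod 45) := by
        rw [Nat.cast_sub (by omega), ZMod.natCast_zmod_val]
      rw [this, ZMod.val_natCast_of_lt (by omega)]
    have h0 : i ≠ 0 := by rintro rfl; rw [ZMod.val_zero] at hi; omega
    rw [if_neg hi, e, if_neg h0, add_zero]

theorem enc_Xn (g : ℕ) (hg : g < 45) : enc (X (g : ZMod 45)) = 4096 ^ g := by
  rw [enc_X, ZMod.val_natCast_of_lt hg]
  have : ∀ g < 45, sp (2 ^ g) = 4096 ^ g := by decide +kernel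
  exact this g hg

noncomputable instance decWin (T : A) : Decidable (Win T) := Classical.dec _

theorem winB_iff (b : ℕ) (hb : b < 2 ^ 45) : winB b = true ↔ Win (el b) := by
  unfold winB Win
  rw [coeff_el, ZMod.val_zero]
  have h0 : b.testBit 0 = decide (b % 2 = 1) := Nat.testBit_zero b
  constructor
  · intro h
    have hm : b % 2 = 1 := by
      rcases Nat.mod_two_eq_zero_or_one b with h' | h'
      · have : Nat.mod b 2 = 0 := h'
        rw [this] at h; exact absurd h (by simp)
      · exact h'
    have hm' : Nat.mod b 2 = 1 := hm
    rw [hm'] at h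
    have hle : b ≤ 549755813887 := Nat.le_of_ble_eq_true h
    refine ⟨by rw [h0, hm]; rfl, fun i hi hi' => ?_⟩
    rw [coeff_el, ZMod.val_natCast_of_lt hi', Nat.testBit_lt_two_pow]
    · rfl
    · have : 2 ^ 39 ≤ 2 ^ i := Nat.pow_le_pow_right (by norm_num) hi
      omega
  · rintro ⟨h1, h2⟩
    have hm : b % 2 = 1 := by
      by_contra hc
      rw [h0, decide_eq_false hc] at h1
      exact absurd h1 (by decide)
    have hm' : Nat.mod b 2 = 1 := hm
    rw [hm']
    have hlt : b < 2 ^ 39 := by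
      apply Nat.lt_pow_two_of_testBit
      intro i hi
      by_cases h45 : i < 45
      · have := h2 i hi h45
        rw [coeff_el, ZMod.val_natCast_of_lt h45] at this
        cases hh : b.testBit i
        · rfl
        · rw [hh] at this; exact absurd this (by decide)
      · apply Nat.testBit_lt_two_pow
        exact lt_of_lt_of_le hb (Nat.pow_le_pow_right (by norm_num) (by omega))
    exact Nat.ble_eq_true_of_le (by omega : b ≤ 549755813887)

theorem lk_eq : ∀ n < 38, ∀ K < 7, lkC n K = cN n K := by decide +kernel

def pb (n m : ℕ) : List Bool := (List.range n).map fun i => m.testBit i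

theorem pb_succ (n m : ℕ) : pb (n + 1) m = m.testBit 0 :: pb n (m / 2) := by
  unfold pb
  rw [List.range_succ_eq_map, List.map_cons, List.map_map]
  refine congrArg _ (List.map_congr_left fun i _ => ?_)
  exact Nat.testBit_succ m i

theorem rkS_spec (k : ℕ → Bool) (n : ℕ) : ∀ (m K a : ℕ), n ≤ 38 → K < 7 → (pb n m).count true ≤ K →
    rkS k n m K a = k (a + rk K (pb n m)) := by
  induction n with
  | zero => intro m K a _ _ _; rfl
  | succ n ih =>
    intro m K a hn hK hc
    rw [pb_succ] at hc ⊢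
    have hl : (pb n (m / 2)).length = n := by simp [pb]
    have h0 : m.testBit 0 = decide (m % 2 = 1) := Nat.testBit_zero m
    unfold rkS
    rw [force_eq]
    rcases Nat.mod_two_eq_zero_or_one m with h | h
    · have h' : Nat.mod m 2 = 0 := h
      have e0 : m.testBit 0 = false := by rw [h0, h]; rfl
      rw [e0] at hc ⊢
      rw [h']
      have hc' : (pb n (m / 2)).count true ≤ K := by simpa using hc
      refine (ih (m / 2) K a (by omega) hK hc').trans ?_
      rw [show rk K (false :: pb n (m / 2)) = rk K (pb n (m / 2)) by cases K <;> rfl]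
    · have h' : Nat.mod m 2 = 1 := h
      have e0 : m.testBit 0 = true := by rw [h0, h]; rfl
      rw [e0] at hc ⊢
      rw [h', force_eq]
      rw [List.count_cons_self] at hc
      cases K with
      | zero => omega
      | succ K =>
        refine (ih (m / 2) K _ (by omega) (by omega) (by omega)).trans ?_
        rw [rk, hl, lk_eq n (by omega) (K + 1) hK]
        exact congrArg k (Nat.add_assoc _ _ _)

theorem pb_pT (b : ℕ) : pb 38 (b / 2) = pT (el b) := by
  unfold pb pT
  refine List.map_congr_left fun i hi => ?_
  have := List.mem_range.1 hi
  rw [tB_el b _ (by omega), Nat.testBit_succ]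

def CLR (F F' : ℕ) (ws : List ℕ) : Prop :=
  ws.Nodup ∧ (∀ x ∈ ws, F.testBit x = true) ∧ ∀ x, F'.testBit x = true ↔ F.testBit x = true ∧ x ∉ ws

theorem clr_nil (F : ℕ) : CLR F F [] := ⟨List.nodup_nil, by simp, by simp⟩

theorem clr_append {F G H : ℕ} {u v : List ℕ} (h : CLR F G u) (h' : CLR G H v) : CLR F H (u ++ v) := by
  obtain ⟨a1, a2, a3⟩ := h
  obtain ⟨b1, b2, b3⟩ := h'
  refine ⟨List.nodup_append.2 ⟨a1, b1, ?_⟩, ?_, ?_⟩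
  · rintro x hx y hy rfl
    exact ((a3 x).1 (b2 x hy)).2 hx
  · intro x hx
    rcases List.mem_append.1 hx with h | h
    · exact a2 x h
    · exact ((a3 x).1 (b2 x h)).1
  · intro x
    rw [b3, a3, List.mem_append]; tauto

theorem clr_one {F r : ℕ} (h : Nat.land F (2 ^ r) ≠ 0) : CLR F (Nat.xor F (2 ^ r)) [r] := by
  have hr : F.testBit r = true := by
    by_contra hc
    apply h
    apply Nat.eq_of_testBit_eq
    intro i
    rw [tba, Nat.testBit_two_pow, Nat.zero_testBit]
    by_cases e : r = i
    · subst e; simp [Bool.eq_false_iff.2 hc]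
    · simp [e]
  refine ⟨List.nodup_singleton r, by simpa using hr, ?_⟩
  intro x
  rw [tbx, Nat.testBit_two_pow, List.mem_singleton]
  by_cases e : r = x
  · subst e; simp [hr]
  · simp [e, Ne.symm e]

noncomputable def rl : ℕ → A → List A
  | 0, _ => []
  | n + 1, Y => Y :: rl n (X (-1) * Y)

noncomputable def fw (l : List A) : List ℕ := (l.filter fun T => decide (Win T)).map L

theorem rotR_spec (k : ℕ → Bool) (n : ℕ) : ∀ (b F : ℕ), b < 2 ^ 45 → wt (el b) ≤ 7 → rotR k n b F = true →
    ∃ F', k F' = true ∧ CLR F F' (fw (rl n (el b))) := by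
  induction n with
  | zero => intro b F _ _ h; exact ⟨F, h, clr_nil F⟩
  | succ n ih =>
    intro b F hb h7 h
    unfold rotR at h
    rw [force_eq] at h
    change cond (winB b) _ (rotR k n ((b + b % 2 * 35184372088832) / 2) F) = true at h
    obtain ⟨r1, r2⟩ := el_rot b hb
    have h7' : wt (el ((b + b % 2 * 35184372088832) / 2)) ≤ 7 := by rw [r2, wt_X_mul]; exact h7
    have hrl : rl (n + 1) (el b) = el b :: rl n (el ((b + b % 2 * 35184372088832) / 2)) := by rw [r2]; rfl
    rw [hrl]
    by_cases hw : Win (el b)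
    · have hwb := (winB_iff b hb).2 hw
      rw [hwb, cond_true] at h
      have hc : (pb 38 (Nat.div b 2)).count true ≤ 6 := by
        have := wt_win hw
        have e := pb_pT b
        change pb 38 (Nat.div b 2) = _ at e
        rw [e]; omega
      rw [rkS_spec _ 38 _ 6 0 le_rfl (by norm_num) hc, force_eq] at h
      have e : 0 + rk 6 (pb 38 (Nat.div b 2)) = L (el b) := by
        rw [Nat.zero_add]; exact congrArg (rk 6) (pb_pT b)
      rw [e] at h
      cases hz : Nat.beq (Nat.land F (Nat.pow 2 (L (el b)))) 0
      · rw [hz, cond_false, force_eq] at h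
        obtain ⟨F', hF', hcl⟩ := ih _ _ r1 h7' h
        refine ⟨F', hF', ?_⟩
        have hne : Nat.land F (2 ^ L (el b)) ≠ 0 := Nat.ne_of_beq_eq_false hz
        have := clr_append (clr_one hne) hcl
        have e2 : fw (el b :: rl n (el ((b + b % 2 * 35184372088832) / 2))) = [L (el b)] ++ fw (rl n (el ((b + b % 2 * 35184372088832) / 2))) := by
          unfold fw; rw [List.filter_cons_of_pos (by simpa using hw)]; rfl
        rw [e2]; exact this
      · rw [hz] at h; exact absurd h (by simp)
    · have hwb : winB b = false := Bool.eq_false_iff.2 fun hh => hw ((winB_iff b hb).1 hh)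
      rw [hwb, cond_false] at h
      obtain ⟨F', hF', hcl⟩ := ih _ _ r1 h7' h
      refine ⟨F', hF', ?_⟩
      have e2 : fw (el b :: rl n (el ((b + b % 2 * 35184372088832) / 2))) = fw (rl n (el ((b + b % 2 * 35184372088832) / 2))) := by
        unfold fw; rw [List.filter_cons_of_neg (by simpa using hw)]
      rw [e2]; exact hcl

theorem decO_spec (k : ℕ → ℕ → ℕ → ℕ → Bool) (f : ℕ) : ∀ (s b : ℕ), b < 2 ^ 45 → decO k f s b (enc (el b)) (enc (st (el b))) = true →
    ∃ b' s', b' < 2 ^ 45 ∧ k b' (enc (el b')) (enc (st (el b'))) s' = true := by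
  induction f with
  | zero => intro s b _ h; exact absurd h (by simp [decO])
  | succ f ih =>
    intro s b hb h
    unfold decO at h
    rw [force_eq, force_eq] at h
    have hg : Nat.mod s 24 < 24 := Nat.mod_lt _ (by norm_num)
    generalize Nat.mod s 24 = g at h hg
    cases hz : Nat.beq g 0
    · rw [hz, cond_false, force_eq, force_eq, force_eq] at h
      have hg0 : g ≠ 0 := Nat.ne_of_beq_eq_false hz
      obtain ⟨h1, h2⟩ := cond_true' h
      have hlt : b * 2 ^ g + 1 < 2 ^ 45 := by
        have : b * 2 ^ g + 1 ≤ 35184372088831 := Nat.le_of_ble_eq_true h1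
        omega
      have e := el_step b g (by omega) hg hlt
      have e1 : Nat.xor (mulN (enc (el b)) (Nat.pow 4096 g)) 1 = enc (el (b * 2 ^ g + 1)) := by
        rw [e, enc_add, mul_comm, enc_mul, enc_Xn g (by omega), enc_one]; rfl
      have e2 : Nat.xor (mulN (enc (st (el b))) (Nat.pow 4096 (Nat.sub 45 g))) 1 = enc (st (el (b * 2 ^ g + 1))) := by
        have : -(g : ZMod 45) = ((45 - g : ℕ) : ZMod 45) := by
          rw [Nat.cast_sub (by omega), show ((45 : ℕ) : ZMod 45) = 0 from rfl, zero_sub]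
        rw [e, st_add, st_mul, st_X, st_one, enc_add, mul_comm, enc_mul, this, enc_Xn _ (by omega), enc_one]; rfl
      rw [e1, e2] at h2
      exact ih _ _ hlt h2
    · rw [hz, cond_true] at h
      exact ⟨b, _, hb, h⟩

end BD

set_option linter.all false
namespace BD
open Finset

theorem force_eq' {α : Type} (x : ℕ) (f : ℕ → α) : force x f = f x := by
  have h := force_eq x f
  rw [h]

theorem encF_add (f g : ZMod 45 → ℕ) : Nat.add (encF f) (encF g) = encF (fun k => f k + g k) := by
  show encF f + encF g = _
  unfold encF
  rw [← Finset.sum_add_distrib]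
  exact Finset.sum_congr rfl fun i _ => by ring

theorem encF_two (g : ZMod 45 → ℕ) : Nat.mul 2 (encF g) = encF (fun k => g k + g k) := by
  rw [← encF_add]; exact Nat.two_mul _

theorem fw_append (l l' : List A) : fw (l ++ l') = fw l ++ fw l' := by
  unfold fw; rw [List.filter_append, List.map_append]

theorem orbR_spec (σ : A) (Fv n : ℕ) : ∀ (s F : ℕ) (l r m : ZMod 45 → ℕ),
    orbR (enc σ) (enc (st σ)) Fv n s F (encF l) (encF r) (encF m) = true →
    ∃ O : List A, O.length ≤ n ∧ (∀ S ∈ O, S ∈ WW σ ∧ wt S ≤ 7) ∧ CLR F 0 (fw (O.flatMap (rl 45))) ∧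
      cub 45 (encF fun k => l k + LLf σ O k) 0 + cub 45 (encF fun k => r k + RRf σ O k) 0 +
        2 * cub 45 (encF fun k => m k + LRf σ O k) 0 = Fv ∧ (s ≠ 0 → O ≠ []) := by
  induction n with
  | zero => intro s F l r m h; exact absurd h (by simp [orbR])
  | succ n ih =>
    intro s F l r m h
    unfold orbR at h
    cases hz : Nat.beq s 0
    · rw [hz, cond_false] at h
      have e1 : (1 : ℕ) = enc (el 1) := by rw [enc_el]; decide +kernel
      have e1' : el 1 = (1 : A) := by apply enc_inj; rw [← e1, enc_one]
      have e2 : (1 : ℕ) = enc (st (el 1)) := by rw [e1', st_one, enc_one]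
      obtain ⟨b, s', hb, h⟩ := decO_spec _ 9 s 1 (by norm_num) (by rw [← e1, ← e2]; exact h)
      simp only [force_eq'] at h
      rw [enc_mod, ← enc_mul, ← enc_mul, enc_mod, ← st_mul] at h
      obtain ⟨q1, h⟩ := cond_true' h
      obtain ⟨q2, h⟩ := cond_true' h
      obtain ⟨q3, h⟩ := cond_true' h
      have q1 : wt (el b) % 2 = 1 := Nat.eq_of_beq_eq_true q1
      have q2 : wt (el b) ≤ 7 := Nat.le_of_ble_eq_true q2
      have q3 : wt (el b) + wt (el b * σ) = 14 := Nat.eq_of_beq_eq_true q3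
      obtain ⟨F', h, hcl⟩ := rotR_spec _ 45 b F hb q2 h
      rw [enc_conv, enc_conv, enc_conv] at h
      have key : ∃ l' r' m' : ZMod 45 → ℕ, orbR (enc σ) (enc (st σ)) Fv n s' F' (encF l') (encF r') (encF m') = true ∧
          (∀ O k, l' k + LLf σ O k = l k + LLf σ (el b :: O) k) ∧
          (∀ O k, r' k + RRf σ O k = r k + RRf σ (el b :: O) k) ∧
          (∀ O k, m' k + LRf σ O k = m k + LRf σ (el b :: O) k) := by
        cases h5 : Nat.ble (wt (el b)) 5
        · have n5 : ¬ wt (el b) ≤ 5 := fun hh => by rw [Nat.ble_eq_true_of_le hh] at h5; cases h5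
          rw [h5, cond_false, encF_add, encF_add, encF_add] at h
          refine ⟨_, _, _, h, ?_, ?_, ?_⟩ <;> intro O k <;>
            simp only [LLf, RRf, LRf, List.map_cons, List.sum_cons, if_neg n5] <;> ring
        · have n5 : wt (el b) ≤ 5 := Nat.le_of_ble_eq_true h5
          rw [h5, cond_true, encF_add, encF_add, encF_add, encF_two, encF_add] at h
          refine ⟨_, _, _, h, ?_, ?_, ?_⟩ <;> intro O k <;>
            simp only [LLf, RRf, LRf, List.map_cons, List.sum_cons, if_pos n5] <;> ring
      obtain ⟨l', r', m', h, k1, k2, k3⟩ := key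
      obtain ⟨O, o1, o2, o3, o4, -⟩ := ih s' F' l' r' m' h
      refine ⟨el b :: O, by simpa using o1, ?_, ?_, ?_, fun _ => by simp⟩
      · intro S hS
        rcases List.mem_cons.1 hS with rfl | hS
        · exact ⟨(mem_WW _ _).2 ⟨q1, q3⟩, q2⟩
        · exact o2 S hS
      · rw [List.flatMap_cons, fw_append]; exact clr_append hcl o3
      · simp only [k1, k2, k3] at o4; exact o4
    · rw [hz, cond_true] at h
      obtain ⟨h1, h2⟩ := cond_true' h
      have h1 : F = 0 := Nat.eq_of_beq_eq_true h1
      have h2 := Nat.eq_of_beq_eq_true h2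
      have hs : s = 0 := Nat.eq_of_beq_eq_true hz
      refine ⟨[], by simp, by simp, ?_, ?_, fun h => absurd hs h⟩
      · rw [h1]; exact clr_nil 0
      · have a1 : (fun k => l k + LLf σ [] k) = l := funext fun k => by simp [LLf]
        have a2 : (fun k => r k + RRf σ [] k) = r := funext fun k => by simp [RRf]
        have a3 : (fun k => m k + LRf σ [] k) = m := funext fun k => by simp [LRf]
        rw [a1, a2, a3]; exact h2

theorem cub_eq (n : ℕ) : ∀ N a, cub n N a = a + ∑ i ∈ range n, (N / 4096 ^ i % 4096) ^ 3 := by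
  induction n with
  | zero => intro N a; simp [cub]
  | succ n ih =>
    intro N a
    unfold cub
    rw [force_eq, force_eq, ih, Finset.sum_range_succ']
    have : ∀ i, Nat.div N 4096 / 4096 ^ i = N / 4096 ^ (i + 1) := fun i => by
      rw [pow_succ']; exact Nat.div_div_eq_div_mul N 4096 (4096 ^ i)
    simp only [this]
    show a + (N % 4096) ^ 3 + _ = _
    simp; ring

theorem cub_encF (f : ZMod 45 → ℕ) (hf : ∀ k, f k < 2 ^ 12) : cub 45 (encF f) 0 = ∑ k, f k ^ 3 := by
  rw [cub_eq, Nat.zero_add, sumR]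
  refine Finset.sum_congr rfl fun i hi => ?_
  rw [encF_dig, dig_digit _ _ (fun i => hf _) i (Finset.mem_range.1 hi)]

theorem list_bd (O : List A) (g : A → ℕ) (h : ∀ S, g S ≤ 90) (hl : O.length ≤ 30) : (O.map g).sum < 2 ^ 12 := by
  have : (O.map g).sum ≤ O.length * 90 := by
    clear hl
    induction O with
    | nil => simp
    | cons a O ih => have := h a; simp only [List.map_cons, List.sum_cons, List.length_cons]; linarith
  omega

theorem cv (S T : A) (k : ZMod 45) : conv (bit S) (bit T) k ≤ 45 := conv_le _ _ (bit_le S) (bit_le T) k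

theorem lists_lt (σ : A) (O : List A) (hl : O.length ≤ 30) (k : ZMod 45) :
    LLf σ O k < 2 ^ 12 ∧ RRf σ O k < 2 ^ 12 ∧ LRf σ O k < 2 ^ 12 := by
  refine ⟨list_bd O _ (fun S => ?_) hl, list_bd O _ (fun S => ?_) hl, list_bd O _ (fun S => ?_) hl⟩ <;>
  · have h1 := cv S (st S) k
    have h2 := cv (S * σ) (st (S * σ)) k
    have h3 := cv S (st (S * σ)) k
    split_ifs <;> omega

theorem rl_sum (g : A → ℕ) (n : ℕ) : ∀ Y, ((rl n Y).map g).sum = ∑ i ∈ range n, g (X (-(i : ZMod 45)) * Y) := by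
  induction n with
  | zero => intro Y; simp [rl]
  | succ n ih =>
    intro Y
    rw [rl, List.map_cons, List.sum_cons, ih, Finset.sum_range_succ', add_comm]
    congr 1
    · refine Finset.sum_congr rfl fun i _ => ?_
      rw [← mul_assoc, ← X_add]; congr 3; push_cast; ring
    · rw [Nat.cast_zero, neg_zero, X_zero, one_mul]

theorem rl45_sum (g : A → ℕ) (Y : A) : ((rl 45 Y).map g).sum = ∑ c, g (X c * Y) := by
  rw [rl_sum, ← sumR (fun c => g (X (-c) * Y))]
  exact Equiv.sum_comp (Equiv.neg (ZMod 45)) fun c => g (X c * Y)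

theorem mem_rl (n : ℕ) : ∀ Y T, T ∈ rl n Y → ∃ c, T = X c * Y := by
  induction n with
  | zero => intro Y T h; simp [rl] at h
  | succ n ih =>
    intro Y T h
    rw [rl, List.mem_cons] at h
    rcases h with rfl | h
    · exact ⟨0, by rw [X_zero, one_mul]⟩
    · obtain ⟨c, rfl⟩ := ih _ _ h
      exact ⟨c + -1, by rw [X_add, mul_assoc]⟩

theorem all_sum (g : A → ℕ) (O : List A) : ((O.flatMap (rl 45)).map g).sum = (O.map fun S => ∑ c, g (X c * S)).sum := by
  induction O with
  | nil => simp
  | cons S O ih => rw [List.flatMap_cons, List.map_append, List.sum_append, ih, rl45_sum, List.map_cons, List.sum_cons]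

theorem X_cancel (c : ZMod 45) (S : A) : X (-c) * (X c * S) = S := by
  rw [← mul_assoc, ← X_add, neg_add_cancel, X_zero, one_mul]

open Classical in
theorem cnt_sum (T : A) (l : List A) : l.count T = (l.map fun S => if S = T then 1 else 0).sum := by
  induction l with
  | nil => simp
  | cons a l ih =>
    rw [List.map_cons, List.sum_cons, ← ih, List.count_cons]
    by_cases h : a = T <;> simp [h, add_comm]

open Classical in
theorem cnt_shift (O : List A) (d : ZMod 45) (T : A) : (O.flatMap (rl 45)).count (X d * T) = (O.flatMap (rl 45)).count T := by
  rw [cnt_sum, cnt_sum, all_sum, all_sum]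
  refine congrArg List.sum (List.map_congr_left fun S _ => ?_)
  rw [← Equiv.sum_comp (Equiv.subRight d) fun c => if X c * S = T then 1 else 0]
  refine Finset.sum_congr rfl fun c _ => ?_
  rw [Equiv.subRight_apply]
  show (if X c * S = X d * T then 1 else 0) = if X (c - d) * S = T then 1 else 0
  congr 1
  apply propext
  constructor
  · intro h
    rw [← X_cancel d T, ← h, ← mul_assoc, ← X_add]; congr 2; ring
  · rintro rfl
    rw [← mul_assoc, ← X_add]; congr 2; ring

theorem WW_X {σ : A} (c : ZMod 45) {S : A} (h : S ∈ WW σ) : X c * S ∈ WW σ := by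
  rw [mem_WW] at h ⊢
  rw [mul_assoc, wt_X_mul, wt_X_mul]; exact h

open Classical in
theorem orb_of {σ : A} {c : ℕ} {ms : List ℕ} (hK : OK 38 6 c ms) {F : ℕ} {O : List A}
    (hF : ∀ T, Win T → wt T ≤ 7 → (F.testBit (L T) = true ↔ wt T % 2 = 1 ∧ wt (T * σ) + wt T = 14))
    (hO : ∀ S ∈ O, S ∈ WW σ ∧ wt S ≤ 7) (hC : CLR F 0 (fw (O.flatMap (rl 45)))) : Orb σ O := by
  intro g
  obtain ⟨c1, c2, c3⟩ := hC
  have mem1 : ∀ T ∈ O.flatMap (rl 45), T ∈ WW σ ∧ wt T ≤ 7 := by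
    intro T hT
    obtain ⟨S, hS, hT⟩ := List.mem_flatMap.1 hT
    obtain ⟨d, rfl⟩ := mem_rl _ _ _ hT
    exact ⟨WW_X d (hO S hS).1, by rw [wt_X_mul]; exact (hO S hS).2⟩
  have nz : ∀ T ∈ WW σ, T ≠ 0 := by
    rintro T hT rfl
    have := ((mem_WW _ _).1 hT).1
    simp [wt, bit] at this
  have nd : (O.flatMap (rl 45)).Nodup := by
    rw [List.nodup_iff_count_le_one]
    intro T
    by_cases hT : T ∈ O.flatMap (rl 45)
    · obtain ⟨h1, h2⟩ := mem1 T hT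
      obtain ⟨d, hd⟩ := win_of (nz T h1) h2
      rw [← cnt_shift O d T]
      have := List.nodup_iff_count_le_one.1 (List.Nodup.of_map _ c1) (X d * T)
      rwa [List.count_filter (by simpa using hd)] at this
    · rw [List.count_eq_zero_of_not_mem hT]; omega
  have ms : (WW σ).filter (fun S => wt S ≤ 7) = (O.flatMap (rl 45)).toFinset := by
    ext T
    rw [Finset.mem_filter, List.mem_toFinset]
    refine ⟨fun ⟨h1, h2⟩ => ?_, mem1 T⟩
    obtain ⟨d, hd⟩ := win_of (nz T h1) h2
    have h1' := WW_X d h1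
    have h2' : wt (X d * T) ≤ 7 := by rw [wt_X_mul]; exact h2
    have hb := (hF _ hd h2').2 (by rw [add_comm]; exact (mem_WW _ _).1 h1')
    have hm : L (X d * T) ∈ fw (O.flatMap (rl 45)) := by
      by_contra hc
      have := (c3 (L (X d * T))).2 ⟨hb, hc⟩
      simp at this
    obtain ⟨T', hT', e⟩ := List.mem_map.1 hm
    obtain ⟨m1, m2⟩ := List.mem_filter.1 hT'
    have : T' = X d * T := L_inj hK (by simpa using m2) (mem1 _ m1).2 hd h2' e
    subst this
    have := List.count_pos_iff.2 m1
    rw [cnt_shift] at this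
    exact List.count_pos_iff.1 this
  rw [ms, List.sum_toFinset _ nd, all_sum]

/-- what one certificate establishes -/
def Res (c k Fv : ℕ) : Prop := Good (U 1 (2 + c) k) ∧ (∃ S, S ∈ WW (U 1 (2 + c) k)) ∧ inv (code (U 1 (2 + c) k)) = 45 * Fv

theorem chk1_spec {c K0 K1 K2 : ℕ} {ms : List ℕ} {a k s Fv : ℕ} (hO : OK 38 6 c ms)
    (hK : ∀ l, ∃ e, cnt ((2 ^ c - 1) :: ms) l = val [K0, K1, K2] l + 8 * e)
    (h : chk1 (2 ^ c - 1) K0 K1 K2 (mkB ((2 ^ c - 1) :: (ms ++ [0]))) (enc (U 1 (2 + a) k)) s Fv = true) : Res a k Fv := by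
  unfold chk1 at h
  cases hz : Nat.beq s 0
  swap
  · rw [hz] at h; exact absurd h (by simp)
  rw [hz, cond_false] at h
  have hs : s ≠ 0 := Nat.ne_of_beq_eq_false hz
  have hu := U_uni 1 (2 + a) k
  have hst := U_st 1 (2 + a) k
  unfold Res
  generalize U 1 (2 + a) k = σ at *
  obtain ⟨h4, h⟩ := cond_true' h
  have h4 := Nat.eq_of_beq_eq_true h4
  rw [enc_mod] at h4
  obtain ⟨F, h, hF⟩ := mid_spec hO hK h
  rw [force_eq, ← enc_pow 12 σ 4094 (by norm_num), ← hst] at h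
  have z : (0 : ℕ) = encF fun _ => 0 := by simp [encF]
  obtain ⟨O, o1, o2, o3, o4, o5⟩ := orbR_spec σ Fv 30 s F (fun _ => 0) (fun _ => 0) (fun _ => 0) (by rw [← z]; exact h)
  have hg := good_of hu fun T h1 h2 => ⟨(hF T h1 h2).1, (hF T h1 h2).2.1⟩
  have hOrb := orb_of hO (fun T h1 h2 => (hF T h1 h2).2.2) o2 o3
  refine ⟨hg, ?_, ?_⟩
  · obtain ⟨S, O', rfl⟩ := List.exists_cons_of_ne_nil (o5 hs)
    exact ⟨S, (o2 S (by simp)).1⟩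
  · rw [inv_eq hu h4 hg hOrb, ← o4]
    simp only [Nat.zero_add]
    rw [cub_encF _ fun k => (lists_lt σ O o1 k).1, cub_encF _ fun k => (lists_lt σ O o1 k).2.1, cub_encF _ fun k => (lists_lt σ O o1 k).2.2]

def Ent.P : Ent → Prop
  | .mk c k _ Fv => c < 4094 → k < 4096 → Res c k Fv

theorem codeN_eq {c k : ℕ} (hc : c < 4094) (hk : k < 4096) : codeN c k = enc (U 1 (2 + c) k) := by
  unfold codeN U H3 H15 H45
  rw [enc_mul, enc_mul, pow_one, enc_pow 12 _ (2 + c) (by omega), enc_pow 12 _ k (by omega), enc_el, enc_el, enc_el]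
  rfl

theorem chkL_spec {c K0 K1 K2 : ℕ} {ms : List ℕ} (hO : OK 38 6 c ms)
    (hK : ∀ l, ∃ e, cnt ((2 ^ c - 1) :: ms) l = val [K0, K1, K2] l + 8 * e) : ∀ es : List Ent,
    chkL (2 ^ c - 1) K0 K1 K2 (mkB ((2 ^ c - 1) :: (ms ++ [0]))) es = true → ∀ e ∈ es, e.P := by
  intro es
  induction es with
  | nil => intro _ e he; simp at he
  | cons e es ih =>
    intro h
    obtain ⟨a, k, s, Fv⟩ := e
    unfold chkL at h
    obtain ⟨h1, h2⟩ := cond_true' h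
    intro e he
    rcases List.mem_cons.1 he with rfl | he
    · intro ha hk
      rw [force_eq, codeN_eq ha hk] at h1
      exact chk1_spec hO hK h1
    · exact ih h2 e he

theorem chkS_spec {es : List Ent} (h : chkS es = true) : ∀ e ∈ es, e.P := by
  unfold chkS at h
  obtain ⟨c, ms, e, hO⟩ := famS_spec 38 6 (fun c ms => force (Nat.sub (Nat.pow 2 c) 1) fun ones =>
    pcnW [[], [], []] (ones :: ms) fun K => un false K fun K0 K => un false K fun K1 K => un false K fun K2 _ =>
    forceL (mkB (ones :: apS ms [0])) fun bs => chkL ones K0 K1 K2 bs es) false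
  rw [e] at h
  rw [force_eq] at h
  change pcnW [[], [], []] ((2 ^ c - 1) :: ms) (fun K => un false K fun K0 K => un false K fun K1 K => un false K fun K2 _ =>
    forceL (mkB ((2 ^ c - 1) :: apS ms [0])) fun bs => chkL (2 ^ c - 1) K0 K1 K2 bs es) = true at h
  obtain ⟨r, e, hl, hv⟩ := pcnW_spec [[], [], []] ((2 ^ c - 1) :: ms) (fun K => un false K fun K0 K => un false K fun K1 K => un false K fun K2 _ =>
    forceL (mkB ((2 ^ c - 1) :: apS ms [0])) fun bs => chkL (2 ^ c - 1) K0 K1 K2 bs es)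
  rw [e] at h
  obtain ⟨K0, r0, y0, h0⟩ := un_true h
  obtain ⟨K1, r1, y1, h1⟩ := un_true h0
  obtain ⟨K2, r2, y2, h2⟩ := un_true h1
  subst y2 y1 y0
  obtain rfl : r2 = [] := by
    rw [← List.length_eq_zero_iff]
    simp only [List.length_cons, List.length_nil] at hl; omega
  rw [forceL_eq, apS_eq] at h2
  refine chkL_spec hO (fun l => ?_) es h2
  obtain ⟨e, he⟩ := hv l
  refine ⟨e, ?_⟩
  simpa [vals, cnt_nil] using he

end BD

set_option linter.all false
namespace BD
open Finset

def es0 : List Ent := [.mk 0 17 0x61d743a42057418f10487f18692e2f2b40c744e046b380bae2ac1839325ee695 1235228, .mk 0 30 0x3f2e9652ae3e3aa6c25520fd529ea4a20399f9e9ab9b04053eb28470ca6720a2b6bcfd3eae1247cb8cbfd350de64a 2029060, .mk 0 35 0x3cbf4537af9bebc88047606c96e7c35a3aa4e4e2560cd34142ca7cb46cf7ec0e1fae5732d2e5ae0651aa75b05c4c6e1f34e2e0402d53a55fd99a4 3780544, .mk 0 66 0x2176618ffc9da33eee2c6a0f74b4d3fc88b0108d6433060b86dc476e3b0ddf67244d6a86cb040f21d19222811860869aca7e2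 2518184, .mk 0 70 0x12d7b290d369851f212deb64ee1797f8b8a0669fac976af665d97b4bb19494640f9c60262da4335ff8f9666c1ab1927955e24dbfe8ed361e18a339d4fdcf65db15c19bfc1 8391384, .mk 0 94 0x2f8feee1650bf264463a4e22cd172e1f8cb2873a243771d64e963d6c44d15bf4960697b49c07acccf9351430bc97a3e10f44e94e7ac6083c8aa59ec7b3427 11159276]
def blk0 : chkS es0 = true := by decide +kernel
def es1 : List Ent := [.mk 0 153 0x15ade87356389147b563dc48a39b940799f526765e5f4ac4239dd426fc44d010db84b77e86aded6b2490b1a7e57d8a34a4e20ba1536f 6276016, .mk 0 169 0x2295bd5e2691d4141e7a292ab047ae6d41e0c867b90d1e36c18c5814d5aa53c9a4897cde0448d2b445cf4ea58f762f060f43a6e27e75122dd718f49b3c2c963073945a9aead485270abcd33cf8ee2a644a 17890392, .mk 0 194 0x92e5cecc6fd1edc861fa540508f7c3eff40ba4f8123c83351ff399035a62b9a9e894c04ecad475a24c0b68ec71bfeaf5 3729100, .mk 0 202 0x1af9887544989e72986b015f76ef2e178c6a61f1fbbd0573252 690948, .mk 0 203 0x13b6cb1415a5d38ee1fa4577a0cba345711daaf7d8a11fe56a74a5aa3e42bdc399781d136c23375ae6f16ac16ca5ca5614101914dd4a74286226bd1a05440733485b8434725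 7376204, .mk 0 213 0x97c774e7159503c06381c43b4ec7637393d16f9d7e195bdf8ac996c2e1e7ccb1ec362355618fbe4560a17a0751ae114a705f56e 9585472]
def blk1 : chkS es1 = true := by decide +kernel
def es2 : List Ent := [.mk 0 230 0x62ba2a60968e231d33a62ed2023a2dfff1fa8d1641a2648e7074854dbd6607c9e177f1fb1604d5fa1bec42d33bbc1c3baf57f51510eab02265adfe03d 8432796, .mk 0 245 0x54835033c99c21a338fc2258f69fc96f6e41cb33f10512887f782e90c5fdc160ed22e7d4df3317fb26350ab3bb34a1ae47cd72bea6d13e0c2c4f93a2469ca2982a3d7a5bf23035967316ebfd36fb112a9271 17890476, .mk 0 247 0x258d4eeadd6ee4cecc63583873b8fabca9a0cecd304c5f48324f0d479efe1a2d788646ed50573d06769fd3b58d2c554a35ab7f4de992eca11a5d9b4848c899ac7eaf747cf1ec 12491964, .mk 0 295 0x1cb17a6b5af13b7a9634c54cfc80fc2a053438508ca670ffa7eb9013bf9ac00b3b360fbc8c822e98faa0dd581d4a3240b5429376c01 3800404, .mk 0 308 0x144d0e142621990c12acfb3c41b7741050fb4d2567a7b6e9d0569ff75330af57af1205a6b9123eb1219e9c642fc032507f1c6180c1400ee1b9471406d25ec468e506ecd3c23279c21e1346af60880562caaed1948ba34ac25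 14021284, .mk 0 357 0x19e3a87512c342433be2f82f351fec711f02467bb6e2bc5f498d1b91e7b6b0f9ce53f7e2 2031256]
def blk2 : chkS es2 = true := by decide +kernel
def es3 : List Ent := [.mk 0 383 0x5d21e1c6284fc3efd7aedfd22a41a723cd893ac3b70814b65e48c7da43935c01d1abadc3769b7fffdc9a2b86b37a9b556a13f671632e5b5 9873196, .mk 0 389 0x48dbbbd90f18889551bf171cd622d5a6185c65781d1fba101105d5f5cc1d4d5165958a1696914e5306accb42a7481159e1d6bba9886957 5270280, .mk 0 390 0x2515570de09aa28a092dd0f9156fc10b1a4dff415c47c84e66721f78126a42afbb96fcbd915ad5ebe0d594d93f25c9038b8a228ece30ab86e819c7d0014c3c3dceea2163c34 7378832, .mk 0 439 0x20a669fd8075fb0fa044a40c4afb26acbd3d848f6cb46a74e37d47aa4f0affc3480ef34e30150d3402330f6e92936054556ca301676217682c13465a3064 7210412, .mk 0 463 0x1dc36bdbbb95b51efbcae3c992044c834696c1cd2c29590883827c8e9d4c91d4ebfd4cb9c20f494cfc88f2142acc19192dc8cd63c12af8 4461596, .mk 0 502 0xa126c2ba154889ee230352fc565afd869b08e06ab690415dd295fc819e29a1f2a5f65e3c640d5bef7ce93ddf21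 2527352]
def blk3 : chkS es3 = true := by decide +kernel
def es4 : List Ent := [.mk 0 574 0x159d47a4e52d1d619241aaf2366987df8a863aa05ed9ed8fc574c9c79f9 672636, .mk 0 590 0x35650cffb06a0692d911968c7aaa676901a0e66b932b71bf83b5c83bedb72289dc6fadfe30a2e74de0ba93c5d492a00b2a7dd99b57392ad263c8127141763f0e3889 11048804, .mk 0 595 0x2983f5f91d8ad47dbb218319d96cec9dc0d2625869930dfc2b05722e811059d6ab3709cc2a62c0bbfbddb 1633800, .mk 0 622 0x3990b8902b85ae2914a20f4679219aad5a58487d8f8a7ac72ce30bc4ed21c48f830226ec341f20fb1b761e37b6ee21aed78b11 4486112, .mk 0 650 0xc6ce66d125463378d060b5d37f9567122c5a998cf1f143c98992f0f0f388d16638dc6147b798ff11a9968cb2 3100260, .mk 0 701 0x12ae0a1cc18edd63489e9594d5ec36699a431a56448136c172ac002eb4eed6f6c6cc10107421ce6c755867b97f0ef20c1db248d55fe3e54f2936848aa 6238552]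
def blk4 : chkS es4 = true := by decide +kernel
def es5 : List Ent := [.mk 0 713 0x7655cb10331f0d90057731ab850b6c2496b62c5234c980a2fc91c5c3f37141789832e496b986809d9ae63075 3076152, .mk 0 741 0x5d6c132fa963fc514c34e0c12591de0171e8cc9385110954af8d510094827efb038777a26b7866818e0d8b0ca7be1aae9339e6c7510a4cef5b9bb3c0b0a89 4582532, .mk 0 760 0x672e8e0a4e5d58d2e323f9dae3da923c9a79e756988d86f94c2418a06b8ca271e7aa43e827346ad11956e32ce54a2110585b6e3 9616720, .mk 0 830 0x4d557c705e5b2772b3b5b2b0b398579b1b39b8d6ce8274faee43169bab9bedd4977b057d566ea05cb9abe0387680ff3d270fee5f195074078b9d1 3726244, .mk 0 863 0x2ac0b6ad942319a1aec4f9ac9c48324315e785540b8100f0e274b6a671beb95068705ffd718b8e2bbebe9ec519716308269104569b76b1aa8b2dbcc7b1beb6017ebad41c544a 11011784, .mk 0 876 0x40182ead21f5f76f73cf26b4c1056e2f8a0fd4ae446020499a7c25c2f2d10e2fa3c42b4fed67646504fad8a1d6371 2014240]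
def blk5 : chkS es5 = true := by decide +kernel
def es6 : List Ent := [.mk 0 890 0x5c32af75e7d89df3c848729ace87fd30b295d881a6794168082048df5b605e038d1896affcc5abaed118d15c539053883a63acd730f2c0785227c9 7368176, .mk 0 903 0xd7640af5d37a6893daeff03711b13d3f6f1ae8c8bd6ce1adaf1900b9fffb09fd463d8d27f070f8dd4712954e077b5639d12d5320937b4ad7885c41e57d242be33e42b05066a2 6318676, .mk 0 933 0x27c4ea53c0fae07f90c08ab1e84051338d4238b25562c87a297e0f6f4f90504054155cb585119b7da5455d251ed635b00180a13519db5b294812d7 7256504, .mk 0 952 0x54efa0007c39d8c97ada9a3dd5928891b4a8b04f4ae2b0c6be5fb19f0a88a07d003be61b6c0a402744b01d831ccd989031d32d8b 4546496, .mk 0 954 0x1f8f476d38ac05899b89af021bdd68ae797117d4fa29a68436c2a361452210e488a62f23808ff366face17eef93 2488016, .mk 0 973 0x1064907e1e8a6a307ddd241972970ebc420e9e7bcd2b76c5ceee7a36d0cd67a0f5f18ff22e73a81016e71fe77f1444cd8195885b5ef356aee23c402d1729c5a0268cdc208 8751864]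
def blk6 : chkS es6 = true := by decide +kernel
def es7 : List Ent := [.mk 0 984 0x1dc8040bc75c646d81a54d0389fb17da7e0d777f2297034af3389ffc6dfbc43c1f5c1d0920b020 2004208, .mk 0 987 0xcd5e7bf849d35f60dc9c1746423ab49cd709ca74441e2b561a9c9b00c9d43ea5bf86efe0aa00e5885e082d3ac68a346a627cb612a9270061ef8399d3a3749f62fb889012003c4c09f05d7e87e4ae1a0b 12498828, .mk 0 999 0x1be8505a9b5dbdf0d1a0af55902ff65f0e3b680bd20188e9326c0809de1ec88ead0c10c16d8e8b458e0617ba1509e1085f592edc6fd481d6becc59d0f07abef4956b 9635428, .mk 0 1002 0x2b997554d28a51a75cdd5be9b6738320426815f62d05d39bf6450729a5d461ee483dc37fa679b1a492a0419729d4d7079b2df65546c3 6252664, .mk 0 1013 0x77417b91a67e091ecc882d8a807900cd7ee9c79fd81106fead 2528744, .mk 0 1095 0xa2a645592ad2ebba82a706ba6cce9dc338467e65728904673f34c660ccd9b0f6fbccb6673200e74f05e1df7ebf3c69503901401a7f384cecb43a64b4ff5e878cd17387f7e264cb105732f4f63e5bf834481d06c166c518 15908768]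
def blk7 : chkS es7 = true := by decide +kernel
def es8 : List Ent := [.mk 0 1127 0x79a55283c0cd6b3d91d0b7caef322d7a3a53a71f91e95e343915005b4b367acaf7c1f30ba168a4fb6317c8969c33382299e9e0cfa3bf1c10c85f5acf 6473596, .mk 0 1165 0xb49c09612daf1ed9d0b7acf60eb933941c2f628301e4591c9a709291f3f661966340b342ea73aa7832392b438cd0d5060e1a00ea 4482356, .mk 0 1179 0x8aaa753785f625df67f7b8edd855c6338ae5a3140d3564e21db7cb3d43d7ff6df5b42fef0647625240a4a4d97791a23c0fc862b04ff9d024c8 4544360, .mk 0 1182 0x18d7792eefad23aab282c5bceb6293e7434fa3a8f06bbad594ccbb3f7d58268e2f4fda9c8ae8e1a4f1539a50850329efed4af6e26a711c9bceaeca6cb16 5325096, .mk 0 1195 0x2cbccd3e64ed85f5e21713e17db42ff115e71ae79b326eaed1f2335d9431608856b96658b238f49d97b650958f974bf81b6f1edd675564b231edce15278d9459ad247f174fc93 15990932, .mk 0 1253 0x26af544172a142bb044acc2bc923192614ac8cb661c4b8ebce6a90784b068851ea1869075e40757c9c0d655e7b14 4458800]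
def blk8 : chkS es8 = true := by decide +kernel
def es9 : List Ent := [.mk 0 1258 0x35c869926e4b3a1ebbe0d3b5a26e8afd4a72b093f4cf2537823f0ccd1cd05765033d3fc3505b62479a0ce88589e4ad6b910a1d58b670 6240988, .mk 0 1383 0xba12289ab55397450bc2756c101b2ab528ed0eb009bd8959e0b1c5641dee8a0602182d8c2ede735b340c20e4d88335dead0f6c72e95dbe5ed0d9cc2ff53a085198aa3b89f3e8197e 9681784, .mk 0 1416 0x11b08cec1afe8e267e72d3df8cd2d93dff403d693596f6360794c9ab9b811d045fbd5d2b980af40b0b989c90623764812a8949680ee45ce3748c5e026ae8a0f181cfc386e88018199ae0d0de08b98eaad 12542184, .mk 0 1419 0x2e63d9b977cbd786661c0134b55aaaf11fb4a6b885ff3266566b46114de8e3d67dcc532e0dace77972cf2194f24dfdd918b84000a42f5124a8906f5c808a98 7277672, .mk 0 1433 0x25805cf1e5c0daa194de26f461838a9bdbf81f832154a607330a5f632029d9f28eddeba8ab8f9c21edb9ddb80987d43c6d55f18daf2992c75b4da1d19c37 8433636, .mk 0 1640 0x4c16c9e014693f6fc696fde7c295c66ca72a8e9b2beb24ef3202f23f593d4eda2568daafb26407d00cfc5ceda8862a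 3716488]
def blk9 : chkS es9 = true := by decide +kernel
def es10 : List Ent := [.mk 0 1671 0x2611cf42f700bd19cb6125809e50f7442964fde34707f6210045db606e3bd51bd53cfa6fd2e2dc1d137fd897e5bfc5932a2e52e8c5d673e211657db4af779ee3d455cbbffaf4146c553f55 12628068, .mk 0 1677 0xc8ce3fdb7f0ec2a16a920fd0b37d2806a466d04e343525c5303af95b81e5f89bcff6498fa554 1262984, .mk 0 1695 0x187a2ccc7892c98553c4b5a7027b41b50cee410bcae4c0f8ae5fc1c5adaa6dd7dac8b5887c3831ef7050f86b826022e31adec2749930542863af2aa2e0 9703480, .mk 0 1737 0x8e1880bc02d17bba3b0e74f02fe068e672fa390802ebf25e083f166fa88ac604ead7406cd2af5b322910da33e5878ce0 3087084, .mk 0 1755 0x21d57336e89a6693f5f63390a675cdd09fdbd21cfd3d81106149f5ae24ca8f95a1a3d1724802afedb9d8fe06d88c 4523360, .mk 0 1769 0xdc282414e33aabb53a1a4fc4bbbb6996cec76eb80d4296f7e39aae41562731b87da293798544c59ac95c6cff09bcc6cb 3069048]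
def blk10 : chkS es10 = true := by decide +kernel
def es11 : List Ent := [.mk 0 1774 0x51d564bbef152faf609646952d1009154419628020afc340613075fda00f5a1956ee072bc8cb4e203b4a719880e7da4c0dcd2baca6704784 4497032, .mk 0 1786 0x73962d1b32256a4e3a07fcf58cad85d5e418d88a0a209a9d8f2f221cd1a6159c0fe164ba2a66f61bf4a4ff15 3170832, .mk 0 1788 0xc0f5aa1874ad213f71e976783bf05801b3eea53383af0ff4181bb529e9040f0f66ee80620baabf895f285f1f5739cb516e426f5249417c4d84c287a211dd28e29 9601036, .mk 0 1914 0x6cc1b5d9dced38562529f8799c74010b3fcd699ffef3f639026bafb5bd590a737eb4dd1056de7efb5e0834abb4daebe15e06ff70f6d3a3de18ba6d24461cecaa22af4ccd 7274924, .mk 0 1929 0x196de4539cc559b7997dcd94603152aed414d4ea283a0a9931fee020b564c496a7ceaaeee3de0032fde484aa7e590007b6d51c0ab8e 3775096, .mk 0 1966 0x8bfe7216dd4693b4309f2811431a1b56e7f89b45794f44b0225313dfb46b48841855bf9fa0d9de87f7a438f0467ba7be7d03803409b9eff7e34cf1b99eebf70f8 11046824]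
def blk11 : chkS es11 = true := by decide +kernel
def es12 : List Ent := [.mk 0 1981 0x3d88174b18ba0a7efb1fa3e5cf2e1de55ef4300c07090604f825eb2bc1a2c03a81d974864f8e1e0d7a7be06b3a4907843a8971ec8b1cf1 5273760, .mk 0 1998 0x1e4644edf46702d4cf11abce79d6be9aa2ceb6904928d4d8a01fa0adc3c0c34e16228f7b1039e0f593f3be4c6b858b1b27b9b2da13d48ea0db61aaffbe814c91ce64c41d932ebd74649b8dda07013dd2ee8fa9e5947dc6b28a 22028492, .mk 0 2042 0x3fd3267d3f9f0eecdae30cf4fa3944327722ebab3adc06820a508569c16d3bbf30bc6aa07b210647b0 2036836, .mk 0 2250 0x67279103e1242627baf733a5124cc2003110e5decce2425114097de3688d4dce8132034fc8e49455a8cf985dc0c88ca87f209b3 2010268, .mk 0 2255 0x6ca16707e798cf44b94459801edbab523f8ade64843b7b77a516677dd07a4b90eebeb998f689ef1173435be929bf63743e3f7e4bcfae5a4900bed7ba3719cde 3747400, .mk 0 2282 0x2a03b6c6491e71936bbcc6825fb53c575cfd5e5295ab14684b00cfe8185cc525214c263d 1602420]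
def blk12 : chkS es12 = true := by decide +kernel
def es13 : List Ent := [.mk 0 2298 0x333dd0d3a01487f8657760ef1ee2dcb06cef9977e5084825f4622073452472bd8fc5b29d8484743829edd9c2cc9a45afda8a18016334a61b9e6b014cbdf46df5e69e9ea1c9f7f5de2d04834d701bf3eeabc7bfab4036ce4fd1a 14200636, .mk 0 2479 0x627ae6970a6411af3d387e7406d8933957ea70991d914ebe6b361a12db0a2d62112d6be0c9af1bdc13ccd8b01007ea45819123fb7c1dae7603c 7243040, .mk 0 2511 0x692cdbc10ed652b252976465297b4829ba4b9033893572c42eca85d468984ea0982f88d57dd17e0fa2917bea1f1191f7551b84d919f92d5df05469a69be6c75a1468354af044c2b3fe36ada81ed17ea9684ea0886bef6761cf54786d 32560404, .mk 0 2750 0x176edfce18f4c2899d592887b6ba193efcfdac6113475e8bc7e5f8096d84916b1428f53a53c3b3ce83c 6283912, .mk 0 3021 0x21ec88faa1d82c85fd7da74593d2df6002863a34a9c13e1e9afbcfac0178be78a78e5642e67d92eca89ed 1657524, .mk 0 3071 0x115c595bff249656b2069a1c974440d2fe07a635e867836d139f9970982b3006790d174d6abb120b1e3794f14d746d83cef3b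 2533424]
def blk13 : chkS es13 = true := by decide +kernel
def es14 : List Ent := [.mk 0 3310 0x14f9eb2c2c121cbf06cbebfaecb8051c7a2702c18cb5d3ad90fd428fb3cf4dde49a6eb644004348d246 2009308, .mk 1 33 0x752a1a1556b2f1ddadfeb9d597e465883f670e63ffdc34e6d9024ff4e3a762ce26018fc92bfa2dc2c2e9aa876deb58f5c74a393bda0 6327292, .mk 1 34 0xd0aecc48bb4e6473b6aac2f3c08dc7868dc64aaf8ff29f11999f064532e5b09a70ef16c291379e3482cf03f395c2480b42ec479d18a86bd79fbfde9d 5332620, .mk 1 81 0x1800926c74fda9b369e077a3f952a248fc56804d09c4f078efde090681e3ef91687810d4815bb4b83d41096d65ec2da7d3f673843e42f0a 8362140, .mk 1 143 0x28f7252cf92a755561044004869e7bbb0e9a31400e943362040a7d1289d2e6a588cdf99028801f38462412ea886b7057e3bc83fa5b42c488a62a 7310144, .mk 1 170 0x2103c4454a1a867941aa837897156ef4094fd79879fde94a5eb6b3a65f3c33810931ded9121e84f3717036862b39d1df42bb07531eae7ce3ca97b722550 5371224]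
def blk14 : chkS es14 = true := by decide +kernel
def es15 : List Ent := [.mk 1 177 0x195ef00dd944fdc28488d3d9466a629d8504d3adcb8266f030ffa8d4c76cba30ef1583f9952d35b92907fc7474ed447d07b52 2529860, .mk 1 197 0x220ace0b3d39d44ff8cb482b6b535f9848a098471fdab1bbdbeebd4cdc3fcb3a1aff573df682628c44d7260fe770 4620548, .mk 1 212 0x339612e2cdcc7aa8e4caaab83de6640957d40b32055e6081d6190a95b13a6bcf55e888ac07ae9f7018de7896e02766ed8094d5cb 4459304, .mk 1 297 0x3932bb96ec6c0dee8aa1b598fe68a1641cee7bdabcc59d18c376b412d2eb9202ae8d49eb94ea705ed67e5fac36709c911394cd52babf2 3260376, .mk 1 302 0x287c34ebd9ba5a271fb2d83725f3cf7aac85e9f61e51b1c5fbc5382dd2c81aae87710c9b8a64208ea765b365f18c1457f632 5329740, .mk 1 310 0xb4361d6b137b5572deab94245ee722bf816ccb438821d1fdb10303fd83ec1f36faa0883eb47c33609f899b9197dac0a8c30f6d7007e2feb5f4a7566204fd13c3c98a7e7a9abdc00c 9637564]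
def blk15 : chkS es15 = true := by decide +kernel
def es16 : List Ent := [.mk 1 344 0xc6a2a8dd50859f7f939ea2aabe2c954c880aff029ba7c637fc731a249cf9c72f45a3628ebaf7b3beba817824e22ce3d651a7289f01d4fbc065d7c3a291 12448548, .mk 1 361 0x2493a41421773a9146241c76fdb896b5b0e23aa8473188e7aee4e0aa356a00dfe41eb2f70069ac1fe35c0eb065266a539834 4531256, .mk 1 366 0x5b2f939af245d64a350c54cc7d91cab78dde3afd9151fa7910df2b396cdab497ce517a80fe3f29824518d11779fc9b5fe6436b8a2742c56a385268 6230380, .mk 1 376 0xe2dd8acca7b053e8abe666eb01fb515674e221f57c6192d0df9b55179cbd9879cc6c75feae6a8ab194eade7830da0c3fa351a4d9a0aada564c09929c4c53633a9f 6491668, .mk 1 389 0xbddbf1d9bfdc6c92c1ce11f8e96b0c6935e9d207f3fa82f83530f60e2a570df9822a3cbdb7af681fba42cfac9ca697be85f68de8dec1ba6287b8c71c5de1f90dacef592220b1dbd62b 8497956, .mk 1 405 0xd090ba1aaeb91a96ee09f1056334b78a3cb0d7578cfc53450e71dbc07c595500438bd5504f5833ceff9a4a9a3a448ffe2f7079c3967528b574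 4476428]
def blk16 : chkS es16 = true := by decide +kernel
def es17 : List Ent := [.mk 1 442 0x1aed38c70b7f9100e3f86ac38d764c734047fdfdf5dccdf48934ca0d8fe23172e4529ba698a55f5298a0716ac92009d96a57e966bacb1b91aaa436d18956ec6c769c082daab70c302b 15798548, .mk 1 460 0x35c7d9efcb56f06990cc7772528cd7dd89f12c0ba85ca50fb2d9929c07edbdefcb3c2ef0b14afdac4d05ce9f218bb43e8b0a4f4 2027428, .mk 1 474 0xab6339388146b1a7c4143507f8208965f886e70554ecfcb79a85c0cd1fd98a2be167e602b9ecec90bee2938c263df3adeb47af30d6d338fb61c77c3d26cc5519bfd8ec929e93330 15819656, .mk 1 501 0x3a87bcabd0f59ac91f9ed0bb267c2f85ab20b69fa736a337d722477a2d329cf184afdee024c249930072b505f8b5f858e18a1c 4488656, .mk 1 585 0x3c841e3b7c586f63f01b3585039a48d71d8e307dfdccebae4ea07b36ae07de79b6227b16e8ab297798fa2449eaacd49ef2f9a93dffccb14cfc4b1d7bd6627d 7294496, .mk 1 618 0x180a267cc97d5ffe8ddc8f41d308778f14409714a0adf577fda6e62f80986d9ddb9afec6102395a9cdae983b32827e164556241d56cd1ac9165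 4492076]
def blk17 : chkS es17 = true := by decide +kernel
def es18 : List Ent := [.mk 1 622 0xb4b0b37e1915cc9281690021b98b722aa57e1087008ac18ec58216f264ddcb1963b84c8a 1604556, .mk 1 663 0x32e9563c1abe72d5f409bd4a58f1b81898baa9fefae20f9eb7ee2be862ed4c9e600d8d6fc83253de5f4cf505424b5194f622d706cbe8b94ceb27ad5a7b38cf87e428e675af4aadf1a004b3fd28c34a1deb5 11027480, .mk 1 696 0x1030b3399e7a6c15136106aeb08a1bb4c4ec635ed118861c3eba1c3a3b191c7ade1a1c55fc90432db9c81cafae204624fefbfccfae05d52e755 3712456, .mk 1 713 0x16d26dff2ddd4103ada177f4a858a7c942ef8f25993fbe5714e0a19eb9a95ed32f1ef7b639f 1605780, .mk 1 725 0x1736729394802de0985bcc6bf9ab44973495502c1ecb6c0d5e2be6b361b22df4795611925f2ae53a1a83fc009b52eda5a6389 2480804, .mk 1 749 0x110ed8a4c7e2abac8826dbef29bd92fff715f88b26f518c8cff355e9a2f115e897156ce686e65480bc29e428d6aecd6d82cb47b4dd9aef0cc7e204553f25bca92d0187d8a 7210748]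
def blk18 : chkS es18 = true := by decide +kernel
def es19 : List Ent := [.mk 1 763 0x2091c0bc8694b0263d206075cd719d6575a9894b5b829429119d333c885effeb24695b77dac6d 1244336, .mk 1 876 0x25a8030bc0267a2eea4a42a4e7d706dfc65ff091c0967bb523c20121f9d713c93b75a4a7b6497c3a998737b4af2b 4442312, .mk 1 877 0x57e2d7185f46402a705003f39081559b7476154cebf4d8344b6576107bb9069d1bee50947d8500cb53fa98d1052f12c1703d52c630a434d795ba31b8f631341f32995b4 4493372, .mk 1 886 0xef4d5285561d3e81b24750df47d0d13babdc800991547a4a7fe20b52dd3cf9200b6a05467337e4755b 2059720, .mk 1 927 0x1ed0bebf11077e11d55b96d92a440c459179ededba2c7fd9fa42069021a9af1586ef27e3daa5f6a9ca9026a147a02fb607694c27d90d8b887ae389 7252724, .mk 1 942 0x3fc914316e3740adc7b36deb3b85193eb4eac3d17190d52964249696b40e30ba73f75dfa26fbbf6a6103d33c9a0ae414f70bbee906d7d57f18a60c5c43a6820db7921620a62f209404896d779ebb 15894656]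
def blk19 : chkS es19 = true := by decide +kernel
def es20 : List Ent := [.mk 1 957 0x4e3c40814bfb93e84e895440e06692398a91aa8c146c9683fdc7e3fe1d2077a2 1602000, .mk 1 966 0x1fb6f6fa7a3a37c6e5e03e5ef8992abdc885cd2c4467500ff2a2b470138658fb875966536d326545abc3fa1f8e9c87f28a7299ba 4536704, .mk 1 973 0x3c57c340125860b902fa4b97d6fd6f65d8bb78f98d71c4cc7bba650553ace6cae03e65a5bda72f42cfaac13bd205a93f061de 2506640, .mk 1 996 0x10fc74f40d5973a6775710a3ab0a53b58bc88b705324274eb21649ff9722f28478ced4e5a1894d530aedbe024c975dcf3a39d156e1b8adba52dbd47a72f3fbeee30fbfe9f 7364276, .mk 1 1007 0x5065957da434f6bc07985d6bf73a0f3973315cbc174eaa9bb08d8e867b937c40ee1500d49697acc55200d91671642ea940fed8b660739 3169956, .mk 1 1100 0x2d6661d30345297dfd77751386f6a5ac0f3e6b4aa427f42e04fcd0b3b00ca8e465b033506d15390ed058b659932d4f01f3a8f4145b9c0de64ed53eaa2d5ef4d7f05d9a 8370684]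
def blk20 : chkS es20 = true := by decide +kernel
def es21 : List Ent := [.mk 1 1118 0x6284af81c1ce29d995ddb4dc123f2741d3bb931290a5e2b2ddea69264c8d3f58166f1f970b5754a 927220, .mk 1 1167 0x1469105d6a9d8df307b2570eac05c6e0995d81a9e9f88593ad87ae04f597ea9bd3c130375c56617f651 2059528, .mk 1 1175 0x1de0b29d3b2217f962ad03785145bba8e532050bb1536b8bda659b98875795487456101a19949fb4147ba3121739d1fa92c 3167940, .mk 1 1224 0x11f22013467984d80b94280030de63206cbe93590b2aba85038a3cbe5e6c5b0ac77c433bca9bb5e0b9235e223dff001f0cb7001deeb546c4a788 7207496, .mk 1 1228 0x3c91d9602c7ea8842fc44f2edcb6212eb48165e4973b8cfe581023305d1f9ca9ecac0fd0799c62f543f5c02a10c7fd55a837f5848f5d075b32fa85ada2f3 9589444, .mk 1 1243 0x1901c9c113a89fdced684d580f7906a5913fe9de8e5a0e47e5ef44274fa68262f1ee00f3a75987ed3ad464321203be497184cbff3bb2fe59f43e75fd7b5fd7fd5ecd36fdbadc1c8e4f55f28680876475d516761c4e 19907164]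
def blk21 : chkS es21 = true := by decide +kernel
def es22 : List Ent := [.mk 1 1270 0x621a3c902d87d57b4d8130260af5f1d9615d002a5eed099efed89f0544d69ecc9328bf8653c9fa085c8774ca96cbc232 3769768, .mk 1 1389 0xbeb802ee91e2f8bbdb261743e3b20aaa4540ba7a65756f932cccc9fcce8b98eb41d18a55af55d94c060cb99a82999fa2b438434c4f 3047772, .mk 1 1405 0x58e0beeea5a3e771a32673f8046ad175dcf2282916e68cae80de243b471d550630e97842fc07de6e7d997c50c7281476886037032ab097314884f271767fd130545ae2 9781192, .mk 1 1423 0x337e36b07a16d4ba633aa85474981c736a3b84e577c6c43d4f27ed18a1b36a93045e0f96015a97823269a5eb10d3a8318778f77df285dcb03cf11dce32aa9071ebf0e95ec03acd76220382d4223bfe75bfffe8978de68e9930280b7fb4e8d637b09 17681124, .mk 1 1529 0x7e60fae0bb4a9f48fd5df89b27e7a7c11b8931111367249929482086f19b61c42bf8 923140, .mk 1 1661 0x11c59211e115bd1340d3f384d12b6644967001e33b38047f49ec169a0baa5e078295d2c078e839f59e2a 3734908]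
def blk22 : chkS es22 = true := by decide +kernel
def es23 : List Ent := [.mk 1 1691 0x853932d6dcdb2a71579085e0d170e2ff10dee856eecf1d3cb0d896b9c871d62b 1223828, .mk 1 1719 0x14de010c5e8350ef9cc68fde680348a0fdc5c47bcea70001be1c8d5297ca2ea29fceee4afabc7412dd6 2067100, .mk 1 1721 0x85b926a9551f008b5d9a29c4414a27896d8d3aea5b9cd77dccdc7cd466a38bd4a5a203f53d689326c380ab5d93efc011abe0f82ef686cd1124b3e526abd3ea69 7294148, .mk 1 1756 0x1b43e48230623f084fb99c88ab2aa0bf4fd79bbb4b58b06de8e311eaa77489e9c2477127fe417dcbbfce28bf4e9ffba2d03 3221436, .mk 1 1791 0x1d72493959e7cb76cfc3ddeeab268a1c5fe427132372467f4993df4bce8440b2650cdd2de82f55d94022c942 3116028, .mk 1 1914 0xaa111972a61a7ca9ad1db36430b2aaa6c3091127abcb453cf1fee5f2b6c7690d9ecce62c60304cb5ace9bf27e95772a18c5a74f85f69 3084660]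
def blk23 : chkS es23 = true := by decide +kernel
def es24 : List Ent := [.mk 1 1919 0x33de0a2f83c10a9ac20deb895b308e588201dd78d8ddb9704e212adaa78d03dccb8f8da9a569682309f5ace7b93ee8b89937ee6c56cdc556a6a84faec200f975f48c52c1b9ae1e7aaf6a378aaf84cd4cb29 10942892, .mk 1 1929 0x4a027a7d48fe4d4cd9295fc8711ca3143ff937367b6ca8127f729b5fda3b6de50456eea7a8b68620e87e2658d0a3088d8aa453c82e7e916142d537dd15ae0506385d4e31812188155d41 12530520, .mk 1 1934 0x7f959c7e3c1df6148a056b4064d59352bbb99055abc18f773c22819337db59d684ae4fd779d13525ea24ddc0a1ff6658defe09d79f2dc598c2a34d5846d93699 7352756, .mk 1 1993 0xccbe23ad0a9f59b568dee6db256db1ef9ccab21ee21d6cc1c386b1d70cd9597100172a97c53e860803ff152fb 4502444, .mk 1 2223 0xa2e9e03fd1415412fa48d7d381ec694b9f42566219b4d35d3b7ee96f58765518e9a6dd3dd45b60ea20e77f121c999cc9a19cfb78ed92b48 8462244, .mk 1 2282 0x34230dc7bf2765e899530066834dacce1d862de2defb4ad138197e6ca61556dac658ad1a6a1e9b9d4c5cbef054e7f34a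 3723988]
def blk24 : chkS es24 = true := by decide +kernel
def es25 : List Ent := [.mk 1 2461 0x1f5a7c736d2e6a7728451cd7843f3a0163d70977151fc2613369c3952d4825f1b674fca5ad6100e44d7787e7bd7395b5bf0f0bbb80ded94523b8f79d6f9f8 4511396, .mk 1 2539 0x407b5dad1511e79927e6f2e6a06771fe7b98348ba518f2d9888366e5e966cfe1c9724887f5a608e4f5495f5ff4e5d23ae73abf9468468175e36cd8e0319dfb1347f0d632fc984d31c940b5b9276513435ff2479d5b98c12c8fc 14120524, .mk 1 2733 0x70af2be0eb48ce62f2ac47b335d01a98a58d61558608d1c6e6ed201f52046f52418702ad5e8ef4b 942196, .mk 1 2780 0x498f3404973ddd095f46f8436053987a6dac8028ef001b501dc267128bfa9e481f6ce4355e832c3916212460c4a8b95a168e3933c840d7542806196037c73 4482308, .mk 1 2782 0x1bc55225869b2831abbf719b48d24a6a419f39f83d43e12fa907cb661a7938845269c76fe641c1e6b8a8d73cc721d014abe 3090000, .mk 1 3022 0xf80f4a3e209a0d9beb319219bc3d4329af849521c9a8ddbde1a34406133c363262c336416f63c0bc8ed6 1592376]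
def blk25 : chkS es25 = true := by decide +kernel
def es26 : List Ent := [.mk 1 3310 0x10e8a9465f7ae4797ea1c0ed89a87f0d99744a1644b5ac595a2d49797fd661c6d391de560d2306a437d7284e5146245cab89c6e4090034e891515751594bc730ad7a214a9 7280060, .mk 1 3567 0x8537eae4d8b6e55b9850d76a7beedba5d434ee23aa32728f7062c70cb3ca697b 1600068]
def blk26 : chkS es26 = true := by decide +kernel

def allE : List Ent := es0 ++ (es1 ++ (es2 ++ (es3 ++ (es4 ++ (es5 ++ (es6 ++ (es7 ++ (es8 ++ (es9 ++ (es10 ++ (es11 ++ (es12 ++ (es13 ++ (es14 ++ (es15 ++ (es16 ++ (es17 ++ (es18 ++ (es19 ++ (es20 ++ (es21 ++ (es22 ++ (es23 ++ (es24 ++ (es25 ++ (es26))))))))))))))))))))))))))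

theorem allE_ok : ∀ e ∈ allE, e.P := by
  intro e h
  unfold allE at h
  rcases List.mem_append.1 h with h | h
  · exact chkS_spec blk0 e h
  rcases List.mem_append.1 h with h | h
  · exact chkS_spec blk1 e h
  rcases List.mem_append.1 h with h | h
  · exact chkS_spec blk2 e h
  rcases List.mem_append.1 h with h | h
  · exact chkS_spec blk3 e h
  rcases List.mem_append.1 h with h | h
  · exact chkS_spec blk4 e h
  rcases List.mem_append.1 h with h | h
  · exact chkS_spec blk5 e h
  rcases List.mem_append.1 h with h | h
  · exact chkS_spec blk6 e h
  rcases List.mem_append.1 h with h | h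
  · exact chkS_spec blk7 e h
  rcases List.mem_append.1 h with h | h
  · exact chkS_spec blk8 e h
  rcases List.mem_append.1 h with h | h
  · exact chkS_spec blk9 e h
  rcases List.mem_append.1 h with h | h
  · exact chkS_spec blk10 e h
  rcases List.mem_append.1 h with h | h
  · exact chkS_spec blk11 e h
  rcases List.mem_append.1 h with h | h
  · exact chkS_spec blk12 e h
  rcases List.mem_append.1 h with h | h
  · exact chkS_spec blk13 e h
  rcases List.mem_append.1 h with h | h
  · exact chkS_spec blk14 e h
  rcases List.mem_append.1 h with h | h
  · exact chkS_spec blk15 e h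
  rcases List.mem_append.1 h with h | h
  · exact chkS_spec blk16 e h
  rcases List.mem_append.1 h with h | h
  · exact chkS_spec blk17 e h
  rcases List.mem_append.1 h with h | h
  · exact chkS_spec blk18 e h
  rcases List.mem_append.1 h with h | h
  · exact chkS_spec blk19 e h
  rcases List.mem_append.1 h with h | h
  · exact chkS_spec blk20 e h
  rcases List.mem_append.1 h with h | h
  · exact chkS_spec blk21 e h
  rcases List.mem_append.1 h with h | h
  · exact chkS_spec blk22 e h
  rcases List.mem_append.1 h with h | h
  · exact chkS_spec blk23 e h
  rcases List.mem_append.1 h with h | h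
  · exact chkS_spec blk24 e h
  rcases List.mem_append.1 h with h | h
  · exact chkS_spec blk25 e h
  exact chkS_spec blk26 e h

def Ent.c : Ent → ℕ
  | .mk c _ _ _ => c
def Ent.k : Ent → ℕ
  | .mk _ k _ _ => k
def Ent.v : Ent → ℕ
  | .mk _ _ _ v => v

theorem allE_len : allE.length = 158 := by decide +kernel
theorem allE_bd : (allE.all fun e => Nat.ble e.c 1 && Nat.ble e.k 4094) = true := by decide +kernel
theorem allE_nd : (allE.map Ent.v).Nodup := by decide +kernel
theorem allE_cov : ∀ c < 2, ∀ k ∈ keys c, (allE.any fun e => Nat.beq e.c c && Nat.beq e.k k) = true := by decide +kernel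

theorem res_of (e : Ent) (h : e ∈ allE) : Res e.c e.k e.v := by
  have h1 := List.all_eq_true.1 allE_bd e h
  rw [Bool.and_eq_true] at h1
  have h2 : e.c ≤ 1 := Nat.le_of_ble_eq_true h1.1
  have h3 : e.k ≤ 4094 := Nat.le_of_ble_eq_true h1.2
  have h4 := allE_ok e h
  obtain ⟨c, k, s, v⟩ := e
  exact h4 (lt_of_le_of_lt h2 (by norm_num)) (lt_of_le_of_lt h3 (by norm_num))

def ent (i : Fin 158) : Ent := allE[i.val]'(by rw [allE_len]; exact i.isLt)

theorem ent_mem (i : Fin 158) : ent i ∈ allE := List.getElem_mem _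

noncomputable def rep (i : Fin 158) : Submodule (ZMod 2) V := code (U 1 (2 + (ent i).c) (ent i).k)

theorem rep_inj (i j : Fin 158) (h : CodeEquiv (rep i) (rep j)) : i = j := by
  have e := inv_ce h
  have h1 := (res_of _ (ent_mem i)).2.2
  have h2 := (res_of _ (ent_mem j)).2.2
  change inv (code _) = inv (code _) at e
  rw [h1, h2] at e
  have e' : (ent i).v = (ent j).v := Nat.eq_of_mul_eq_mul_left (by norm_num) e
  have hi : i.val < (allE.map Ent.v).length := by rw [List.length_map, allE_len]; exact i.isLt
  have hj : j.val < (allE.map Ent.v).length := by rw [List.length_map, allE_len]; exact j.isLt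
  apply Fin.ext
  apply (List.Nodup.getElem_inj_iff allE_nd (hi := hi) (hj := hj)).1
  rw [List.getElem_map, List.getElem_map]
  exact e'

theorem rep_cov {B : Matrix (Fin 46) (Fin 46) (ZMod 2)} (hB : IsBorderMatrix (n := 45) B)
    (hs : IsSelfDual (borderedDCC (n := 45) B)) (h16 : ∀ x ∈ borderedDCC (n := 45) B, x ≠ 0 → 16 ≤ hammingNorm x) :
    ∃ k, CodeEquiv (rep k) (borderedDCC (n := 45) B) := by
  obtain ⟨σ, rfl⟩ := exists_Bm hB
  obtain ⟨c, hc, k, hk, h⟩ := reduce ((selfdual_code σ).1 hs) ((good_iff σ).1 h16)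
  obtain ⟨e, he, h1⟩ := List.any_eq_true.1 (allE_cov c hc k hk)
  rw [Bool.and_eq_true] at h1
  obtain rfl : e.c = c := Nat.eq_of_beq_eq_true h1.1
  obtain rfl : e.k = k := Nat.eq_of_beq_eq_true h1.2
  obtain ⟨i, hi, rfl⟩ := List.getElem_of_mem he
  exact ⟨⟨i, allE_len ▸ hi⟩, h⟩

end BD

theorem classification_bordered_dcc_92 :
    (∃ reps : Fin 158 → Submodule (ZMod 2) (Fin 46 ⊕ Fin 46 → ZMod 2),
      (∀ k, (∃ B : Matrix (Fin 46) (Fin 46) (ZMod 2), IsBorderMatrix (n := 45) B ∧ reps k = borderedDCC (n := 45) B) ∧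
        IsSelfDual (reps k) ∧ (∀ x ∈ reps k, x ≠ 0 → 16 ≤ hammingNorm x)) ∧
      (∀ k l, CodeEquiv (reps k) (reps l) → k = l) ∧
      (∀ B : Matrix (Fin 46) (Fin 46) (ZMod 2), IsBorderMatrix (n := 45) B →
        IsSelfDual (borderedDCC (n := 45) B) →
        (∀ x ∈ borderedDCC (n := 45) B, x ≠ 0 → 16 ≤ hammingNorm x) →
        ∃ k, CodeEquiv (reps k) (borderedDCC (n := 45) B))) ∧
    (∀ B : Matrix (Fin 46) (Fin 46) (ZMod 2), IsBorderMatrix (n := 45) B →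
      IsSelfDual (borderedDCC (n := 45) B) →
      (∀ x ∈ borderedDCC (n := 45) B, x ≠ 0 → 16 ≤ hammingNorm x) →
      MinWeightIs (borderedDCC (n := 45) B) 16) := by
  refine ⟨⟨BD.rep, fun k => ⟨⟨_, BD.isBorder_Bm _, rfl⟩, ?_, ?_⟩, BD.rep_inj, fun B hB hs h16 => BD.rep_cov hB hs h16⟩, ?_⟩
  · exact (BD.selfdual_code _).2 (BD.U_uni _ _ _)
  · exact (BD.good_iff _).2 (BD.res_of _ (BD.ent_mem k)).1
  · intro B hB hs h16
    obtain ⟨k, hk⟩ := BD.rep_cov hB hs h16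
    obtain ⟨S, hS⟩ := (BD.res_of _ (BD.ent_mem k)).2.1
    exact ⟨BD.ce_min16 hk (BD.exists16 hS), h16⟩
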